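/- (Verma's Theorem for root-reductive Lie algebras.) Let g be a root-reductive Lie algebra with splitting maximal toral subalgebra h and Dynkin Borel subalgebra b ⊇ h. For λ ∈ h* and a positive root α such that s_α·λ ≼ λ, there exists an embedding of the Verma module M(s_α·λ) into M(λ). -/

import Mathlib

noncomputable section
namespace Paper

variable (K : Type) [Field K] [IsAlgClosed K] [CharZero K]
variable (g : Type) [LieRing g] [LieAlgebra K g]

def adWeightSpace (h : LieSubalgebra K g) (α : Module.Dual K h) : Submodule K g where
  carrier := {x | ∀ H : h, ⁅(H : g), x⁆ = α H • x}
  add_mem' := by intro a b ha hb H; rw [lie_add, ha H, hb H, smul_add]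
  zero_mem' := by intro H; rw [lie_zero, smul_zero]
  smul_mem' := by intro c x hx H; rw [lie_smul, hx H, smul_comm]

def IsRootOf (h : LieSubalgebra K g) (α : Module.Dual K h) : Prop :=
  α ≠ 0 ∧ adWeightSpace K g h α ≠ ⊥

def IsToralIn (s t : LieSubalgebra K g) : Prop :=
  t ≤ s ∧ IsLieAbelian t ∧
    s.toSubmodule ≤ ⨆ α : Module.Dual K t, s.toSubmodule ⊓ adWeightSpace K g t α

def IsMaxToralIn (s t : LieSubalgebra K g) : Prop :=
  IsToralIn K g s t ∧ ∀ t' : LieSubalgebra K g, IsToralIn K g s t' → t ≤ t' → t' = t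

/-- A root-reductive Lie algebra `g` together with a splitting maximal toral subalgebra `h`
and a splitting Borel subalgebra `b ⊇ h` determined by a set `pos` of positive roots. -/
structure Setup where
  /-- the exhausting chain of finite-dimensional reductive subalgebras -/
  F : ℕ → LieSubalgebra K g
  F_mono : Monotone F
  F_exhaust : ∀ x : g, ∃ n, x ∈ F n
  F_findim : ∀ n, FiniteDimensional K (F n)
  /-- each `F n` is reductive: every abelian ideal is central -/
  F_reductive : ∀ n, ∀ I : LieIdeal K (F n), IsLieAbelian I → I ≤ LieAlgebra.center K (F n)
  /-- the nested chain of Cartan subalgebras witnessing the root inclusions -/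
  C : ℕ → LieSubalgebra K g
  C_mono : Monotone C
  C_le : ∀ n, C n ≤ F n
  C_cartan : ∀ n, (LieSubalgebra.comap (F n).incl (C n)).IsCartanSubalgebra
  /-- each inclusion `F n ↪ F (n+1)` is a root inclusion with respect to `C (n+1)`:
  every root space of `F n` relative to `C n` is a root space of `F (n+1)` -/
  C_rootIncl : ∀ n, ∀ α : Module.Dual K (C n), α ≠ 0 →
    (F n).toSubmodule ⊓ adWeightSpace K g (C n) α ≠ ⊥ →
    ∃ β : Module.Dual K (C (n + 1)),
      (F n).toSubmodule ⊓ adWeightSpace K g (C n) α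
        = (F (n + 1)).toSubmodule ⊓ adWeightSpace K g (C (n + 1)) β
  /-- the splitting maximal toral subalgebra -/
  h : LieSubalgebra K g
  h_maxToral : ∀ n, IsMaxToralIn K g (F n) (h ⊓ F n)
  /-- `g` is the direct sum of its `h`-weight spaces -/
  h_indep : iSupIndep fun α : Module.Dual K h => adWeightSpace K g h α
  h_span : (⨆ α : Module.Dual K h, adWeightSpace K g h α) = ⊤
  /-- the set `Δ⁺` of positive roots -/
  pos : Set (Module.Dual K h)
  pos_root : ∀ α ∈ pos, IsRootOf K g h α
  pos_add : ∀ α ∈ pos, ∀ β ∈ pos, IsRootOf K g h (α + β) → α + β ∈ pos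
  pos_polar : ∀ α : Module.Dual K h, IsRootOf K g h α → (α ∈ pos ↔ ¬(-α ∈ pos))
  neg_add : ∀ α β : Module.Dual K h, IsRootOf K g h α → IsRootOf K g h β →
    α ∉ pos → β ∉ pos → IsRootOf K g h (α + β) → α + β ∉ pos
  /-- the splitting Borel subalgebra -/
  b : LieSubalgebra K g
  b_eq : b.toSubmodule = h.toSubmodule ⊔ ⨆ α ∈ pos, adWeightSpace K g h α


variable {K g}

namespace Setup

variable (S : Setup K g)

/-- `h ∩ g_n`. -/
def hn (n : ℕ) : LieSubalgebra K g := S.h ⊓ S.F n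

/-- restriction of a functional on `h` to `h ∩ g_n`. -/
def resDual (n : ℕ) (lam : Module.Dual K S.h) : Module.Dual K (S.hn n) :=
  lam.comp (LieSubalgebra.inclusion (inf_le_left : S.hn n ≤ S.h)).toLinearMap

/-- the `α`-root space of `g_n` relative to `h ∩ g_n`. -/
def rootSpaceN (n : ℕ) (α : Module.Dual K (S.hn n)) : Submodule K g :=
  (S.F n).toSubmodule ⊓ adWeightSpace K g (S.hn n) α

/-- the set of `b`-positive roots of `g_n`. -/
def posRootsN (n : ℕ) : Set (Module.Dual K (S.hn n)) :=
  {α | α ≠ 0 ∧ S.rootSpaceN n α ≠ ⊥ ∧ S.rootSpaceN n α ≤ S.b.toSubmodule}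

/-- `ρ_n`, the half sum of the positive roots of `g_n` with respect to `b ∩ g_n`. -/
def rhoN (n : ℕ) : Module.Dual K (S.hn n) :=
  (2 : K)⁻¹ • ∑ᶠ α ∈ S.posRootsN n, α

/-- `α` is a simple `b`-positive root: it is positive and cannot be written as a sum of
two or more positive roots. -/
def IsSimpleRoot (α : Module.Dual K S.h) : Prop :=
  α ∈ S.pos ∧ ¬∃ s : Multiset (Module.Dual K S.h),
    2 ≤ Multiset.card s ∧ (∀ β ∈ s, β ∈ S.pos) ∧ s.sum = α

/-- `b` is a Dynkin Borel subalgebra: it is generated, as a Lie subalgebra, by `h` together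
with the simple root spaces. -/
def IsDynkin : Prop :=
  S.b = LieSubalgebra.lieSpan K g
    ((S.h : Set g) ∪ ⋃ α ∈ {α | S.IsSimpleRoot α}, (adWeightSpace K g S.h α : Set g))

/-- the partial order `≼` on `h^*`: `lam ≼ mu` iff `mu - lam` is a `ℤ≥0`-linear combination
of positive roots. -/
def wle (lam mu : Module.Dual K S.h) : Prop :=
  ∃ s : Multiset (Module.Dual K S.h), (∀ β ∈ s, β ∈ S.pos) ∧ mu - lam = s.sum

/-- `g` is locally semisimple: each `g_n` is a semisimple Lie algebra. -/
def IsLocallySemisimple : Prop := ∀ n, LieAlgebra.IsSemisimple K (S.F n)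

end Setup


/-- the universal enveloping algebra of `g`. -/
abbrev Env (K g : Type) [Field K] [LieRing g] [LieAlgebra K g] : Type :=
  UniversalEnvelopingAlgebra K g

namespace Setup

variable {K : Type} [Field K] [IsAlgClosed K] [CharZero K]
variable {g : Type} [LieRing g] [LieAlgebra K g]
variable (S : Setup K g)

/-- the nilpotent radical `n⁺ = ⨁_{α ∈ Δ⁺} g^α` of `b`, as a subspace of `g`. -/
def nplus : Submodule K g := ⨆ α ∈ S.pos, adWeightSpace K g S.h α

/-- the left ideal of `U(g)` generated by `n⁺` and the elements `H - lam(H)`, `H ∈ h`. -/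
def vermaIdeal (lam : Module.Dual K S.h) : Submodule (Env K g) (Env K g) :=
  Submodule.span (Env K g)
    ((UniversalEnvelopingAlgebra.ι K '' (S.nplus : Set g)) ∪
      Set.range fun H : S.h =>
        UniversalEnvelopingAlgebra.ι K (H : g) - algebraMap K (Env K g) (lam H))

/-- the Verma module `M(lam) = U(g)/I`. -/
abbrev Verma (lam : Module.Dual K S.h) : Type := Env K g ⧸ S.vermaIdeal lam

/-- the maximal proper submodule of the Verma module `M(lam)`,
i.e. the sum of all proper submodules. -/
def maxSub (lam : Module.Dual K S.h) : Submodule (Env K g) (S.Verma lam) :=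
  sSup {N : Submodule (Env K g) (S.Verma lam) | N ≠ ⊤}

/-- the simple module `L(lam)`, the unique simple quotient of `M(lam)`. -/
abbrev SimpleL (lam : Module.Dual K S.h) : Type := S.Verma lam ⧸ S.maxSub lam

/-- `H` is the coroot `h_α` of the root `α`:  `α(H) = 2` and `H ∈ [g^α, g^{-α}]`. -/
def IsCoroot (α : Module.Dual K S.h) (H : S.h) : Prop :=
  α H = 2 ∧ ∃ x ∈ adWeightSpace K g S.h α, ∃ y ∈ adWeightSpace K g S.h (-α),
    (H : g) = ⁅x, y⁆

/-- the dot-reflection `s_α · mu = mu - (mu + ρ)(h_α) α` associated to a root `α`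
with coroot `Hα`, relative to the half sum `ρ` of positive roots. -/
def dotReflect (ρ α : Module.Dual K S.h) (Hα : S.h) (mu : Module.Dual K S.h) :
    Module.Dual K S.h :=
  mu - ((mu + ρ) Hα) • α

/-- `ρ` is the global half sum of positive roots: its restriction to each `h ∩ g_n`
is the half sum `ρ_n` of positive roots of `g_n`. -/
def IsGlobalRho (ρ : Module.Dual K S.h) : Prop := ∀ n : ℕ, S.resDual n ρ = S.rhoN n

/-- `lam` is strongly linked to `mu` (relative to `ρ`). -/
inductive StronglyLinked (ρ : Module.Dual K S.h) :
    Module.Dual K S.h → Module.Dual K S.h → Prop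
  | refl (mu : Module.Dual K S.h) : StronglyLinked ρ mu mu
  | step {lam mu : Module.Dual K S.h} (α : Module.Dual K S.h) (Hα : S.h) :
      α ∈ S.pos → S.IsCoroot α Hα →
      S.wle (S.dotReflect ρ α Hα mu) mu →
      StronglyLinked ρ lam (S.dotReflect ρ α Hα mu) →
      StronglyLinked ρ lam mu

/-- `lam` is antidominant: `(lam + ρ)(h_α)` is not a positive integer
for any positive root `α`. -/
def IsAntidominant (ρ lam : Module.Dual K S.h) : Prop :=
  ∀ α ∈ S.pos, ∀ Hα : S.h, S.IsCoroot α Hα → ¬∃ k : ℕ, 0 < k ∧ (lam + ρ) Hα = (k : K)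

/-- `lam` is almost antidominant: `(lam + ρ)(h_α)` is a positive integer
for only finitely many positive roots `α`. -/
def IsAlmostAntidominant (ρ lam : Module.Dual K S.h) : Prop :=
  {α | α ∈ S.pos ∧ ∃ Hα : S.h, S.IsCoroot α Hα ∧
    ∃ k : ℕ, 0 < k ∧ (lam + ρ) Hα = (k : K)}.Finite

end Setup

namespace Setup

variable {K : Type} [Field K] [IsAlgClosed K] [CharZero K]
variable {g : Type} [LieRing g] [LieAlgebra K g]
variable (S : Setup K g)

/-- the reflection `s_α : mu ↦ mu - mu(h_α) α`, as a linear map on `h^*`. -/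
def reflectionMap (α : Module.Dual K S.h) (Hα : S.h) :
    Module.Dual K S.h →ₗ[K] Module.Dual K S.h where
  toFun mu := mu - mu Hα • α
  map_add' mu ν := by
    simp only [LinearMap.add_apply, add_smul]
    abel
  map_smul' c mu := by
    simp only [LinearMap.smul_apply, RingHom.id_apply, smul_sub, smul_smul, smul_eq_mul]

/-- the reflection `s_α` associated to a root `α` with coroot `Hα`,
as a linear automorphism of `h^*`. -/
def reflection (α : Module.Dual K S.h) (Hα : S.h) (h2 : α Hα = 2) :
    Module.Dual K S.h ≃ₗ[K] Module.Dual K S.h :=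
  LinearEquiv.ofInvolutive (S.reflectionMap α Hα) (by
    intro mu
    show S.reflectionMap α Hα (mu - mu Hα • α) = mu
    show (mu - mu Hα • α) - ((mu - mu Hα • α) Hα) • α = mu
    rw [LinearMap.sub_apply, LinearMap.smul_apply, h2, smul_eq_mul]
    module)

/-- the Weyl group of `g`, realized as the group of linear automorphisms of `h^*`
generated by the reflections in the roots. -/
def weylGroup : Subgroup (Module.Dual K S.h ≃ₗ[K] Module.Dual K S.h) :=
  Subgroup.closure
    {w | ∃ (α : Module.Dual K S.h) (Hα : S.h) (hc : S.IsCoroot α Hα),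
      IsRootOf K g S.h α ∧ w = S.reflection α Hα hc.1}

/-- the dot action `w · mu = w(mu + ρ) - ρ`. -/
def dotAct (ρ : Module.Dual K S.h) (w : Module.Dual K S.h ≃ₗ[K] Module.Dual K S.h)
    (mu : Module.Dual K S.h) : Module.Dual K S.h :=
  w (mu + ρ) - ρ

/-- the root lattice `Λ`, the `ℤ`-span of the roots in `h^*`. -/
def rootLattice : Submodule ℤ (Module.Dual K S.h) :=
  Submodule.span ℤ {α : Module.Dual K S.h | IsRootOf K g S.h α}

end Setup

end Paper

set_option linter.unusedSectionVars false

namespace Paper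

section SlTwo
variable {K M : Type*} [Field K] [CharZero K] [AddCommGroup M] [Module K M]

/-- Three operators satisfying the `sl₂` relations, possibly all zero. -/
structure SlTwoOps (H E F : Module.End K M) : Prop where
  EF : E * F - F * E = H
  HE : H * E - E * H = (2 : K) • E
  HF : H * F - F * H = -((2 : K) • F)

namespace SlTwoOps
variable {H E F : Module.End K M}

theorem EF_apply (t : SlTwoOps H E F) (v : M) : E (F v) = F (E v) + H v := by
  have := LinearMap.congr_fun t.EF v
  simp only [LinearMap.sub_apply, Module.End.mul_apply] at this
  rw [← this]; abel

theorem HE_apply (t : SlTwoOps H E F) (v : M) : H (E v) = E (H v) + (2 : K) • E v := by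
  have := LinearMap.congr_fun t.HE v
  simp only [LinearMap.sub_apply, Module.End.mul_apply, LinearMap.smul_apply] at this
  rw [← this]; abel

theorem HF_apply (t : SlTwoOps H E F) (v : M) : H (F v) = F (H v) - (2 : K) • F v := by
  have := LinearMap.congr_fun t.HF v
  simp only [LinearMap.sub_apply, Module.End.mul_apply, LinearMap.smul_apply,
    LinearMap.neg_apply] at this
  rw [sub_eq_add_neg, ← this]; abel

theorem H_F_pow (t : SlTwoOps H E F) {v : M} {μ : K} (hv : H v = μ • v) (n : ℕ) :
    H ((F ^ n) v) = (μ - 2 * n) • (F ^ n) v := by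
  induction n with
  | zero => simp [hv]
  | succ n ih =>
    rw [pow_succ', Module.End.mul_apply, t.HF_apply, ih, map_smul, ← sub_smul]
    congr 1; push_cast; ring

theorem E_F_pow_succ (t : SlTwoOps H E F)
    {v : M} {μ : K} (hv : H v = μ • v) (he : E v = 0) (n : ℕ) :
    E ((F ^ (n + 1)) v) = ((n + 1) * (μ - n)) • (F ^ n) v := by
  induction n with
  | zero => simp [t.EF_apply, he, hv]
  | succ n ih =>
    rw [pow_succ', Module.End.mul_apply, t.EF_apply, ih, t.H_F_pow hv, map_smul,
      ← Module.End.mul_apply, ← pow_succ', ← add_smul]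
    congr 1; push_cast; ring

theorem E_pow_F_pow (t : SlTwoOps H E F) {v : M} {μ : K} (hv : H v = μ • v) (he : E v = 0) (n : ℕ) :
    (E ^ n) ((F ^ n) v) = (∏ i ∈ Finset.range n, ((i + 1) * (μ - i))) • v := by
  induction n with
  | zero => simp
  | succ n ih =>
    rw [pow_succ, Module.End.mul_apply, t.E_F_pow_succ hv he, map_smul, ih, smul_smul,
      Finset.prod_range_succ]
    congr 1; ring

theorem exists_nat (t : SlTwoOps H E F)
    {v : M} {μ : K} (hv : H v = μ • v) (he : E v = 0) (h0 : v ≠ 0) {N : ℕ}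
    (hN : (F ^ N) v = 0) : ∃ m : ℕ, μ = m := by
  by_contra! h
  have hp := t.E_pow_F_pow hv he N
  rw [hN, map_zero] at hp
  rcases smul_eq_zero.1 hp.symm with h1 | h1
  · obtain ⟨i, -, hi⟩ := Finset.prod_eq_zero_iff.1 h1
    rcases mul_eq_zero.1 hi with h2 | h2
    · exact Nat.cast_add_one_ne_zero i h2
    · exact h i (sub_eq_zero.1 h2)
  · exact h0 h1

theorem E_pow_F_pow_ne_zero (t : SlTwoOps H E F)
    {v : M} {m : ℕ} (hv : H v = (m : K) • v) (he : E v = 0) :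
    ∃ c : K, c ≠ 0 ∧ (E ^ m) ((F ^ m) v) = c • v := by
  refine ⟨_, ?_, t.E_pow_F_pow hv he m⟩
  rw [Finset.prod_ne_zero_iff]
  intro i hi
  have : i < m := Finset.mem_range.1 hi
  refine mul_ne_zero (Nat.cast_add_one_ne_zero i) (sub_ne_zero.2 ?_)
  exact_mod_cast this.ne'

end SlTwoOps
end SlTwo
end Paper

namespace Paper

section Parity
open LieModule

variable {K L V W : Type*} [Field K] [CharZero K] [LieRing L] [LieAlgebra K L]
  [AddCommGroup V] [Module K V] [LieRingModule L V] [LieModule K L V] [FiniteDimensional K V]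
  [AddCommGroup W] [Module K W]

theorem SlTwoOps.exists_F_pow_eq_zero {H E F : Module.End K V} (t : SlTwoOps H E F)
    {v : V} {μ : K} (hv : H v = μ • v) : ∃ N, (F ^ N) v = 0 := by
  by_contra! h
  refine Set.infinite_of_injective_forall_mem (f := fun n : ℕ => μ - 2 * (n : K)) ?_ ?_
    H.finite_hasEigenvalue
  · intro a b hab
    simpa using hab
  · intro n
    exact Module.End.hasEigenvalue_of_hasEigenvector
      ⟨Module.End.mem_eigenspace_iff.2 (t.H_F_pow hv n), h n⟩

variable (V) in
/-- elements of `L` acting on `V` with degree `2 * j` for the grading given by `H`. -/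
def evenDegree (H : L) (j : ℤ) : Submodule K L where
  carrier := {x | ∀ v : V, ⁅⁅H, x⁆, v⁆ = (2 * j : K) • ⁅x, v⁆}
  add_mem' := by intro a b ha hb v; rw [lie_add, add_lie, ha, hb, add_lie, smul_add]
  zero_mem' := by intro v; simp
  smul_mem' := by intro c x hx v; rw [lie_smul, smul_lie, hx, smul_lie, smul_comm]

theorem evenDegree_lie {H x y : L} {i j : ℤ} (hx : x ∈ evenDegree (K := K) V H i)
    (hy : y ∈ evenDegree (K := K) V H j) : ⁅x, y⁆ ∈ evenDegree (K := K) V H (i + j) := by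
  intro v
  rw [leibniz_lie, add_lie, lie_lie, hx, hx, lie_lie, hy, hy, lie_smul, lie_smul, lie_lie]
  push_cast
  module

theorem evenDegree_apply {H x : L} {i : ℤ} (hx : x ∈ evenDegree (K := K) V H i) {v : V} {μ : K}
    (hv : ⁅H, v⁆ = μ • v) : ⁅H, ⁅x, v⁆⁆ = (μ + 2 * i) • ⁅x, v⁆ := by
  rw [leibniz_lie, hx, hv, lie_smul]; module

theorem exists_isotropic_of_even_eigenvalue [IsAlgClosed K] (A : LieSubalgebra K L)
    [LieRing.IsNilpotent A] [FiniteDimensional K A] (H E F : L)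
    (t : SlTwoOps (toEnd K L V H) (toEnd K L V E) (toEnd K L V F))
    (hspan : ∀ x : L, x ∈ ⨆ j : ℤ, evenDegree (K := K) V H j)
    (hA : ∀ a ∈ A, a ∈ evenDegree (K := K) V H 0)
    (h0 : ∀ x ∈ evenDegree (K := K) V H 0, ∃ a ∈ A, ∀ v : V, ⁅x, v⁆ = ⁅a, v⁆)
    (ω : V →ₗ[K] V →ₗ[K] W) (hω : ∀ v, ω v v = 0)
    (hinv : ∀ (x : L) (u v : V), ω ⁅x, u⁆ v = - ω u ⁅x, v⁆)
    (n : ℤ) (hn : Even n) (v₀ : V) (hv₀ : v₀ ≠ 0) (hHv₀ : ⁅H, v₀⁆ = (n : K) • v₀) :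
    ∃ T : LieSubmodule K L V, T ≠ ⊥ ∧ ∀ u ∈ T, ∀ w ∈ T, ω u w = 0 := by
  classical
  let X : ℤ → Submodule K V := fun n => (toEnd K L V H).eigenspace (n : K)
  have hX : ∀ n v, v ∈ X n ↔ ⁅H, v⁆ = (n : K) • v := fun n v => Module.End.mem_eigenspace_iff
  have hskew : ∀ u v, ω u v = - ω v u := by
    intro u v
    have := hω (u + v)
    simp only [map_add, LinearMap.add_apply, hω, zero_add, add_zero] at this
    exact eq_neg_of_add_eq_zero_right this
  have hXind : iSupIndep X := by
    have := (toEnd K L V H).eigenspaces_iSupIndep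
    exact this.comp (f := fun n : ℤ => (n : K)) Int.cast_injective
  have hXstep : ∀ {x : L} {i n : ℤ} {v : V}, x ∈ evenDegree (K := K) V H i → v ∈ X n →
      ⁅x, v⁆ ∈ X (n + 2 * i) := by
    intro x i n v hx hv
    rw [hX] at hv ⊢
    rw [evenDegree_apply hx hv]; push_cast; rfl
  -- the largest even eigenvalue
  obtain ⟨m, ⟨hm, hXm⟩, hmax⟩ : ∃ m : ℤ, (Even m ∧ X m ≠ ⊥) ∧ ∀ n, Even n → X n ≠ ⊥ → n ≤ m := by
    have hfin : {n : ℤ | Even n ∧ X n ≠ ⊥}.Finite := by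
      have := ((toEnd K L V H).finite_hasEigenvalue).preimage (f := fun n : ℤ => (n : K))
        (Int.cast_injective.injOn)
      exact this.subset fun n hn => hn.2
    obtain ⟨m, hm, hmm⟩ := Set.exists_max_image _ id hfin
      ⟨n, hn, fun h => hv₀ (by simpa [h] using (hX n v₀).2 hHv₀)⟩
    exact ⟨m, hm, fun n h1 h2 => hmm n ⟨h1, h2⟩⟩
  have htop : ∀ {x : L} {i : ℤ} {v : V}, x ∈ evenDegree (K := K) V H i → v ∈ X m → 0 < i →
      ⁅x, v⁆ = 0 := by
    intro x i v hx hv hi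
    by_contra hne
    have := hmax (m + 2 * i) (hm.add (even_two_mul i))
      fun h => hne (by simpa [h] using hXstep hx hv)
    omega
  -- a common eigenvector of `A`
  obtain ⟨v, hvm, hv0, χ, hvA⟩ : ∃ v ∈ X m, v ≠ 0 ∧ ∃ χ : L → K, ∀ a ∈ A, ⁅a, v⁆ = χ a • v := by
    let Y : LieSubmodule K A V := { X m with
      lie_mem := by
        intro a v hv
        have := hXstep (hA a a.2) hv
        rwa [mul_zero, add_zero] at this }
    have : Nontrivial Y := by
      have := Submodule.nontrivial_iff_ne_bot.2 hXm
      exact this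
    obtain ⟨χ, hχ⟩ := exists_nontrivial_weightSpace_of_isNilpotent K A Y
    obtain ⟨⟨w, hw⟩, hw0⟩ := exists_ne (0 : weightSpace Y χ)
    refine ⟨w, w.2, fun h => hw0 ?_, fun a => if h : a ∈ A then χ ⟨a, h⟩ else 0, fun a ha => ?_⟩
    · ext; exact h
    · have := (LieModule.mem_weightSpace _ _ |>.1 hw) ⟨a, ha⟩
      simp only [dif_pos ha]
      exact congrArg Subtype.val this
  have hE : E ∈ evenDegree (K := K) V H 1 := by
    intro v
    have := t.HE_apply v
    simp only [toEnd_apply_apply] at this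
    rw [lie_lie, this]; push_cast; module
  have hF : F ∈ evenDegree (K := K) V H (-1) := by
    intro v
    have := t.HF_apply v
    simp only [toEnd_apply_apply] at this
    rw [lie_lie, this]; push_cast; module
  have hHv : ⁅H, v⁆ = (m : K) • v := (hX m v).1 hvm
  have hEv : ⁅E, v⁆ = 0 := htop hE hvm one_pos
  obtain ⟨k, rfl⟩ : ∃ k : ℕ, m = k := by
    obtain ⟨N, hN⟩ := t.exists_F_pow_eq_zero (v := v) hHv
    obtain ⟨k, hk⟩ := t.exists_nat (v := v) hHv hEv hv0 hN
    exact ⟨k, by exact_mod_cast hk⟩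
  push_cast at hHv
  -- the submodule generated by `v`
  let lower : Submodule K V → Prop := fun N =>
    ∀ i : ℤ, i < 0 → ∀ x ∈ evenDegree (K := K) V H i, ∀ t ∈ N, ⁅x, t⁆ ∈ N
  let T : Submodule K V := sInf {N | v ∈ N ∧ lower N}
  have hTle : ∀ N : Submodule K V, v ∈ N → lower N → T ≤ N := fun N h1 h2 => sInf_le ⟨h1, h2⟩
  have hvT : v ∈ T := Submodule.mem_sInf.2 fun N hN => hN.1
  have hTlow : lower T := fun i hi x hx t ht =>
    Submodule.mem_sInf.2 fun N hN => hN.2 i hi x hx t (Submodule.mem_sInf.1 ht N hN)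
  have hTup : ∀ i : ℤ, 0 ≤ i → ∀ x ∈ evenDegree (K := K) V H i, ∀ t ∈ T, ⁅x, t⁆ ∈ T := by
    let T' : Submodule K V :=
      { carrier := {t | t ∈ T ∧ ∀ i : ℤ, 0 ≤ i → ∀ x ∈ evenDegree (K := K) V H i, ⁅x, t⁆ ∈ T}
        add_mem' := fun {a b} ha hb => ⟨T.add_mem ha.1 hb.1, fun i hi x hx => by
          rw [lie_add]; exact T.add_mem (ha.2 i hi x hx) (hb.2 i hi x hx)⟩
        zero_mem' := ⟨T.zero_mem, fun i hi x hx => by rw [lie_zero]; exact T.zero_mem⟩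
        smul_mem' := fun c a ha => ⟨T.smul_mem c ha.1, fun i hi x hx => by
          rw [lie_smul]; exact T.smul_mem c (ha.2 i hi x hx)⟩ }
    have : T ≤ T' := by
      refine hTle T' ⟨hvT, ?_⟩ ?_
      · intro i hi x hx
        rcases hi.eq_or_lt with rfl | hi
        · obtain ⟨a, ha, hxa⟩ := h0 x hx
          rw [hxa, hvA a ha]
          exact T.smul_mem _ hvT
        · rw [htop hx hvm hi]; exact T.zero_mem
      · intro j hj f hf t ht
        refine ⟨hTlow j hj f hf t ht.1, fun i hi x hx => ?_⟩
        rw [leibniz_lie]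
        refine T.add_mem ?_ (hTlow j hj f hf _ (ht.2 i hi x hx))
        have hxf := evenDegree_lie hx hf
        rcases lt_or_ge (i + j) 0 with h | h
        · exact hTlow _ h _ hxf t ht.1
        · exact ht.2 _ h _ hxf
    exact fun i hi x hx t ht => (this ht).2 i hi x hx
  have hTall : ∀ x : L, ∀ t ∈ T, ⁅x, t⁆ ∈ T := by
    intro x t ht
    refine Submodule.iSup_induction _ (motive := fun x => ⁅x, t⁆ ∈ T) (hspan x) ?_ ?_ ?_
    · intro i x hx
      rcases lt_or_ge i 0 with h | h
      · exact hTlow i h x hx t ht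
      · exact hTup i h x hx t ht
    · rw [zero_lie]; exact T.zero_mem
    · intro x y hx hy; rw [add_lie]; exact T.add_mem hx hy
  -- `T` is graded, with top component spanned by `v`
  have hThom : T ≤ ⨆ n, T ⊓ X n := by
    refine hTle _ (Submodule.mem_iSup_of_mem (k : ℤ) ⟨hvT, hvm⟩) ?_
    intro i hi x hx t ht
    refine Submodule.iSup_induction _ (motive := fun t => ⁅x, t⁆ ∈ ⨆ n, T ⊓ X n) ht ?_ ?_ ?_
    · intro n t ht
      exact Submodule.mem_iSup_of_mem (n + 2 * i) ⟨hTlow i hi x hx t ht.1, hXstep hx ht.2⟩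
    · rw [lie_zero]; exact Submodule.zero_mem _
    · intro a b ha hb; rw [lie_add]; exact Submodule.add_mem _ ha hb
  have hTtop : ∀ t ∈ T, t ∈ X k → ∃ c : K, t = c • v := by
    intro t ht htk
    have hle : T ≤ (K ∙ v) ⊔ ⨆ (n : ℤ) (_ : n < k), X n := by
      refine hTle _ (Submodule.mem_sup_left (Submodule.mem_span_singleton_self v)) ?_
      intro i hi x hx t ht
      obtain ⟨a, ha, b, hb, rfl⟩ := Submodule.mem_sup.1 ht
      apply Submodule.mem_sup_right
      rw [lie_add]
      refine Submodule.add_mem _ ?_ ?_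
      · obtain ⟨c, rfl⟩ := Submodule.mem_span_singleton.1 ha
        rw [lie_smul]
        refine Submodule.smul_mem _ _ ?_
        exact Submodule.mem_iSup_of_mem (k + 2 * i)
          (Submodule.mem_iSup_of_mem (by omega) (hXstep hx hvm))
      · simp only [iSup_subtype'] at hb ⊢
        refine Submodule.iSup_induction _
          (motive := fun b => ⁅x, b⁆ ∈ ⨆ n : {n : ℤ // n < k}, X n) hb ?_ ?_ ?_
        · rintro ⟨n, hn⟩ b hb
          exact Submodule.mem_iSup_of_mem ⟨n + 2 * i, by omega⟩ (hXstep hx hb)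
        · rw [lie_zero]; exact Submodule.zero_mem _
        · intro a b ha hb; rw [lie_add]; exact Submodule.add_mem _ ha hb
    obtain ⟨a, ha, b, hb, hab⟩ := Submodule.mem_sup.1 (hle ht)
    obtain ⟨c, rfl⟩ := Submodule.mem_span_singleton.1 ha
    have hb' : b ∈ ⨆ (n : ℤ) (_ : n ≠ k), X n :=
      (iSup_mono fun n => iSup_mono' fun h => ⟨ne_of_lt h, le_rfl⟩ :
        (⨆ (n : ℤ) (_ : n < k), X n) ≤ ⨆ (n : ℤ) (_ : n ≠ k), X n) hb
    have hbk : b ∈ X k := by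
      rw [← add_sub_cancel_left (c • v) b, hab]
      exact Submodule.sub_mem _ htk (Submodule.smul_mem _ _ hvm)
    have := (Submodule.disjoint_def.1 (hXind k)) b hbk hb'
    exact ⟨c, by rw [← hab, this, add_zero]⟩
  -- `v` is orthogonal to `T`
  have hpow : ∀ (x : L) (n : ℕ) (u w : V),
      ω ((toEnd K L V x ^ n) u) w = (-1 : K) ^ n • ω u ((toEnd K L V x ^ n) w) := by
    intro x n
    induction n with
    | zero => simp
    | succ n ih =>
      intro u w
      rw [pow_succ', Module.End.mul_apply, toEnd_apply_apply, hinv, ih, ← pow_succ',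
        pow_succ (toEnd K L V x), Module.End.mul_apply, toEnd_apply_apply, pow_succ, mul_neg_one,
        neg_smul]
  have hk : (-1 : K) ^ k = 1 := by
    have : Even k := by exact_mod_cast hm
    exact this.neg_one_pow
  have hvFv : ω v ((toEnd K L V F ^ k) v) = 0 := by
    have h1 := hpow F k v v
    rw [hk, one_smul, hskew] at h1
    have h2 : (2 : K) • ω v ((toEnd K L V F ^ k) v) = 0 := by
      rw [two_smul]; nth_rewrite 1 [← h1]; exact neg_add_cancel _
    exact (smul_eq_zero.1 h2).resolve_left two_ne_zero
  have hEpow : ∀ (j : ℕ) (n : ℤ), ∀ w ∈ T ⊓ X n,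
      (toEnd K L V E ^ j) w ∈ T ⊓ X (n + 2 * j) := by
    intro j n w hw
    induction j with
    | zero => simpa using hw
    | succ j ih =>
      rw [pow_succ', Module.End.mul_apply, toEnd_apply_apply]
      refine ⟨hTall E _ ih.1, ?_⟩
      have := hXstep hE ih.2
      rwa [show n + 2 * ((j + 1 : ℕ) : ℤ) = n + 2 * j + 2 * 1 by push_cast; ring]
  have hvT0 : ∀ w ∈ T, ω v w = 0 := by
    intro w hw
    refine Submodule.iSup_induction _ (motive := fun w => ω v w = 0) (hThom hw) ?_ ?_ ?_
    · intro n w hw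
      by_cases hn : n = -k
      · have h1 := hEpow k n w hw
        rw [hn, show (-k + 2 * k : ℤ) = k by ring] at h1
        obtain ⟨c, hc⟩ := hTtop _ h1.1 h1.2
        obtain ⟨d, hd, hdv⟩ := t.E_pow_F_pow_ne_zero (v := v) hHv hEv
        have h2 : d • ω v w = 0 := by
          rw [← LinearMap.smul_apply, ← map_smul, ← hdv, hpow, hk, one_smul, hc, map_smul, hskew,
            hvFv, neg_zero, smul_zero]
        exact (smul_eq_zero.1 h2).resolve_left hd
      · have h1 := hinv H v w
        rw [hHv, (hX n w).1 hw.2, map_smul, LinearMap.smul_apply, map_smul, eq_neg_iff_add_eq_zero,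
          ← add_smul] at h1
        refine (smul_eq_zero.1 h1).resolve_left fun h => hn ?_
        have : ((k + n : ℤ) : K) = 0 := by push_cast; exact h
        have := Int.cast_eq_zero.1 this
        omega
    · simp
    · intro a b ha hb; rw [map_add, ha, hb, add_zero]
  have hT0 : ∀ u ∈ T, ∀ w ∈ T, ω u w = 0 := by
    let T₀ : Submodule K V :=
      { carrier := {u | ∀ w ∈ T, ω u w = 0}
        add_mem' := fun {a b} ha hb w hw => by rw [map_add, LinearMap.add_apply, ha w hw, hb w hw,
          add_zero]
        zero_mem' := fun w hw => by simp
        smul_mem' := fun c a ha w hw => by rw [map_smul, LinearMap.smul_apply, ha w hw, smul_zero] }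
    have : T ≤ T₀ := hTle T₀ hvT0 fun i hi x hx t ht w hw => by
      rw [hinv, ht _ (hTall x w hw), neg_zero]
    exact this
  refine ⟨{ T with lie_mem := fun {x t} ht => hTall x t ht }, fun h => hv0 ?_, hT0⟩
  have : v ∈ (⊥ : LieSubmodule K L V) := h ▸ (show v ∈ T from hvT)
  simpa using this
end Parity
end Paper

namespace Paper

section
variable {K L : Type*} [Field K] [CharZero K] [IsAlgClosed K] [LieRing L] [LieAlgebra K L]
  [FiniteDimensional K L]

open LieAlgebra LieModule

/-- Every abelian ideal is central. -/
def AbelianIdealsCentral (K L : Type*) [Field K] [LieRing L] [LieAlgebra K L] : Prop :=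
  ∀ I : LieIdeal K L, IsLieAbelian I → I ≤ LieAlgebra.center K L

theorem AbelianIdealsCentral.le_center (hL : AbelianIdealsCentral K L) (I : LieIdeal K L)
    (h : ∀ x ∈ I, ∀ y ∈ I, ⁅x, y⁆ = 0) : I ≤ LieAlgebra.center K L :=
  hL I ⟨fun x y => Subtype.ext (h x x.2 y y.2)⟩

theorem mem_center_iff {x : L} : x ∈ LieAlgebra.center K L ↔ ∀ y : L, ⁅y, x⁆ = 0 :=
  LieModule.mem_maxTrivSubmodule _ _ _ _

theorem lie_center {x : L} (hx : x ∈ LieAlgebra.center K L) (y : L) : ⁅y, x⁆ = 0 :=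
  mem_center_iff.1 hx y

theorem center_lie {x : L} (hx : x ∈ LieAlgebra.center K L) (y : L) : ⁅x, y⁆ = 0 := by
  rw [← lie_skew, lie_center hx, neg_zero]

theorem exists_radical_weight (X : LieIdeal K L) (hX : ¬ X ≤ LieAlgebra.center K L) :
    ∃ (χ : radical K L → K) (Y : LieIdeal K L), Y ≤ X ∧ ¬ Y ≤ LieAlgebra.center K L ∧
      (∀ (r : radical K L), ∀ y ∈ Y, ⁅(r : L), y⁆ - χ r • y ∈ LieAlgebra.center K L) := by
  let Z := LieAlgebra.center K L
  let V : LieSubmodule K L (L ⧸ Z) := LieSubmodule.map (LieSubmodule.Quotient.mk' Z) X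
  have : Nontrivial V := by
    obtain ⟨x, hx, hxZ⟩ := SetLike.not_le_iff_exists.1 hX
    refine ⟨⟨⟨LieSubmodule.Quotient.mk' Z x, LieSubmodule.mem_map_of_mem hx⟩, 0, ?_⟩⟩
    intro h
    exact hxZ ((LieSubmodule.Quotient.mk_eq_zero' (N := Z)).1 (Subtype.ext_iff.1 h))
  obtain ⟨χ, hχ⟩ := LieModule.exists_nontrivial_weightSpace_of_isSolvable K (radical K L) V
  let W : LieSubmodule K L V := LieModule.weightSpaceOfIsLieTower K V (χ : radical K L → K)
  let Y : LieIdeal K L := X ⊓ LieSubmodule.comap (LieSubmodule.Quotient.mk' Z) (LieSubmodule.map V.incl W)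
  have hY : ∀ y, y ∈ Y ↔ y ∈ X ∧ ∃ w ∈ W, (w : L ⧸ Z) = LieSubmodule.Quotient.mk' Z y := by
    intro y
    simp [Y, LieSubmodule.mem_inf, LieSubmodule.mem_comap, LieSubmodule.mem_map]
  refine ⟨χ, Y, inf_le_left, ?_, ?_⟩
  · obtain ⟨⟨w, hw⟩, hw0⟩ := exists_ne (0 : weightSpace V χ)
    obtain ⟨x, hx, hxw⟩ := (LieSubmodule.mem_map ..).1 w.2
    intro hYZ
    have : x ∈ Y := (hY x).2 ⟨hx, w, hw, hxw.symm⟩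
    have := (LieSubmodule.Quotient.mk_eq_zero' (N := Z)).2 (hYZ this)
    apply hw0
    ext
    exact hxw.symm.trans this
  · rintro r y hy
    obtain ⟨hyX, w, hw, hwy⟩ := (hY y).1 hy
    have h1 : ⁅r, w⁆ = χ r • w := (LieModule.mem_weightSpace _ _ |>.1 hw) r
    have h2 : ⁅(r : L), (w : L ⧸ Z)⁆ = χ r • (w : L ⧸ Z) := congrArg Subtype.val h1
    rw [hwy] at h2
    apply (LieSubmodule.Quotient.mk_eq_zero' (N := Z)).1
    have : (LieSubmodule.Quotient.mk' Z) (⁅(r : L), y⁆ - χ r • y) =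
      ⁅(r : L), LieSubmodule.Quotient.mk' Z y⁆ - χ r • LieSubmodule.Quotient.mk' Z y := by
      rw [map_sub, map_smul, LieModuleHom.map_lie]
    exact this.trans (by rw [h2, sub_self])

theorem AbelianIdealsCentral.exists_radical_trivial (hL : AbelianIdealsCentral K L)
    (X : LieIdeal K L) (hX : ¬ X ≤ LieAlgebra.center K L)
    (hXX : ∀ x ∈ X, ∀ y ∈ X, ⁅x, y⁆ ∈ LieAlgebra.center K L) :
    ∃ Y : LieIdeal K L, Y ≤ X ∧ ¬ Y ≤ LieAlgebra.center K L ∧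
      ∀ r ∈ radical K L, ∀ y ∈ Y, ⁅r, y⁆ ∈ LieAlgebra.center K L := by
  obtain ⟨χ, Y, hYX, hYZ, hχ⟩ := exists_radical_weight X hX
  refine ⟨Y, hYX, hYZ, fun r hr y hy => ?_⟩
  by_cases h0 : χ ⟨r, hr⟩ = 0
  · simpa [h0] using hχ ⟨r, hr⟩ y hy
  · exfalso
    apply hYZ
    refine hL.le_center Y fun x hx y hy => ?_
    have h1 := lie_center (hXX x (hYX hx) y (hYX hy)) r
    have h2 := center_lie (hχ ⟨r, hr⟩ x hx) y
    have h3 := lie_center (hχ ⟨r, hr⟩ y hy) x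
    rw [sub_lie, sub_eq_zero, smul_lie] at h2
    rw [lie_sub, sub_eq_zero, lie_smul] at h3
    rw [leibniz_lie, h2, h3, ← two_smul K, smul_smul] at h1
    simpa [h0] using h1

theorem lie_lie_eq_zero {I J : LieIdeal K L} {u : L}
    (h : ∀ i ∈ I, ∀ j ∈ J, ⁅⁅i, j⁆, u⁆ = 0) {y : L} (hy : y ∈ ⁅I, J⁆) : ⁅y, u⁆ = 0 := by
  rw [← LieSubmodule.mem_toSubmodule, LieSubmodule.lieIdeal_oper_eq_linear_span'] at hy
  induction hy using Submodule.span_induction with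
  | mem x hx => obtain ⟨i, hi, j, hj, rfl⟩ := hx; exact h i hi j hj
  | zero => simp
  | add x y _ _ hx hy => rw [add_lie, hx, hy, add_zero]
  | smul c x _ hx => rw [smul_lie, hx, smul_zero]

theorem AbelianIdealsCentral.radical_lie_le (hL : AbelianIdealsCentral K L)
    (I : LieIdeal K L) (hI : ∀ x ∈ I, ∀ y ∈ I, ⁅x, y⁆ ∈ LieAlgebra.center K L) :
    ⁅radical K L, I⁆ ≤ LieAlgebra.center K L := by
  by_contra hX
  have hle : ⁅radical K L, I⁆ ≤ I := LieSubmodule.lie_le_right _ _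
  obtain ⟨Y, hYX, hYZ, hY⟩ := hL.exists_radical_trivial ⁅radical K L, I⁆ hX
    fun x hx y hy => hI x (hle hx) y (hle hy)
  apply hYZ
  refine hL.le_center Y fun x hx u hu => lie_lie_eq_zero (fun r hr v hv => ?_) (hYX hx)
  rw [lie_lie, lie_center (hI v hv u (hle (hYX hu))), lie_center (hY r hr u hu), sub_zero]

theorem AbelianIdealsCentral.radical_lie_radical (hL : AbelianIdealsCentral K L)
    {x y : L} (hx : x ∈ radical K L) (hy : y ∈ radical K L) :
    ⁅x, y⁆ ∈ LieAlgebra.center K L := by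
  let D := derivedSeriesOfIdeal K L
  have key : ∀ k, D (k + 2) (radical K L) ≤ LieAlgebra.center K L →
      D (k + 1) (radical K L) ≤ LieAlgebra.center K L := by
    intro k hk
    have hk' : ⁅D (k+1) (radical K L), D (k+1) (radical K L)⁆ ≤ LieAlgebra.center K L := by
      rwa [← derivedSeriesOfIdeal_succ]
    have h1 := hL.radical_lie_le (D (k + 1) (radical K L))
      fun x hx y hy => hk' (LieSubmodule.lie_mem_lie hx hy)
    have hR : D k (radical K L) ≤ radical K L := derivedSeriesOfIdeal_le_self _ k
    refine hL.le_center _ fun x hx u hu => ?_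
    have hx' : x ∈ ⁅D k (radical K L), D k (radical K L)⁆ := by
      rwa [← derivedSeriesOfIdeal_succ]
    refine lie_lie_eq_zero (fun p hp q hq => ?_) hx'
    rw [lie_lie, lie_center (h1 (LieSubmodule.lie_mem_lie (hR hq) hu)),
      lie_center (h1 (LieSubmodule.lie_mem_lie (hR hp) hu)), sub_zero]
  have hsol : IsSolvable (radical K L) := inferInstance
  obtain ⟨k, hk⟩ := (LieAlgebra.isSolvable_iff K (radical K L)).1 hsol
  have hk' : D k (radical K L) = ⊥ := (LieIdeal.derivedSeries_eq_bot_iff _ k).1 hk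
  have h0 : D (k + 1) (radical K L) ≤ LieAlgebra.center K L := by
    have : D (k+1) (radical K L) ≤ D k (radical K L) := derivedSeriesOfIdeal_succ_le _ k
    exact (this.trans hk'.le).trans bot_le
  have h1 : ∀ k, D (k + 1) (radical K L) ≤ LieAlgebra.center K L →
      D 1 (radical K L) ≤ LieAlgebra.center K L := by
    intro k
    induction k with
    | zero => exact id
    | succ k ih => exact fun h => ih (key k h)
  apply h1 k h0
  change _ ∈ derivedSeriesOfIdeal K L (0 + 1) _
  rw [derivedSeriesOfIdeal_succ, derivedSeriesOfIdeal_zero]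
  exact LieSubmodule.lie_mem_lie hx hy

end
end Paper

namespace Paper

section Principal
open LieModule LieAlgebra

variable {K L : Type*} [Field K] [CharZero K] [IsAlgClosed K] [LieRing L] [LieAlgebra K L]
  [FiniteDimensional K L]

/-- In a Killing Lie algebra there is a principal `sl₂`, and all roots take nonzero even
values on its neutral element. -/
theorem exists_principal_sl2 [IsKilling K L] (A : LieSubalgebra K L) [A.IsCartanSubalgebra] :
    ∃ (H : A) (E F : L), ⁅E, F⁆ = H ∧ ⁅(H : L), E⁆ = (2 : K) • E ∧ ⁅(H : L), F⁆ = -((2 : K) • F) ∧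
      ∀ α : Weight K A L, α.IsNonZero → ∃ n : ℤ, n ≠ 0 ∧ α H = 2 * n := by
  classical
  obtain ⟨b⟩ := RootPairing.nonempty_base (LieAlgebra.IsKilling.rootSystem A)
  have h1 : ∃ H : A, ∀ i : b.support, (i.1.1 : Weight K A L) H = 2 := by
    let φ : Module.Dual K (Module.Dual K A) := b.toWeightBasis.constr K fun _ => (2 : K)
    refine ⟨(Module.evalEquiv K A).symm φ, fun i => ?_⟩
    have := b.toWeightBasis.constr_basis K (fun _ => (2 : K)) i
    have h2 : φ (b.toWeightBasis i) = (b.toWeightBasis i) ((Module.evalEquiv K A).symm φ) := by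
      conv_lhs => rw [← (Module.evalEquiv K A).apply_symm_apply φ]
      rfl
    rw [RootPairing.Base.toWeightBasis_apply] at h2
    exact h2.symm.trans (by simpa [φ] using this)
  obtain ⟨H, hH⟩ := h1
  have ht : ∀ i : b.support, ∃ e f : L, ⁅e, f⁆ = (IsKilling.coroot i.1.1 : A) ∧
      e ∈ rootSpace A i.1.1 ∧ f ∈ rootSpace A (-i.1.1) := by
    intro i
    have hi : (i.1.1 : Weight K A L).IsNonZero := by
      exact (Finset.mem_filter.1 i.1.2).2
    obtain ⟨h, e, f, t, he, hf⟩ := IsKilling.exists_isSl2Triple_of_weight_isNonZero hi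
    exact ⟨e, f, by rw [t.lie_e_f, t.h_eq_coroot hi he hf], he, hf⟩
  choose e f hef he hf using ht
  have hc : ∃ c : b.support → K, H = ∑ i, c i • (IsKilling.coroot i.1.1 : A) := by
    refine ⟨b.toCoweightBasis.repr H, ?_⟩
    conv_lhs => rw [← b.toCoweightBasis.sum_repr H]
    simp
  obtain ⟨c, hc⟩ := hc
  have hoff : ∀ i j, i ≠ j → ⁅e i, f j⁆ = 0 := by
    intro i j hij
    have hm := lie_mem_genWeightSpace_of_mem_genWeightSpace (he i) (hf j)
    by_contra hne
    let γ : Weight K A L := ⟨(i.1.1 : A → K) + -(j.1.1 : A → K), fun h => hne (by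
      rw [h] at hm; simpa using hm)⟩
    have hγ : γ.IsNonZero := by
      intro h0
      have : (i.1.1 : A → K) = j.1.1 := by
        have : (i.1.1 : A → K) + -(j.1.1 : A → K) = 0 := h0
        rwa [add_neg_eq_zero] at this
      exact hij (Subtype.ext (Subtype.ext (DFunLike.coe_injective this)))
    refine b.sub_notMem_range_root i.2 j.2 ⟨⟨γ, by simpa using hγ⟩, ?_⟩
    ext x
    simp [γ, sub_eq_add_neg]
  refine ⟨H, ∑ i, e i, ∑ i, c i • f i, ?_, ?_, ?_, ?_⟩
  · rw [sum_lie]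
    simp_rw [lie_sum, lie_smul]
    rw [Finset.sum_congr rfl fun i _ => Finset.sum_eq_single i
      (fun j _ hj => by rw [hoff i j hj.symm, smul_zero]) (by simp)]
    rw [hc]
    simp [hef]
  · rw [lie_sum, Finset.smul_sum]
    refine Finset.sum_congr rfl fun i _ => ?_
    have := IsKilling.lie_eq_smul_of_mem_rootSpace (he i) H
    rw [← hH i]; exact this
  · rw [lie_sum, Finset.smul_sum, ← Finset.sum_neg_distrib]
    refine Finset.sum_congr rfl fun i _ => ?_
    have := IsKilling.lie_eq_smul_of_mem_rootSpace (hf i) H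
    rw [lie_smul, ← hH i, smul_comm, ← smul_neg]
    congr 1
    rw [← neg_smul]
    exact this
  · intro α hα
    obtain ⟨n, h0, hpm, hn⟩ := b.exists_root_eq_sum_int ⟨α, by simpa using hα⟩
    have e1 := congrArg (fun φ : Module.Dual K A => φ H) hn
    refine ⟨∑ j ∈ b.support, n j, ?_, ?_⟩
    · rw [← b.height_eq_sum hn]
      exact b.height_ne_zero _
    · simp only [IsKilling.rootSystem_root_apply] at e1
      refine Eq.trans (b := (∑ j ∈ b.support, n j • (j.1 : Weight K A L).toLinear) H) e1 ?_
      rw [LinearMap.sum_apply, Int.cast_sum, Finset.mul_sum]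
      refine Finset.sum_congr rfl fun j hj => ?_
      have := hH ⟨j, hj⟩
      simp only at this
      rw [LinearMap.smul_apply, zsmul_eq_mul, mul_comm]
      congr 1

end Principal
end Paper

namespace Paper

section Lift
open LieModule LieAlgebra

variable {K L : Type*} [Field K] [LieRing L] [LieAlgebra K L]

/-- the quotient map by an ideal, as a morphism of Lie algebras. -/
def quotHom (I : LieIdeal K L) : L →ₗ⁅K⁆ L ⧸ I :=
  { (LieSubmodule.Quotient.mk' I : L →ₗ[K] L ⧸ I) with
    map_lie' := by intro x y; exact LieSubmodule.Quotient.mk_bracket I x y }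

theorem quotHom_eq_zero {I : LieIdeal K L} {x : L} : quotHom I x = 0 ↔ x ∈ I :=
  LieSubmodule.Quotient.mk_eq_zero' 

theorem quotHom_surjective (I : LieIdeal K L) : Function.Surjective (quotHom I) :=
  LieSubmodule.Quotient.surjective_mk' I

theorem hasTrivialRadical_quotient [IsNoetherian K L] :
    HasTrivialRadical K (L ⧸ radical K L) := by
  constructor
  rw [eq_bot_iff]
  set I := radical K (L ⧸ radical K L) with hI
  let J := LieIdeal.comap (quotHom (radical K L)) I
  have hmap : ∀ k, derivedSeriesOfIdeal K L k J ≤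
      LieIdeal.comap (quotHom (radical K L)) (derivedSeriesOfIdeal K _ k I) := by
    intro k
    induction k with
    | zero => exact le_rfl
    | succ k ih =>
      rw [derivedSeriesOfIdeal_succ, LieSubmodule.lie_le_iff]
      intro x hx y hy
      rw [LieIdeal.mem_comap, LieHom.map_lie, derivedSeriesOfIdeal_succ]
      exact LieSubmodule.lie_mem_lie (ih hx) (ih hy)
  have hJ : IsSolvable J := by
    obtain ⟨k, hk⟩ := IsSolvable.solvable K I
    obtain ⟨l, hl⟩ := IsSolvable.solvable K (radical K L)
    rw [LieIdeal.derivedSeries_eq_bot_iff] at hk hl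
    refine IsSolvable.mk (R := K) (k := l + k) ?_
    rw [LieIdeal.derivedSeries_eq_bot_iff, derivedSeriesOfIdeal_add, eq_bot_iff, ← hl]
    refine derivedSeriesOfIdeal_mono (fun x hx => ?_) l
    have := hmap k hx
    rw [hk, LieIdeal.mem_comap] at this
    exact quotHom_eq_zero.1 ((LieSubmodule.mem_bot _).1 this)
  intro y hy
  obtain ⟨x, rfl⟩ := quotHom_surjective _ y
  have : x ∈ radical K L := (LieIdeal.solvable_iff_le_radical K L J).1 hJ (by
    rw [LieIdeal.mem_comap]; exact hy)
  exact (LieSubmodule.mem_bot _).2 (quotHom_eq_zero.2 this)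

variable [CharZero K] [IsAlgClosed K] [FiniteDimensional K L]
variable (A : LieSubalgebra K L)

section
variable [LieRing.IsNilpotent A]
theorem quotHom_mem_genWeightSpace {I : LieIdeal K L} {χ : A → K} {x : L}
    (hx : x ∈ rootSpace A χ) : quotHom I x ∈ genWeightSpace (L ⧸ I) χ := by
  rw [mem_genWeightSpace]
  intro a
  obtain ⟨k, hk⟩ := (mem_genWeightSpace _ _ _).1 hx a
  refine ⟨k, ?_⟩
  have : ∀ (k : ℕ) (x : L), ((toEnd K A (L ⧸ I) a - χ a • 1) ^ k) (quotHom I x) =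
      quotHom I (((toEnd K A L a - χ a • 1) ^ k) x) := by
    intro k
    induction k with
    | zero => intro x; rfl
    | succ k ih =>
      intro x
      rw [pow_succ, pow_succ, Module.End.mul_apply, Module.End.mul_apply, ← ih]
      congr 1
  rw [this, hk, map_zero]

theorem exists_rootSpace_lift {I : LieIdeal K L} {χ : A → K} {y : L ⧸ I}
    (hy : y ∈ genWeightSpace (L ⧸ I) χ) : ∃ x ∈ rootSpace A χ, quotHom I x = y := by
  obtain ⟨x, rfl⟩ := quotHom_surjective I y
  have htop : x ∈ (⨆ χ : A → K, rootSpace A χ : LieSubmodule K A L) := by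
    rw [iSup_genWeightSpace_eq_top K A L]; trivial
  have hdec : ∀ x ∈ (⨆ χ : A → K, rootSpace A χ : LieSubmodule K A L), ∃ x' ∈ rootSpace A χ,
      quotHom I x - quotHom I x' ∈ ⨆ ψ ≠ χ, genWeightSpace (L ⧸ I) ψ := by
    intro x hx
    refine LieSubmodule.iSup_induction' (motive := fun x _ => ∃ x' ∈ rootSpace A χ,
      quotHom I x - quotHom I x' ∈ ⨆ ψ ≠ χ, genWeightSpace (L ⧸ I) ψ) _ ?_ ?_ ?_ hx
    · intro ψ x hx
      by_cases h : ψ = χ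
      · subst h; exact ⟨x, hx, by simp⟩
      · refine ⟨0, zero_mem _, ?_⟩
        rw [map_zero, sub_zero]
        exact LieSubmodule.mem_iSup_of_mem ψ (LieSubmodule.mem_iSup_of_mem h
          (quotHom_mem_genWeightSpace A hx))
    · exact ⟨0, zero_mem _, by simp⟩
    · rintro x y hx hy ⟨x', hx', h1⟩ ⟨y', hy', h2⟩
      refine ⟨x' + y', add_mem hx' hy', ?_⟩
      have := add_mem h1 h2
      rw [map_add, map_add]
      convert this using 1
      abel
  obtain ⟨x', hx', h⟩ := hdec x htop
  refine ⟨x', hx', ?_⟩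
  have hd := (iSupIndep_genWeightSpace K A (L ⧸ I)) χ
  have := LieSubmodule.disjoint_toSubmodule.2 hd
  rw [Submodule.disjoint_def] at this
  have hm : quotHom I x - quotHom I x' ∈ genWeightSpace (L ⧸ I) χ :=
    sub_mem hy (quotHom_mem_genWeightSpace A hx')
  have := this _ hm h
  exact (sub_eq_zero.1 this).symm
end

variable [A.IsCartanSubalgebra]

theorem mem_of_mem_rootSpace_zero {x : L} (hx : x ∈ rootSpace A (0 : A → K)) : x ∈ A := by
  rw [← zeroRootSubalgebra_eq_of_is_cartan K L A]; exact hx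

theorem isCartanSubalgebra_map (I : LieIdeal K L) :
    (A.map (quotHom I)).IsCartanSubalgebra := by
  have : LieRing.IsNilpotent (A.map (quotHom I)) := by
    let f : A →ₗ⁅K⁆ A.map (quotHom I) :=
      { toFun := fun a => ⟨quotHom I a, ⟨a, a.2, rfl⟩⟩
        map_add' := by intro a b; ext; simp
        map_smul' := by intro a b; ext; simp
        map_lie' := by intro a b; ext; simp }
    refine Function.Surjective.lieAlgebra_isNilpotent (f := f) ?_
    rintro ⟨_, ⟨a, ha, rfl⟩⟩
    exact ⟨⟨a, ha⟩, rfl⟩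
  rw [← zeroRootSubalgebra_eq_iff_is_cartan]
  refine le_antisymm ?_ (le_zeroRootSubalgebra _ _ _)
  intro y hy
  rw [mem_zeroRootSubalgebra] at hy
  have h0 : y ∈ genWeightSpace (L ⧸ I) (0 : A → K) := by
    rw [mem_genWeightSpace]
    intro a
    obtain ⟨k, hk⟩ := hy ⟨quotHom I a, ⟨a, a.2, rfl⟩⟩
    refine ⟨k, ?_⟩
    rw [Pi.zero_apply, zero_smul, sub_zero]
    exact hk
  obtain ⟨x, hx, rfl⟩ := exists_rootSpace_lift A h0
  exact ⟨x, mem_of_mem_rootSpace_zero A hx, rfl⟩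

theorem exists_weight_of_notMem {I : LieIdeal K L} [IsKilling K (L ⧸ I)]
    [(A.map (quotHom I)).IsCartanSubalgebra] {χ : A → K} {x : L}
    (hx : x ∈ rootSpace A χ) (hxI : x ∉ I) :
    ∃ α : Weight K (A.map (quotHom I)) (L ⧸ I),
      ∀ a : A, χ a = α ⟨quotHom I a, ⟨a, a.2, rfl⟩⟩ := by
  by_contra! hcon
  have htop := iSup_genWeightSpace_eq_top' K (A.map (quotHom I)) (L ⧸ I)
  have hle : ∀ y ∈ (⨆ α : Weight K (A.map (quotHom I)) (L ⧸ I), genWeightSpace (L ⧸ I) α),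
      y ∈ ⨆ ψ ≠ χ, genWeightSpace (L ⧸ I) ψ := by
    intro y hy
    refine LieSubmodule.iSup_induction' (motive := fun y _ =>
      y ∈ ⨆ ψ ≠ χ, genWeightSpace (L ⧸ I) ψ) _ ?_ (zero_mem _) (fun _ _ _ _ => add_mem) hy
    intro α y hy
    have hne : (fun a : A => α ⟨quotHom I a, ⟨a, a.2, rfl⟩⟩) ≠ χ := by
      intro h
      obtain ⟨a, ha⟩ := hcon α
      exact ha (congrFun h a).symm
    refine LieSubmodule.mem_iSup_of_mem _ (LieSubmodule.mem_iSup_of_mem hne ?_)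
    rw [mem_genWeightSpace] at hy ⊢
    intro a
    exact hy ⟨quotHom I a, ⟨a, a.2, rfl⟩⟩
  have hd := LieSubmodule.disjoint_toSubmodule.2 ((iSupIndep_genWeightSpace K A (L ⧸ I)) χ)
  rw [Submodule.disjoint_def] at hd
  exact hxI (quotHom_eq_zero.1 (hd _ (quotHom_mem_genWeightSpace A hx)
    (hle _ (by rw [htop]; trivial))))

/-- a principal `sl₂` modulo the radical together with the structure of the root spaces. -/
theorem exists_principal_lift : ∃ (H : A) (E F : L), ⁅E, F⁆ - H ∈ radical K L ∧
    ⁅(H : L), E⁆ - (2 : K) • E ∈ radical K L ∧ ⁅(H : L), F⁆ + (2 : K) • F ∈ radical K L ∧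
    (∀ a ∈ A, ∀ a' ∈ A, ⁅a, a'⁆ ∈ radical K L) ∧
    ∀ χ : A → K, χ ≠ 0 → ∀ x ∈ rootSpace A χ, x ∉ radical K L →
      (∃ n : ℤ, n ≠ 0 ∧ χ H = 2 * n) ∧
      (∀ a : A, ⁅(a : L), x⁆ - χ a • x ∈ radical K L) ∧
      (∀ y ∈ rootSpace A χ, ∃ c : K, y - c • x ∈ radical K L) ∧
      ∃ y ∈ rootSpace A (-χ), ∃ h : A, ⁅x, y⁆ = h ∧ χ h ≠ 0 := by
  have := hasTrivialRadical_quotient (K := K) (L := L)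
  set R := radical K L with hR
  have hC := isCartanSubalgebra_map A R
  obtain ⟨⟨_, ⟨H, hHA, rfl⟩⟩, E, F, h1, h2, h3, h4⟩ :=
    exists_principal_sl2 (A.map (quotHom R))
  obtain ⟨E, rfl⟩ := quotHom_surjective _ E
  obtain ⟨F, rfl⟩ := quotHom_surjective _ F
  refine ⟨⟨H, hHA⟩, E, F, ?_, ?_, ?_, ?_, ?_⟩
  · rw [← quotHom_eq_zero, map_sub, LieHom.map_lie, h1]; exact sub_self _
  · rw [← quotHom_eq_zero, map_sub, LieHom.map_lie, map_smul]; exact sub_eq_zero.2 h2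
  · rw [← quotHom_eq_zero, map_add, LieHom.map_lie, map_smul]
    exact (congrArg (· + _) h3).trans (neg_add_cancel _)
  · intro a ha a' ha'
    rw [← quotHom_eq_zero, LieHom.map_lie]
    have : IsLieAbelian (A.map (quotHom R)) := inferInstance
    have := this.trivial ⟨quotHom R a, ⟨a, ha, rfl⟩⟩ ⟨quotHom R a', ⟨a', ha', rfl⟩⟩
    exact congrArg Subtype.val this
  intro χ hχ x hx hxR
  obtain ⟨α, hα⟩ := exists_weight_of_notMem A hx hxR
  have hα0 : α.IsNonZero := by
    intro h
    refine hχ (funext fun a => ?_)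
    rw [hα a]
    exact congrFun h _
  have hmem : ∀ y ∈ rootSpace A χ, quotHom R y ∈ rootSpace (A.map (quotHom R)) α := by
    intro y hy
    have := quotHom_mem_genWeightSpace (I := R) A hy
    rw [mem_genWeightSpace] at this ⊢
    rintro ⟨_, ⟨a, ha, rfl⟩⟩
    obtain ⟨k, hk⟩ := this ⟨a, ha⟩
    refine ⟨k, ?_⟩
    rw [hα] at hk
    exact hk
  have hx0 : quotHom R x ≠ 0 := fun h => hxR (quotHom_eq_zero.1 h)
  have hfin := IsKilling.finrank_rootSpace_eq_one α hα0
  have hone : ∀ z ∈ rootSpace (A.map (quotHom R)) α, ∃ c : K, c • quotHom R x = z := by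
    intro z hz
    obtain ⟨c, hc⟩ := (finrank_eq_one_iff_of_nonzero' (⟨quotHom R x, hmem x hx⟩ :
      rootSpace (A.map (quotHom R)) α) (fun h => hx0 (congrArg Subtype.val h))).1 hfin ⟨z, hz⟩
    exact ⟨c, congrArg Subtype.val hc⟩
  refine ⟨?_, ?_, ?_, ?_⟩
  · obtain ⟨n, hn, hn'⟩ := h4 α hα0
    exact ⟨n, hn, (hα _).trans hn'⟩
  · intro a
    rw [← quotHom_eq_zero, map_sub, LieHom.map_lie, map_smul, hα, sub_eq_zero]
    exact IsKilling.lie_eq_smul_of_mem_rootSpace (hmem x hx) ⟨_, ⟨a, a.2, rfl⟩⟩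
  · intro y hy
    obtain ⟨c, hc⟩ := hone _ (hmem y hy)
    exact ⟨c, by rw [← quotHom_eq_zero, map_sub, map_smul, hc, sub_self]⟩
  · obtain ⟨h, e, f, t, he, hf⟩ := IsKilling.exists_isSl2Triple_of_weight_isNonZero hα0
    obtain ⟨c, rfl⟩ := hone e he
    have hc : c ≠ 0 := fun hc => t.e_ne_zero (by rw [hc, zero_smul])
    have hf' : f ∈ genWeightSpace (L ⧸ R) (-χ) := by
      rw [rootSpace, mem_genWeightSpace] at hf
      rw [mem_genWeightSpace]
      intro a
      obtain ⟨k, hk⟩ := hf ⟨_, ⟨a, a.2, rfl⟩⟩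
      refine ⟨k, ?_⟩
      rw [Pi.neg_apply, hα]
      exact hk
    obtain ⟨y, hy, rfl⟩ := exists_rootSpace_lift A hf'
    have hxy : ⁅x, y⁆ ∈ A := by
      refine mem_of_mem_rootSpace_zero A ?_
      have := lie_mem_genWeightSpace_of_mem_genWeightSpace hx hy
      rwa [add_neg_cancel] at this
    refine ⟨y, hy, ⟨_, hxy⟩, rfl, ?_⟩
    intro h0
    rw [hα] at h0
    have hco := t.h_eq_coroot hα0 he hf
    have h5 : α (IsKilling.coroot α) = 2 := IsKilling.root_apply_coroot hα0
    have h6 : IsKilling.coroot α = c • (⟨quotHom R ⁅x, y⁆, ⟨_, hxy, rfl⟩⟩ : A.map (quotHom R)) := by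
      ext1
      rw [← hco, ← t.lie_e_f, smul_lie]; rfl
    rw [h6] at h5
    have h7 := (Weight.toLinear K _ _ α).map_smul c
      (⟨quotHom R ⁅x, y⁆, ⟨_, hxy, rfl⟩⟩ : A.map (quotHom R))
    have h8 : c • α (⟨quotHom R ⁅x, y⁆, ⟨_, hxy, rfl⟩⟩ : A.map (quotHom R)) = 2 := h7.symm.trans h5
    rw [h0, smul_zero] at h8
    exact two_ne_zero h8.symm

theorem cartan_le_of_lie_mem (p : Submodule K L)
    (hp : ∀ χ : A → K, χ ≠ 0 → ∀ x ∈ rootSpace A χ, ∀ y ∈ rootSpace A (-χ), ⁅x, y⁆ ∈ p)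
    (hrad : ∀ x ∈ radical K L, x ∈ p) {a : L} (ha : a ∈ A) : a ∈ p := by
  have := hasTrivialRadical_quotient (K := K) (L := L)
  set R := radical K L with hR
  have hC := isCartanSubalgebra_map A R
  have hco : ∀ α : Weight K (A.map (quotHom R)) (L ⧸ R), α.IsNonZero →
      ∃ c ∈ p, quotHom R c = IsKilling.coroot α := by
    intro α hα0
    obtain ⟨h, e, f, t, he, hf⟩ := IsKilling.exists_isSl2Triple_of_weight_isNonZero hα0
    let χ : A → K := fun a => α ⟨quotHom R a, ⟨a, a.2, rfl⟩⟩
    have hlift : ∀ (β : A.map (quotHom R) → K) (z : L ⧸ R), z ∈ genWeightSpace (L ⧸ R) β →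
        ∃ x ∈ rootSpace A (fun a : A => β ⟨quotHom R a, ⟨a, a.2, rfl⟩⟩), quotHom R x = z := by
      intro β z hz
      refine exists_rootSpace_lift A ?_
      rw [mem_genWeightSpace] at hz ⊢
      intro a
      exact hz ⟨_, ⟨a, a.2, rfl⟩⟩
    obtain ⟨x, hx, rfl⟩ := hlift _ e he
    obtain ⟨y, hy, rfl⟩ := hlift _ f hf
    refine ⟨⁅x, y⁆, hp χ ?_ x hx y hy, ?_⟩
    · intro h0
      apply hα0
      funext ⟨_, ⟨a, ha, rfl⟩⟩
      exact congrFun h0 ⟨a, ha⟩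
    · rw [LieHom.map_lie, t.lie_e_f, t.h_eq_coroot hα0 he hf]
  have hspan : ∀ b : A.map (quotHom R), ∃ c ∈ p, quotHom R c = b := by
    intro b
    have hb : b ∈ Submodule.span K (Set.range (IsKilling.rootSystem (A.map (quotHom R))).coroot) := by
      rw [RootPairing.IsRootSystem.span_coroot_eq_top]; trivial
    induction hb using Submodule.span_induction with
    | mem x hx =>
      obtain ⟨α, rfl⟩ := hx
      exact hco α.1 (Finset.mem_filter.1 α.2).2
    | zero => exact ⟨0, zero_mem _, by simp⟩
    | add x y _ _ hx hy =>
      obtain ⟨c, hc, hc'⟩ := hx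
      obtain ⟨d, hd, hd'⟩ := hy
      exact ⟨c + d, add_mem hc hd, by rw [map_add, hc', hd']; rfl⟩
    | smul k x _ hx =>
      obtain ⟨c, hc, hc'⟩ := hx
      exact ⟨k • c, p.smul_mem k hc, by rw [map_smul, hc']; rfl⟩
  obtain ⟨c, hc, hc'⟩ := hspan ⟨quotHom R a, ⟨a, ha, rfl⟩⟩
  have : a - c ∈ R := by rw [← quotHom_eq_zero, map_sub, hc', sub_self]
  rw [← sub_add_cancel a c]
  exact add_mem (hrad _ this) hc

end Lift
end Paper

namespace Paper

section Reduct
open LieModule LieAlgebra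

variable {K L : Type*} [Field K] [CharZero K] [IsAlgClosed K] [LieRing L] [LieAlgebra K L]
  [FiniteDimensional K L]

variable (K L) in
/-- the centre, as a submodule of the radical. -/
abbrev centerInRadical : LieSubmodule K L (radical K L) :=
  LieSubmodule.comap (LieSubmodule.incl (radical K L)) (center K L)

variable (K L) in
/-- the radical modulo the centre. -/
abbrev RadQuot := radical K L ⧸ centerInRadical K L

theorem RadQuot.mk_eq_zero {r : radical K L} :
    (LieSubmodule.Quotient.mk r : RadQuot K L) = 0 ↔ (r : L) ∈ center K L :=
  LieSubmodule.Quotient.mk_eq_zero'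

theorem RadQuot.lie_mk (x : L) (r : radical K L) :
    (⁅x, (LieSubmodule.Quotient.mk r : RadQuot K L)⁆ : RadQuot K L) =
      LieSubmodule.Quotient.mk (⁅x, r⁆ : radical K L) := rfl

theorem AbelianIdealsCentral.lie_radQuot (hL : AbelianIdealsCentral K L) {x : L}
    (hx : x ∈ radical K L) (v : RadQuot K L) : ⁅x, v⁆ = 0 := by
  obtain ⟨r, rfl⟩ := LieSubmodule.Quotient.surjective_mk' _ v
  exact RadQuot.mk_eq_zero.2 (hL.radical_lie_radical hx r.2)

/-- the alternating form on the radical modulo the centre induced by the bracket. -/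
def AbelianIdealsCentral.form (_hL : AbelianIdealsCentral K L) :
    RadQuot K L →ₗ[K] RadQuot K L →ₗ[K] L :=
  (centerInRadical K L).toSubmodule.liftQ
    { toFun := fun r => (centerInRadical K L).toSubmodule.liftQ
        ((LieAlgebra.ad K L (r : L)).comp (radical K L).toSubmodule.subtype) (by
          intro s hs
          exact lie_center (K := K) hs _)
      map_add' := by
        intro r s
        refine Submodule.linearMap_qext _ (LinearMap.ext fun t => ?_)
        exact add_lie (r : L) (s : L) (t : L)
      map_smul' := by
        intro c r
        refine Submodule.linearMap_qext _ (LinearMap.ext fun t => ?_)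
        exact smul_lie c (r : L) (t : L) }
    (by
      intro r hr
      rw [LinearMap.mem_ker]
      refine Submodule.linearMap_qext _ (LinearMap.ext fun t => ?_)
      exact center_lie (K := K) hr _)

theorem AbelianIdealsCentral.eq_bot_of_isotropic (hL : AbelianIdealsCentral K L)
    (T : LieSubmodule K L (RadQuot K L)) (hT : ∀ u ∈ T, ∀ w ∈ T, hL.form u w = 0) : T = ⊥ := by
  rw [eq_bot_iff]
  let I : LieIdeal K L :=
    (T.comap (LieSubmodule.Quotient.mk' (centerInRadical K L))).map (LieSubmodule.incl (radical K L))
  have hI : I ≤ center K L := by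
    refine hL.le_center I ?_
    rintro x hx y hy
    obtain ⟨r, hr, rfl⟩ := (LieSubmodule.mem_map _).1 hx
    obtain ⟨s, hs, rfl⟩ := (LieSubmodule.mem_map _).1 hy
    exact hT _ hr _ hs
  intro v hv
  obtain ⟨r, rfl⟩ := LieSubmodule.Quotient.surjective_mk' _ v
  exact (LieSubmodule.mem_bot _).2 (RadQuot.mk_eq_zero.2 (hI ((LieSubmodule.mem_map _).2 ⟨r, hv, rfl⟩)))

variable (A : LieSubalgebra K L) [A.IsCartanSubalgebra]

/-- every element is the sum of an element of the Cartan subalgebra and of generalised root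
vectors. -/
theorem cartan_induction {p : L → Prop} (hadd : ∀ x y, p x → p y → p (x + y))
    (hA : ∀ a ∈ A, p a) (hroot : ∀ χ : A → K, χ ≠ 0 → ∀ x ∈ rootSpace A χ, p x) (x : L) : p x := by
  have htop : x ∈ (⨆ χ : A → K, rootSpace A χ : LieSubmodule K A L) := by
    rw [iSup_genWeightSpace_eq_top K A L]; trivial
  refine LieSubmodule.iSup_induction' (motive := fun x _ => p x) _ ?_ (hA 0 (zero_mem _))
    (fun x y _ _ => hadd x y) htop
  intro χ x hx
  by_cases h : χ = 0
  · subst h; exact hA _ (mem_of_mem_rootSpace_zero A hx)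
  · exact hroot χ h x hx

theorem AbelianIdealsCentral.exists_principal (hL : AbelianIdealsCentral K L) :
    ∃ H : A, (∀ r ∈ radical K L, ∀ n : ℤ, ⁅(H : L), r⁆ - (2 * n : K) • r ∈ center K L →
        r ∈ center K L) ∧
      (∀ a ∈ A, ∀ a' ∈ A, ⁅a, a'⁆ ∈ radical K L) ∧
    ∀ χ : A → K, χ ≠ 0 → ∀ x ∈ rootSpace A χ, x ∉ radical K L →
      (∃ n : ℤ, n ≠ 0 ∧ χ H = 2 * n) ∧
      (∀ a : A, ⁅(a : L), x⁆ - χ a • x ∈ radical K L) ∧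
      (∀ y ∈ rootSpace A χ, ∃ c : K, y - c • x ∈ radical K L) ∧
      ∃ y ∈ rootSpace A (-χ), ∃ h : A, ⁅x, y⁆ = h ∧ χ h ≠ 0 := by
  obtain ⟨H, E, F, h1, h2, h3, h4, h5⟩ := exists_principal_lift A
  refine ⟨H, ?_, h4, h5⟩
  intro r hr n hn
  by_contra hrZ
  set V := RadQuot K L
  have hact : ∀ {x y : L}, x - y ∈ radical K L → ∀ v : V, ⁅x, v⁆ = ⁅y, v⁆ := by
    intro x y h v
    have := hL.lie_radQuot h v
    rwa [sub_lie, sub_eq_zero] at this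
  have hevR : ∀ x ∈ radical K L, ∀ j, x ∈ evenDegree (K := K) V (H : L) j := by
    intro x hx j v
    rw [hL.lie_radQuot hx, hL.lie_radQuot (LieSubmodule.lie_mem _ hx), smul_zero]
  have hevA : ∀ a ∈ A, a ∈ evenDegree (K := K) V (H : L) 0 := by
    intro a ha v
    rw [hL.lie_radQuot (h4 _ H.2 _ ha)]; simp
  have hevroot : ∀ χ : A → K, χ ≠ 0 → ∀ x ∈ rootSpace A χ, x ∈ radical K L ∨ ∃ j : ℤ, j ≠ 0 ∧
      x ∈ evenDegree (K := K) V (H : L) j := by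
    intro χ hχ x hx
    by_cases hxR : x ∈ radical K L
    · exact Or.inl hxR
    · obtain ⟨⟨m, hm, hm'⟩, h6, -⟩ := h5 χ hχ x hx hxR
      refine Or.inr ⟨m, hm, fun v => ?_⟩
      rw [hact (h6 H), smul_lie, hm']
  have t : SlTwoOps (toEnd K L V (H : L)) (toEnd K L V E) (toEnd K L V F) := by
    refine ⟨?_, ?_, ?_⟩
    · ext v
      have := hact h1 v
      rw [lie_lie] at this
      exact this
    · ext v
      have := hact h2 v
      rw [lie_lie, smul_lie] at this
      exact this
    · ext v
      have := hact (x := ⁅(H : L), F⁆) (y := -((2 : K) • F)) (by rwa [sub_neg_eq_add]) v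
      rw [lie_lie, neg_lie, smul_lie] at this
      exact this
  suffices hT : ∃ T : LieSubmodule K L V, T ≠ ⊥ ∧ ∀ u ∈ T, ∀ w ∈ T, hL.form u w = 0 by
    obtain ⟨T, hT, hT'⟩ := hT
    exact hT (hL.eq_bot_of_isotropic T hT')
  refine exists_isotropic_of_even_eigenvalue (K := K) (V := V) A H E F t ?_ hevA ?_
    hL.form ?_ ?_ (2 * n) (even_two_mul n) (LieSubmodule.Quotient.mk ⟨r, hr⟩)
    (fun h => hrZ (RadQuot.mk_eq_zero.1 h)) ?_
  · refine cartan_induction A (fun _ _ => add_mem) ?_ ?_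
    · intro a ha
      exact Submodule.mem_iSup_of_mem 0 (hevA a ha)
    · intro χ hχ x hx
      obtain hxR | ⟨j, -, hj⟩ := hevroot χ hχ x hx
      · exact Submodule.mem_iSup_of_mem 0 (hevR x hxR 0)
      · exact Submodule.mem_iSup_of_mem j hj
  · let D : Module.End K (Module.End K V) := LinearMap.mulLeft K (toEnd K L V (H : L)) -
      LinearMap.mulRight K (toEnd K L V (H : L))
    have hD : ∀ {j : ℤ} {x : L}, x ∈ evenDegree (K := K) V (H : L) j →
        toEnd K L V x ∈ D.eigenspace (2 * j : K) := by
      intro j x hx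
      rw [Module.End.mem_eigenspace_iff]
      ext v
      exact (lie_lie (H : L) x v).symm.trans (hx v)
    have hdec : ∀ x : L, ∃ a ∈ A, toEnd K L V x - toEnd K L V a ∈
        ⨆ μ ≠ (0 : K), D.eigenspace μ := by
      refine cartan_induction A ?_ ?_ ?_
      · rintro x y ⟨a, ha, h⟩ ⟨a', ha', h'⟩
        refine ⟨a + a', add_mem ha ha', ?_⟩
        have := add_mem h h'
        rw [map_add, map_add]
        convert this using 1
        abel
      · intro a ha
        exact ⟨a, ha, by simp⟩
      · intro χ hχ x hx
        refine ⟨0, zero_mem _, ?_⟩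
        rw [map_zero, sub_zero]
        obtain hxR | ⟨j, hj0, hj⟩ := hevroot χ hχ x hx
        · have : toEnd K L V x = 0 := by
            ext v; exact hL.lie_radQuot hxR v
          rw [this]; exact zero_mem _
        · exact Submodule.mem_iSup_of_mem (2 * j : K) (Submodule.mem_iSup_of_mem
            (by simpa using hj0) (hD hj))
    intro x hx
    obtain ⟨a, ha, h⟩ := hdec x
    refine ⟨a, ha, ?_⟩
    have hx0 := hD hx
    have ha0 := hD (hevA a ha)
    simp only [Int.cast_zero, mul_zero] at hx0 ha0
    have := Submodule.disjoint_def.1 (D.eigenspaces_iSupIndep 0) _ (sub_mem hx0 ha0) h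
    intro v
    exact LinearMap.congr_fun (sub_eq_zero.1 this) v
  · intro v
    obtain ⟨r, rfl⟩ := LieSubmodule.Quotient.surjective_mk' _ v
    exact lie_self _
  · intro x u v
    obtain ⟨r, rfl⟩ := LieSubmodule.Quotient.surjective_mk' _ u
    obtain ⟨s, rfl⟩ := LieSubmodule.Quotient.surjective_mk' _ v
    change ⁅⁅x, (r : L)⁆, (s : L)⁆ = - ⁅(r : L), ⁅x, (s : L)⁆⁆
    have h := lie_center (hL.radical_lie_radical r.2 s.2) x
    rw [leibniz_lie] at h
    exact eq_neg_of_add_eq_zero_left h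
  · have : (LieSubmodule.Quotient.mk (⁅(H : L), (⟨r, hr⟩ : radical K L)⁆ - (2 * n : K) • ⟨r, hr⟩) :
        V) = 0 := RadQuot.mk_eq_zero.2 hn
    rw [RadQuot.lie_mk]
    push_cast
    exact sub_eq_zero.1 this

end Reduct
end Paper

namespace Paper

section Toral
open LieModule LieAlgebra

variable {K L : Type*} [Field K] [CharZero K] [IsAlgClosed K] [LieRing L] [LieAlgebra K L]
  [FiniteDimensional K L] (A : LieSubalgebra K L) [A.IsCartanSubalgebra]

theorem mem_rootSpace_of_lie_eq {χ : A → K} {x : L} (h : ∀ a : A, ⁅(a : L), x⁆ = χ a • x) :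
    x ∈ rootSpace A χ := by
  rw [mem_genWeightSpace]
  intro a
  refine ⟨1, ?_⟩
  rw [pow_one]
  exact sub_eq_zero.2 (h a)

theorem eq_zero_of_mem_center {χ : A → K} (hχ : χ ≠ 0) {z : L} (hz : z ∈ center K L)
    (h : z ∈ rootSpace A χ) : z = 0 := by
  have h0 : z ∈ rootSpace A (0 : A → K) := mem_rootSpace_of_lie_eq A fun a => by
    rw [lie_center (K := K) hz]; simp
  have hd := (LieSubmodule.disjoint_toSubmodule.2
    ((iSupIndep_genWeightSpace K A L).pairwiseDisjoint hχ))
  exact Submodule.disjoint_def.1 hd z h h0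

/-- `ad a - c`. -/
abbrev adShift (a : L) (c : K) : Module.End K L := LieAlgebra.ad K L a - c • 1

theorem adShift_apply (a : L) (c : K) (x : L) : adShift a c x = ⁅a, x⁆ - c • x := rfl

theorem adShift_lie (a : L) (c d : K) (y x : L) :
    adShift a (d + c) ⁅y, x⁆ = ⁅adShift a d y, x⁆ + ⁅y, adShift a c x⁆ := by
  simp only [adShift_apply, sub_lie, lie_sub, smul_lie, lie_smul, leibniz_lie a y x]
  module

theorem adShift_mem_rootSpace {χ : A → K} (a : A) (c : K) {x : L} (hx : x ∈ rootSpace A χ) (k : ℕ) :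
    (adShift (a : L) c ^ k) x ∈ rootSpace A χ := by
  induction k with
  | zero => exact hx
  | succ k ih =>
    rw [pow_succ', Module.End.mul_apply]
    exact sub_mem ((rootSpace A χ).lie_mem (x := a) ih) ((rootSpace A χ).smul_mem _ ih)

theorem adShift_mem_ideal (I : LieIdeal K L) (a : L) (c : K) {x : L} (hx : x ∈ I) (k : ℕ) :
    (adShift (a : L) c ^ k) x ∈ I := by
  induction k with
  | zero => exact hx
  | succ k ih =>
    rw [pow_succ', Module.End.mul_apply]
    exact sub_mem (I.lie_mem ih) (I.smul_mem _ ih)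

theorem adShift_pow_finrank {χ : A → K} (a : A) {x : L} (hx : x ∈ rootSpace A χ) :
    (adShift (a : L) (χ a) ^ Module.finrank K L) x = 0 := by
  obtain ⟨k, hk⟩ := (mem_genWeightSpace _ _ _).1 hx a
  have h1 : x ∈ (LieAlgebra.ad K L (a : L)).maxGenEigenspace (χ a) :=
    Module.End.mem_maxGenEigenspace _ _ _ |>.2 ⟨k, hk⟩
  rw [Module.End.maxGenEigenspace_eq_genEigenspace_finrank, Module.End.mem_genEigenspace_nat] at h1
  exact h1

variable {A}

theorem AbelianIdealsCentral.rootSpace_dichotomy (hL : AbelianIdealsCentral K L) :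
    (∀ x ∈ A, x ∈ radical K L → x ∈ center K L) ∧
    ∀ χ : A → K, χ ≠ 0 → ∀ x ∈ rootSpace A χ, x ∉ radical K L →
      (∀ a : A, ⁅(a : L), x⁆ = χ a • x) ∧
      (∀ y ∈ rootSpace A χ, ∃ c : K, y = c • x) ∧
      ∃ y ∈ rootSpace A (-χ), ∃ h : A, ⁅x, y⁆ = h ∧ χ h ≠ 0 := by
  obtain ⟨H, h1, h2, h3⟩ := hL.exists_principal A
  have key : ∀ χ : A → K, ∀ n : ℤ, χ H = 2 * n → ∀ x ∈ rootSpace A χ, x ∈ radical K L →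
      x ∈ center K L := by
    intro χ n hn x hx hxR
    have hind : ∀ k : ℕ, ∀ x ∈ radical K L, (adShift (H : L) (χ H) ^ k) x ∈ center K L →
        x ∈ center K L := by
      intro k
      induction k with
      | zero => intro x _ h; exact h
      | succ k ih =>
        intro x hx h
        rw [pow_succ', Module.End.mul_apply, adShift_apply, hn] at h
        refine ih x hx (h1 _ ?_ n ?_)
        · exact adShift_mem_ideal _ _ _ hx k
        · rwa [hn]
    exact hind _ x hxR (by rw [adShift_pow_finrank A H hx]; exact zero_mem _)
  refine ⟨?_, ?_⟩
  · intro x hx hxR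
    refine key 0 0 (by simp) x ?_ hxR
    have := zeroRootSubalgebra_eq_of_is_cartan K L A
    rw [← this] at hx
    exact hx
  · intro χ hχ x hx hxR
    obtain ⟨⟨n, -, hn⟩, h4, h5, h6⟩ := h3 χ hχ x hx hxR
    have h0 : ∀ z ∈ rootSpace A χ, z ∈ radical K L → z = 0 := fun z hz hzR =>
      eq_zero_of_mem_center A hχ (key χ n hn z hz hzR) hz
    refine ⟨?_, ?_, h6⟩
    · intro a
      exact sub_eq_zero.1 (h0 _ (sub_mem ((rootSpace A χ).lie_mem (x := a) hx)
        ((rootSpace A χ).smul_mem _ hx)) (h4 a))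
    · intro y hy
      obtain ⟨c, hc⟩ := h5 y hy
      exact ⟨c, sub_eq_zero.1 (h0 _ (sub_mem hy ((rootSpace A χ).smul_mem _ hx)) hc)⟩

theorem AbelianIdealsCentral.adShift_radical (hL : AbelianIdealsCentral K L) (a : A) {χ : A → K}
    {u : L} (hu : u ∈ rootSpace A χ) (huR : u ∈ radical K L) :
    adShift (a : L) (χ a) u ∈ center K L := by
  obtain ⟨hA, hroot⟩ := hL.rootSpace_dichotomy (A := A)
  obtain ⟨_, _, hAA, _⟩ := hL.exists_principal A
  let P : ℕ → Prop := fun k => ∀ χ : A → K, ∀ u ∈ rootSpace A χ, u ∈ radical K L →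
    (adShift (a : L) (χ a) ^ k) u ∈ center K L
  have hstep : ∀ k, P (k + 2) → P (k + 1) := by
    intro k hk
    let Q : Submodule K L := (center K L).toSubmodule ⊔ ⨆ χ : A → K, ((rootSpace A χ).toSubmodule ⊓
          (radical K L).toSubmodule).map (adShift (a : L) (χ a) ^ (k + 1))
    have hQ_ind : ∀ p : L → Prop, (∀ x y, p x → p y → p (x + y)) → (∀ z ∈ center K L, p z) →
        (∀ χ : A → K, ∀ u ∈ rootSpace A χ, u ∈ radical K L →
          p ((adShift (a : L) (χ a) ^ (k + 1)) u)) → ∀ x ∈ Q, p x := by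
      intro p hadd hZ hv x hx
      obtain ⟨z, hz, w, hw, rfl⟩ := Submodule.mem_sup.1 hx
      refine hadd _ _ (hZ z hz) ?_
      refine Submodule.iSup_induction _ (motive := p) hw ?_ (hZ 0 (zero_mem _)) hadd
      rintro χ _ ⟨u, ⟨hu, huR⟩, rfl⟩
      exact hv χ u hu huR
    have hQ_mem : ∀ χ : A → K, ∀ u ∈ rootSpace A χ, u ∈ radical K L →
          (adShift (a : L) (χ a) ^ (k + 1)) u ∈ Q := fun χ u hu huR =>
      Submodule.mem_sup_right (Submodule.mem_iSup_of_mem χ ⟨u, ⟨hu, huR⟩, rfl⟩)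
    have hroot' : ∀ ψ : A → K, ∀ y ∈ rootSpace A ψ, ∀ x ∈ Q, ⁅y, x⁆ ∈ Q := by
      intro ψ y hy
      refine hQ_ind _ ?_ ?_ ?_
      · intro x x' hx hx'
        rw [lie_add]
        exact add_mem hx hx'
      · intro z hz
        rw [lie_center (K := K) hz]
        exact zero_mem _
      · intro χ u hu huR
        by_cases hyR : y ∈ radical K L
        · exact Submodule.mem_sup_left (hL.radical_lie_radical hyR (adShift_mem_ideal _ _ _ huR _))
        · have hy0 : adShift (a : L) (ψ a) y ∈ center K L := by
            by_cases hψ : ψ = 0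
            · subst hψ
              have hyA := mem_of_mem_rootSpace_zero A hy
              rw [adShift_apply, Pi.zero_apply, zero_smul, sub_zero]
              exact hA _ (A.lie_mem a.2 hyA) (hAA _ a.2 _ hyA)
            · rw [adShift_apply, (hroot ψ hψ y hy hyR).1 a, sub_self]
              exact zero_mem _
          have hpow : ∀ m : ℕ, ∀ u : L, ⁅y, (adShift (a : L) (χ a) ^ m) u⁆ =
              (adShift (a : L) ((ψ + χ) a) ^ m) ⁅y, u⁆ := by
            intro m
            induction m with
            | zero => intro u; rfl
            | succ m ih =>
              intro u
              rw [pow_succ, Module.End.mul_apply, ih, pow_succ, Module.End.mul_apply,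
                Pi.add_apply, adShift_lie, center_lie (K := K) hy0, zero_add]
          rw [hpow]
          exact hQ_mem _ _ (lie_mem_genWeightSpace_of_mem_genWeightSpace hy hu)
            ((radical K L).lie_mem huR)
    let I : LieIdeal K L :=
      { Q with
        lie_mem := by
          intro y
          refine cartan_induction A (p := fun y => ∀ {x : L}, x ∈ Q → ⁅y, x⁆ ∈ Q) ?_ ?_ ?_ y
          · intro y z hy hz x hx
            rw [add_lie]
            exact add_mem (hy hx) (hz hx)
          · intro y hy x hx
            refine hroot' 0 y ?_ x hx
            have := zeroRootSubalgebra_eq_of_is_cartan K L A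
            rw [← this] at hy
            exact hy
          · intro χ _ y hy x hx
            exact hroot' χ y hy x hx }
    have hI : I ≤ center K L := by
      refine hL.le_center I ?_
      refine hQ_ind _ ?_ ?_ ?_
      · intro x x' hx hx' y hy
        rw [add_lie, hx y hy, hx' y hy, add_zero]
      · intro z hz y _
        exact center_lie (K := K) hz y
      · intro χ u hu huR
        refine hQ_ind _ ?_ ?_ ?_
        · intro x x' hx hx'
          rw [lie_add, hx, hx', add_zero]
        · intro z hz
          exact lie_center (K := K) hz _
        · intro ψ v hv hvR
          set u' := (adShift (a : L) (χ a) ^ (k + 1)) u with hu'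
          have hu'R : u' ∈ radical K L := adShift_mem_ideal _ _ _ huR _
          have hu'χ : u' ∈ rootSpace A χ := adShift_mem_rootSpace A a _ hu _
          set v' := (adShift (a : L) (ψ a) ^ k) v with hv'
          have hv'R : v' ∈ radical K L := adShift_mem_ideal _ _ _ hvR _
          have hv'ψ : v' ∈ rootSpace A ψ := adShift_mem_rootSpace A a _ hv _
          rw [pow_succ', Module.End.mul_apply, ← hv']
          have h1 := adShift_lie (a : L) (ψ a) (χ a) u' v'
          have h2 : adShift (a : L) (χ a) u' ∈ center K L := by
            rw [hu', ← Module.End.mul_apply, ← pow_succ']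
            exact hk χ u hu huR
          have hmem : ⁅u', adShift (a : L) (ψ a) v'⁆ ∈ center K L :=
            hL.radical_lie_radical hu'R (by simpa using adShift_mem_ideal (radical K L) (a : L) (ψ a) hv'R 1)
          have hmem' : ⁅u', adShift (a : L) (ψ a) v'⁆ ∈ rootSpace A (χ + ψ) :=
            lie_mem_genWeightSpace_of_mem_genWeightSpace hu'χ
              (by simpa using adShift_mem_rootSpace A a (ψ a) hv'ψ 1)
          by_cases h0 : χ + ψ = 0
          · have h3 : χ a + ψ a = 0 := congrFun h0 a
            rw [center_lie (K := K) h2, zero_add, h3, adShift_apply, zero_smul, sub_zero] at h1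
            rw [← h1]
            exact lie_center (K := K) (hL.radical_lie_radical hu'R hv'R) _
          · exact eq_zero_of_mem_center A h0 hmem hmem'
    intro χ u hu huR
    exact hI (Submodule.mem_sup_right (Submodule.mem_iSup_of_mem χ ⟨u, ⟨hu, huR⟩, rfl⟩))
  have h1 : P 1 := by
    have : ∀ n, P (n + 1) → P 1 := by
      intro n
      induction n with
      | zero => exact id
      | succ n ih => exact fun h => ih (hstep n h)
    refine this (Module.finrank K L) fun χ u hu huR => ?_
    rw [pow_succ', Module.End.mul_apply, adShift_pow_finrank A a hu, map_zero]
    exact zero_mem _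
  simpa using h1 χ u hu huR

theorem AbelianIdealsCentral.lie_eq_smul (hL : AbelianIdealsCentral K L) {χ : A → K} (hχ : χ ≠ 0)
    {x : L} (hx : x ∈ rootSpace A χ) (a : A) : ⁅(a : L), x⁆ = χ a • x := by
  by_cases hxR : x ∈ radical K L
  · refine sub_eq_zero.1 (eq_zero_of_mem_center A hχ (hL.adShift_radical a hx hxR) ?_)
    simpa using adShift_mem_rootSpace A a (χ a) hx 1
  · exact ((hL.rootSpace_dichotomy (A := A)).2 χ hχ x hx hxR).1 a

theorem AbelianIdealsCentral.cartan_lie (hL : AbelianIdealsCentral K L) {a a' : L}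
    (ha : a ∈ A) (ha' : a' ∈ A) : ⁅a, a'⁆ = 0 := by
  obtain ⟨hA, hroot⟩ := hL.rootSpace_dichotomy (A := A)
  let B : Submodule K L :=
    { carrier := {x | x ∈ A ∧ ∀ y ∈ A, ⁅y, x⁆ = 0}
      add_mem' := fun hx hy =>
        ⟨add_mem hx.1 hy.1, fun z hz => by rw [lie_add, hx.2 z hz, hy.2 z hz, add_zero]⟩
      zero_mem' := ⟨zero_mem _, fun z _ => lie_zero z⟩
      smul_mem' := fun c x hx =>
        ⟨A.smul_mem c hx.1, fun z hz => by rw [lie_smul, hx.2 z hz, smul_zero]⟩ }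
  have h1 : ∀ c ∈ A, c ∈ (radical K L).toSubmodule ⊔ B := by
    intro c hc
    refine cartan_le_of_lie_mem A _ ?_ (fun x hx => Submodule.mem_sup_left hx) hc
    intro χ hχ x hx y hy
    refine Submodule.mem_sup_right ⟨?_, fun z hz => ?_⟩
    · refine mem_of_mem_rootSpace_zero A ?_
      have := lie_mem_genWeightSpace_of_mem_genWeightSpace hx hy
      rwa [add_neg_cancel] at this
    · rw [leibniz_lie, hL.lie_eq_smul hχ hx ⟨z, hz⟩,
        hL.lie_eq_smul (neg_ne_zero.2 hχ) hy ⟨z, hz⟩]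
      simp
  obtain ⟨r, hr, s, hs, rfl⟩ := Submodule.mem_sup.1 (h1 a ha)
  have hrA : r ∈ A := by simpa using sub_mem ha hs.1
  rw [add_lie, center_lie (K := K) (hA r hrA hr), zero_add, ← lie_skew, hs.2 a' ha', neg_zero]

end Toral
end Paper

namespace Paper

section MaxToral
open LieModule LieAlgebra

variable {K : Type} [Field K] [CharZero K] [IsAlgClosed K] {L : Type} [LieRing L] [LieAlgebra K L]

theorem lie_eq_zero_of_lie_lie_eq_zero {t : LieSubalgebra K L}
    (hdiag : (⨆ α : Module.Dual K t, adWeightSpace K L t α) = ⊤) (a : t) {x : L}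
    (hx : ⁅(a : L), ⁅(a : L), x⁆⁆ = 0) : ⁅(a : L), x⁆ = 0 := by
  set f : Module.End K L := LieAlgebra.ad K L a with hf
  have h1 : ∀ y, f y ∈ ⨆ μ ≠ (0 : K), f.eigenspace μ := by
    intro y
    have hy : y ∈ ⨆ α : Module.Dual K t, adWeightSpace K L t α := hdiag ▸ Submodule.mem_top
    refine Submodule.iSup_induction _ (motive := fun y => f y ∈ ⨆ μ ≠ (0 : K), f.eigenspace μ)
      hy ?_ (by rw [map_zero]; exact zero_mem _) (fun y z hy hz => by rw [map_add]; exact add_mem hy hz)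
    intro α y hy
    have h2 : f y = α a • y := hy a
    by_cases h0 : α a = 0
    · rw [h2, h0, zero_smul]; exact zero_mem _
    · rw [h2]
      refine Submodule.smul_mem _ _ ?_
      exact Submodule.mem_iSup_of_mem (α a) (Submodule.mem_iSup_of_mem h0
        (Module.End.mem_eigenspace_iff.2 h2))
  have h2 := Submodule.disjoint_def.1 (f.eigenspaces_iSupIndep 0)
  exact h2 (f x) (Module.End.mem_eigenspace_iff.2 (by rw [zero_smul]; exact hx)) (h1 x)

variable [FiniteDimensional K L]

theorem AbelianIdealsCentral.toral_of_cartan (hL : AbelianIdealsCentral K L)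
    (A : LieSubalgebra K L) [A.IsCartanSubalgebra] :
    (⨆ α : Module.Dual K A, adWeightSpace K L A α) = ⊤ := by
  refine eq_top_iff.2 fun x _ => ?_
  refine cartan_induction A (p := fun x => x ∈ ⨆ α : Module.Dual K A, adWeightSpace K L A α)
    (fun x y => add_mem) ?_ ?_ x
  · intro a ha
    refine Submodule.mem_iSup_of_mem 0 fun b => ?_
    rw [hL.cartan_lie b.2 ha]; simp
  · intro χ hχ x hx
    have h1 := hL.lie_eq_smul hχ hx
    by_cases hx0 : x = 0
    · rw [hx0]; exact zero_mem _
    let α : Module.Dual K A :=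
      { toFun := χ
        map_add' := fun a b => smul_left_injective K hx0 (by
          simp only [← h1, add_smul]; rw [← add_lie]; rfl)
        map_smul' := fun c a => smul_left_injective K hx0 (by
          simp only [RingHom.id_apply, smul_eq_mul, mul_smul, ← h1]; rw [← smul_lie]; rfl) }
    exact Submodule.mem_iSup_of_mem α h1

theorem AbelianIdealsCentral.isCartanSubalgebra (hL : AbelianIdealsCentral K L)
    (t : LieSubalgebra K L) (hab : ∀ x ∈ t, ∀ y ∈ t, ⁅x, y⁆ = 0)
    (hdiag : (⨆ α : Module.Dual K t, adWeightSpace K L t α) = ⊤)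
    (hmax : ∀ t' : LieSubalgebra K L, t ≤ t' → (∀ x ∈ t', ∀ y ∈ t', ⁅x, y⁆ = 0) →
      (⨆ α : Module.Dual K t', adWeightSpace K L t' α) = ⊤ → t' = t) :
    t.IsCartanSubalgebra := by
  let c : LieSubalgebra K L :=
    { carrier := {x | ∀ a ∈ t, ⁅a, x⁆ = 0}
      add_mem' := fun hx hy a ha => by rw [lie_add, hx a ha, hy a ha, add_zero]
      zero_mem' := fun a _ => lie_zero a
      smul_mem' := fun r x hx a ha => by rw [lie_smul, hx a ha, smul_zero]
      lie_mem' := fun {x y} hx hy a ha => by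
        rw [leibniz_lie, hx a ha, hy a ha, zero_lie, lie_zero, add_zero] }
  obtain ⟨z, hz⟩ := exists_isCartanSubalgebra_engel K c
  set B := LieSubalgebra.engel K z
  let A : LieSubalgebra K L := B.map c.incl
  have htA : t ≤ A := by
    intro a ha
    have hac : a ∈ c := fun b hb => hab b hb a ha
    refine ⟨⟨a, hac⟩, ?_, rfl⟩
    have : (⟨a, hac⟩ : c) ∈ B.normalizer := by
      rw [LieSubalgebra.mem_normalizer_iff]
      intro y _
      have : ⁅(⟨a, hac⟩ : c), y⁆ = 0 := Subtype.ext (y.2 a ha)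
      rw [this]
      exact zero_mem _
    rwa [hz.self_normalizing] at this
  have hA : A.IsCartanSubalgebra := by
    constructor
    · have hnil := hz.nilpotent
      let e : B →ₗ⁅K⁆ A :=
        { toFun := fun w => ⟨(w : c), w, w.2, rfl⟩
          map_add' := fun _ _ => rfl
          map_smul' := fun _ _ => rfl
          map_lie' := rfl }
      refine Function.Surjective.lieAlgebra_isNilpotent (f := e) ?_
      rintro ⟨_, w, hw, rfl⟩
      exact ⟨⟨w, hw⟩, rfl⟩
    · refine le_antisymm ?_ A.le_normalizer
      intro x hx
      rw [LieSubalgebra.mem_normalizer_iff'] at hx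
      have hxc : x ∈ c := by
        intro a ha
        refine lie_eq_zero_of_lie_lie_eq_zero hdiag ⟨a, ha⟩ ?_
        obtain ⟨w, _, hw⟩ := hx a (htA ha)
        have := w.2 a ha
        change ⁅a, ⁅a, x⁆⁆ = 0
        rw [← hw]
        exact this
      have : (⟨x, hxc⟩ : c) ∈ B.normalizer := by
        rw [LieSubalgebra.mem_normalizer_iff']
        intro y hy
        obtain ⟨w, hw, hw'⟩ := hx y ⟨y, hy, rfl⟩
        have : ⁅y, (⟨x, hxc⟩ : c)⁆ = w := Subtype.ext hw'.symm
        rw [this]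
        exact hw
      rw [hz.self_normalizing] at this
      exact ⟨_, this, rfl⟩
  have := hmax A htA (fun x hx y hy => hL.cartan_lie hx hy) (hL.toral_of_cartan A)
  rwa [← this]

end MaxToral
end Paper

namespace Paper

section Convert
open LieModule LieAlgebra

variable {K : Type} [Field K] [CharZero K] [IsAlgClosed K] {g : Type} [LieRing g] [LieAlgebra K g]

theorem isToralIn_map_iff (s : LieSubalgebra K g) (t : LieSubalgebra K s) :
    IsToralIn K g s (t.map s.incl) ↔ (∀ x ∈ t, ∀ y ∈ t, ⁅x, y⁆ = 0) ∧
      (⨆ α : Module.Dual K t, adWeightSpace K s t α) = ⊤ := by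
  let e₀ : t →ₗ[K] t.map s.incl :=
    { toFun := fun w => ⟨((w : s) : g), w, w.2, rfl⟩
      map_add' := fun _ _ => rfl
      map_smul' := fun _ _ => rfl }
  let e : t ≃ₗ[K] t.map s.incl := LinearEquiv.ofBijective e₀
    ⟨fun a b h => Subtype.ext (Subtype.ext (congrArg (Subtype.val : t.map s.incl → g) h)),
      fun ⟨_, w, hw, h⟩ => ⟨⟨w, hw⟩, Subtype.ext h⟩⟩
  constructor
  · rintro ⟨h1, h2, h3⟩
    refine ⟨fun x hx y hy => ?_, eq_top_iff.2 fun x _ => ?_⟩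
    · have := h2.trivial (e ⟨x, hx⟩) (e ⟨y, hy⟩)
      exact Subtype.ext (congrArg (Subtype.val : t.map s.incl → g) this)
    · have h4 : (⨆ α : Module.Dual K (t.map s.incl),
          s.toSubmodule ⊓ adWeightSpace K g (t.map s.incl) α) ≤
          (⨆ α : Module.Dual K t, adWeightSpace K s t α).map s.toSubmodule.subtype := by
        refine iSup_le fun α y hy => ⟨⟨y, hy.1⟩, ?_, rfl⟩
        refine Submodule.mem_iSup_of_mem (α.comp e.toLinearMap) fun a => Subtype.ext ?_
        exact hy.2 (e a)
      obtain ⟨y, hy, hyx⟩ := h4 (h3 x.2)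
      have : y = x := Subtype.ext hyx
      exact this ▸ hy
  · rintro ⟨h1, h2⟩
    refine ⟨?_, ⟨?_⟩, fun x hx => ?_⟩
    · rintro _ ⟨w, _, rfl⟩
      exact w.2
    · rintro ⟨_, w, hw, rfl⟩ ⟨_, w', hw', rfl⟩
      exact Subtype.ext (congrArg (Subtype.val : s → g) (h1 w hw w' hw'))
    · have hx' : (⟨x, hx⟩ : s) ∈ ⨆ α : Module.Dual K t, adWeightSpace K s t α :=
        h2 ▸ Submodule.mem_top
      refine Submodule.iSup_induction _ (motive := fun z : s => (z : g) ∈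
        ⨆ α : Module.Dual K (t.map s.incl), s.toSubmodule ⊓ adWeightSpace K g (t.map s.incl) α)
        hx' ?_ (zero_mem _) (fun _ _ => add_mem)
      intro α z hz
      refine Submodule.mem_iSup_of_mem (α.comp e.symm.toLinearMap) ⟨z.2, fun H => ?_⟩
      obtain ⟨a, rfl⟩ := e.surjective H
      rw [LinearMap.comp_apply, LinearEquiv.coe_coe, LinearEquiv.symm_apply_apply]
      exact congrArg (Subtype.val : s → g) (hz a)

namespace Setup
variable (S : Setup K g)

/-- The subalgebra `h ∩ g_n` seen inside `g_n`. -/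
def cartanN (n : ℕ) : LieSubalgebra K (S.F n) := (S.hn n).comap (S.F n).incl

theorem map_cartanN (n : ℕ) : (S.cartanN n).map (S.F n).incl = S.hn n := by
  ext x
  constructor
  · rintro ⟨w, hw, rfl⟩
    exact hw
  · intro hx
    exact ⟨⟨x, hx.2⟩, hx, rfl⟩

theorem abelianIdealsCentral (n : ℕ) : AbelianIdealsCentral K (S.F n) := S.F_reductive n

instance (n : ℕ) : FiniteDimensional K (S.F n) := S.F_findim n

instance isCartanSubalgebra_cartanN (n : ℕ) : (S.cartanN n).IsCartanSubalgebra := by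
  obtain ⟨h1, h2⟩ := S.h_maxToral n
  change IsToralIn K g (S.F n) (S.hn n) at h1
  rw [← S.map_cartanN n, isToralIn_map_iff] at h1
  refine (S.abelianIdealsCentral n).isCartanSubalgebra _ h1.1 h1.2 ?_
  intro t' ht hab hdiag
  have h3 := h2 _ ((isToralIn_map_iff _ t').2 ⟨hab, hdiag⟩)
    (by change S.hn n ≤ _; rw [← S.map_cartanN n]; rintro _ ⟨w, hw, rfl⟩; exact ⟨w, ht hw, rfl⟩)
  refine le_antisymm (fun x hx => ?_) ht
  have : (x : g) ∈ S.h ⊓ S.F n := h3 ▸ ⟨x, hx, rfl⟩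
  exact this

/-- The radical of `g_n`, as a subspace of `g`. -/
def radN (n : ℕ) : Submodule K g :=
  (LieAlgebra.radical K (S.F n)).toSubmodule.map (S.F n).toSubmodule.subtype

theorem lie_mem_radN {n : ℕ} {x y : g} (hx : x ∈ S.F n) (hy : y ∈ S.radN n) :
    ⁅x, y⁆ ∈ S.radN n := by
  obtain ⟨w, hw, rfl⟩ := hy
  exact ⟨⁅(⟨x, hx⟩ : S.F n), w⁆, (radical K (S.F n)).lie_mem hw, rfl⟩

theorem lie_lie_radN {n : ℕ} {x y z : g} (hx : x ∈ S.radN n) (hy : y ∈ S.radN n)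
    (hz : z ∈ S.F n) : ⁅z, ⁅x, y⁆⁆ = 0 := by
  obtain ⟨x, hx, rfl⟩ := hx
  obtain ⟨y, hy, rfl⟩ := hy
  have := lie_center (K := K) ((S.abelianIdealsCentral n).radical_lie_radical hx hy) ⟨z, hz⟩
  exact Subtype.ext_iff.1 this

theorem mem_h_of_lie_eq_zero {n : ℕ} {x : g} (hx : x ∈ S.F n) (h : ∀ H ∈ S.hn n, ⁅H, x⁆ = 0) :
    x ∈ S.h := by
  have : (⟨x, hx⟩ : S.F n) ∈ S.cartanN n := by
    refine mem_of_mem_rootSpace_zero _ (mem_rootSpace_of_lie_eq _ fun a => ?_)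
    rw [Pi.zero_apply, zero_smul]
    exact Subtype.ext (h a a.2)
  exact this.1

theorem lie_eq_zero_of_mem_radN_of_mem_h {n : ℕ} {x y : g} (hx : x ∈ S.radN n) (hxh : x ∈ S.h)
    (hy : y ∈ S.F n) : ⁅y, x⁆ = 0 := by
  obtain ⟨x, hx, rfl⟩ := hx
  have h1 := ((S.abelianIdealsCentral n).rootSpace_dichotomy (A := S.cartanN n)).1 x ⟨hxh, x.2⟩ hx
  exact Subtype.ext_iff.1 (lie_center (K := K) h1 ⟨y, hy⟩)

theorem rootSpaceN_dichotomy {n : ℕ} {α : Module.Dual K (S.hn n)} (hα : α ≠ 0) {x : g}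
    (hx : x ∈ S.rootSpaceN n α) (hxR : x ∉ S.radN n) :
    (∀ y ∈ S.rootSpaceN n α, ∃ c : K, y = c • x) ∧
      ∃ y ∈ S.rootSpaceN n (-α), ∃ H : S.hn n, ⁅x, y⁆ = H ∧ α H ≠ 0 := by
  obtain ⟨h1, h2⟩ := (S.abelianIdealsCentral n).rootSpace_dichotomy (A := S.cartanN n)
  let χ : S.cartanN n → K := fun a => α ⟨a, a.2⟩
  have hc : ∀ y (hy : y ∈ S.rootSpaceN n α), (⟨y, hy.1⟩ : S.F n) ∈ rootSpace (S.cartanN n) χ :=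
    fun y hy => mem_rootSpace_of_lie_eq _ fun a => Subtype.ext (hy.2 ⟨a, a.2⟩)
  have hχ : χ ≠ 0 := fun h => hα (LinearMap.ext fun H =>
    congrFun h (⟨⟨H, H.2.2⟩, H.2⟩ : S.cartanN n))
  have hxR' : (⟨x, hx.1⟩ : S.F n) ∉ radical K (S.F n) := fun h => hxR ⟨_, h, rfl⟩
  obtain ⟨_, h4, y, hy, H, hH, hH'⟩ := h2 χ hχ _ (hc x hx) hxR'
  refine ⟨fun y hy => ?_, y, ⟨y.2, fun a => ?_⟩, ⟨H, H.2⟩, Subtype.ext_iff.1 hH, hH'⟩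
  · obtain ⟨c, hc⟩ := h4 _ (hc y hy)
    exact ⟨c, Subtype.ext_iff.1 hc⟩
  · have := (S.abelianIdealsCentral n).lie_eq_smul (neg_ne_zero.2 hχ) hy ⟨⟨a, a.2.2⟩, a.2⟩
    exact Subtype.ext_iff.1 this

end Setup
end Convert
end Paper

namespace Paper

namespace Setup

variable {K : Type} [Field K] [CharZero K] [IsAlgClosed K] {g : Type} [LieRing g] [LieAlgebra K g]
variable (S : Setup K g)

/-- The `h`-weight space of weight `α`. -/
abbrev W (α : Module.Dual K S.h) : Submodule K g := adWeightSpace K g S.h α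

theorem lie_of_mem_W {α : Module.Dual K S.h} {x : g} (hx : x ∈ S.W α) (H : S.h) :
    ⁅(H : g), x⁆ = α H • x := hx H

theorem lie_mem_W {α β : Module.Dual K S.h} {x y : g} (hx : x ∈ S.W α) (hy : y ∈ S.W β) :
    ⁅x, y⁆ ∈ S.W (α + β) := by
  intro H
  rw [leibniz_lie, hx H, hy H, smul_lie, lie_smul, LinearMap.add_apply, add_smul]

theorem exists_mem_F (s : Finset g) : ∃ n, ∀ x ∈ s, x ∈ S.F n := by
  classical
  induction s using Finset.induction_on with
  | empty => exact ⟨0, by simp⟩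
  | insert a s _ ih =>
    obtain ⟨n, hn⟩ := ih
    obtain ⟨m, hm⟩ := S.F_exhaust a
    refine ⟨max n m, fun x hx => ?_⟩
    rcases Finset.mem_insert.1 hx with rfl | hx
    · exact S.F_mono (le_max_right _ _) hm
    · exact S.F_mono (le_max_left _ _) (hn x hx)

theorem h_lie_h (H H' : S.h) : ⁅(H : g), (H' : g)⁆ = 0 := by
  classical
  obtain ⟨n, hn⟩ := S.exists_mem_F {(H : g), (H' : g)}
  have h1 := (S.h_maxToral n).1.2.1
  have := h1.trivial ⟨H, H.2, hn H (by simp)⟩ ⟨H', H'.2, hn H' (by simp)⟩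
  exact congrArg (Subtype.val : (S.h ⊓ S.F n : LieSubalgebra K g) → g) this

theorem mem_W_zero {x : g} : x ∈ S.W 0 ↔ x ∈ S.h := by
  constructor
  · intro hx
    obtain ⟨n, hn⟩ := S.F_exhaust x
    refine S.mem_h_of_lie_eq_zero hn fun H hH => ?_
    simpa using hx ⟨H, hH.1⟩
  · intro hx H
    simpa using S.h_lie_h H ⟨x, hx⟩

theorem W_induction {p : g → Prop} (hadd : ∀ x y, p x → p y → p (x + y))
    (hW : ∀ α, ∀ x ∈ S.W α, p x) (x : g) : p x := by
  have hx : x ∈ ⨆ α : Module.Dual K S.h, S.W α := S.h_span ▸ Submodule.mem_top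
  exact Submodule.iSup_induction _ (motive := p) hx hW (hW 0 0 (zero_mem _)) hadd

open Classical in
theorem isInternal : DirectSum.IsInternal S.W :=
  DirectSum.isInternal_submodule_of_iSupIndep_of_iSup_eq_top S.h_indep S.h_span

open Classical in
/-- The projection of `g` onto the weight space of weight `α`. -/
noncomputable def proj (α : Module.Dual K S.h) : g →ₗ[K] g :=
  (S.W α).subtype ∘ₗ DirectSum.component K _ _ α ∘ₗ
    (LinearEquiv.ofBijective (DirectSum.coeLinearMap S.W) S.isInternal).symm.toLinearMap

theorem proj_mem (α : Module.Dual K S.h) (x : g) : S.proj α x ∈ S.W α := Subtype.property _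

open Classical in
theorem proj_apply_of_mem {α β : Module.Dual K S.h} {x : g} (hx : x ∈ S.W β) :
    S.proj α x = if β = α then x else 0 := by
  have h1 : (LinearEquiv.ofBijective (DirectSum.coeLinearMap S.W) S.isInternal).symm x =
      DirectSum.lof K _ (fun α => S.W α) β ⟨x, hx⟩ := by
    rw [LinearEquiv.symm_apply_eq]
    exact (DirectSum.coeLinearMap_lof S.W β (⟨x, hx⟩ : S.W β)).symm
  simp only [proj, LinearMap.comp_apply, LinearEquiv.coe_coe, h1]
  rw [DirectSum.component.of]
  split_ifs with h
  · subst h; rfl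
  · rfl

theorem proj_self {α : Module.Dual K S.h} {x : g} (hx : x ∈ S.W α) : S.proj α x = x := by
  rw [S.proj_apply_of_mem hx, if_pos rfl]

theorem proj_of_ne {α β : Module.Dual K S.h} {x : g} (hx : x ∈ S.W β) (h : β ≠ α) :
    S.proj α x = 0 := by
  rw [S.proj_apply_of_mem hx, if_neg h]

theorem eq_zero_of_proj {x : g} (h : ∀ α, S.proj α x = 0) : x = 0 := by
  classical
  have h1 : (LinearEquiv.ofBijective (DirectSum.coeLinearMap S.W) S.isInternal).symm x = 0 := by
    refine DFinsupp.ext fun α => Subtype.ext ?_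
    exact h α
  exact (LinearEquiv.map_eq_zero_iff _).1 h1

theorem finite_proj (x : g) : {α | S.proj α x ≠ 0}.Finite := by
  refine S.W_induction (p := fun x => {α | S.proj α x ≠ 0}.Finite) ?_ ?_ x
  · intro x y hx hy
    refine (hx.union hy).subset fun α hα => ?_
    by_contra h
    simp only [Set.mem_union, Set.mem_ofPred_eq, not_or, not_not] at h
    exact hα (by rw [map_add, h.1, h.2, add_zero])
  · intro α x hx
    refine (Set.finite_singleton α).subset fun β hβ => ?_
    by_contra h
    exact hβ (S.proj_of_ne hx (Ne.symm h))

theorem sum_proj (x : g) : ∑ α ∈ (S.finite_proj x).toFinset, S.proj α x = x := by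
  classical
  rw [← sub_eq_zero]
  refine S.eq_zero_of_proj fun β => ?_
  rw [map_sub, map_sum, sub_eq_zero]
  by_cases hβ : S.proj β x = 0
  · rw [hβ]
    refine Finset.sum_eq_zero fun α hα => ?_
    by_cases h : α = β
    · subst h; rw [hβ, map_zero]
    · exact S.proj_of_ne (S.proj_mem _ _) h
  · rw [Finset.sum_eq_single β]
    · exact S.proj_self (S.proj_mem _ _)
    · intro α _ h
      exact S.proj_of_ne (S.proj_mem _ _) h
    · intro h
      simp [hβ] at h

theorem proj_lie {α β : Module.Dual K S.h} {e : g} (he : e ∈ S.W α) (x : g) :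
    S.proj (α + β) ⁅e, x⁆ = ⁅e, S.proj β x⁆ := by
  refine S.W_induction (p := fun x => S.proj (α + β) ⁅e, x⁆ = ⁅e, S.proj β x⁆) ?_ ?_ x
  · intro x y hx hy
    rw [lie_add, map_add, map_add, lie_add, hx, hy]
  · intro δ x hx
    by_cases h : δ = β
    · subst h
      rw [S.proj_self hx, S.proj_self (S.lie_mem_W he hx)]
    · rw [S.proj_of_ne hx h, lie_zero, S.proj_of_ne (S.lie_mem_W he hx) (by simpa using h)]

end Setup
end Paper

namespace Paper

namespace Setup

variable {K : Type} [Field K] [CharZero K] [IsAlgClosed K] {g : Type} [LieRing g] [LieAlgebra K g]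
variable (S : Setup K g)

/-- The elements which eventually lie in the radicals of the `g_n`. -/
def locRad : Submodule K g where
  carrier := {x | ∃ n, ∀ m ≥ n, x ∈ S.radN m}
  add_mem' := by
    rintro x y ⟨n, hn⟩ ⟨k, hk⟩
    exact ⟨max n k, fun m hm => add_mem (hn m (le_of_max_le_left hm)) (hk m (le_of_max_le_right hm))⟩
  zero_mem' := ⟨0, fun m _ => zero_mem _⟩
  smul_mem' := by
    rintro c x ⟨n, hn⟩
    exact ⟨n, fun m hm => Submodule.smul_mem _ c (hn m hm)⟩

theorem lie_mem_locRad (y : g) {x : g} (hx : x ∈ S.locRad) : ⁅y, x⁆ ∈ S.locRad := by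
  obtain ⟨n, hn⟩ := hx
  obtain ⟨k, hk⟩ := S.F_exhaust y
  exact ⟨max n k, fun m hm =>
    S.lie_mem_radN (S.F_mono (le_of_max_le_right hm) hk) (hn m (le_of_max_le_left hm))⟩

/-- The center of `g`, as a subspace. -/
def cent (_S : Setup K g) : Submodule K g where
  carrier := {x | ∀ y : g, ⁅y, x⁆ = 0}
  add_mem' := by
    intro x x' hx hx' z
    rw [lie_add, hx z, hx' z, add_zero]
  zero_mem' z := lie_zero z
  smul_mem' := by
    intro c x hx z
    rw [lie_smul, hx z, smul_zero]

theorem mem_cent_of_mem_locRad {x : g} (hx : x ∈ S.locRad) (hxh : x ∈ S.h) : x ∈ S.cent := by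
  intro y
  obtain ⟨n, hn⟩ := hx
  obtain ⟨k, hk⟩ := S.F_exhaust y
  exact S.lie_eq_zero_of_mem_radN_of_mem_h (hn (max n k) (le_max_left _ _)) hxh
    (S.F_mono (le_max_right _ _) hk)

theorem lie_mem_cent {x y : g} (hx : x ∈ S.locRad) (hy : y ∈ S.locRad) : ⁅x, y⁆ ∈ S.cent := by
  intro z
  obtain ⟨n, hn⟩ := hx
  obtain ⟨l, hl⟩ := hy
  obtain ⟨k, hk⟩ := S.F_exhaust z
  exact S.lie_lie_radN (n := max (max n l) k)
    (hn _ ((le_max_left _ _).trans (le_max_left _ _)))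
    (hl _ ((le_max_right _ _).trans (le_max_left _ _))) (S.F_mono (le_max_right _ _) hk)

theorem exists_apply_ne_zero {V : Type*} [AddCommGroup V] [Module K V] {α : Module.Dual K V}
    (hα : α ≠ 0) : ∃ H, α H ≠ 0 := by
  by_contra! h
  exact hα (LinearMap.ext h)

theorem eq_zero_of_mem_cent {α : Module.Dual K S.h} (hα : α ≠ 0) {x : g} (hx : x ∈ S.W α)
    (hxc : x ∈ S.cent) : x = 0 := by
  obtain ⟨H, hH⟩ := exists_apply_ne_zero hα
  have := hx H
  rw [hxc] at this
  exact (smul_eq_zero.1 this.symm).resolve_left hH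

/-- The span of the weight spaces of `locRad` with weights in `P` and of its central part. -/
def locRadPart (P : Set (Module.Dual K S.h)) : Submodule K g :=
  (⨆ α ∈ P, S.locRad ⊓ S.W α) ⊔ (S.locRad ⊓ S.cent)

variable {S}

theorem mem_locRadPart {P : Set (Module.Dual K S.h)} {α : Module.Dual K S.h} (hα : α ∈ P) {x : g}
    (hx : x ∈ S.locRad) (hxα : x ∈ S.W α) : x ∈ S.locRadPart P :=
  Submodule.mem_sup_left (Submodule.mem_iSup_of_mem α (Submodule.mem_iSup_of_mem hα ⟨hx, hxα⟩))

theorem locRadPart_induction {P : Set (Module.Dual K S.h)} {p : g → Prop}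
    (hadd : ∀ x y, p x → p y → p (x + y)) (h0 : ∀ x ∈ S.locRad, x ∈ S.cent → p x)
    (hP : ∀ α ∈ P, ∀ x ∈ S.locRad, x ∈ S.W α → p x) {x : g} (hx : x ∈ S.locRadPart P) : p x := by
  obtain ⟨y, hy, z, hz, rfl⟩ := Submodule.mem_sup.1 hx
  have hp0 : p 0 := h0 0 (zero_mem _) (zero_mem _)
  refine hadd _ _ ?_ (h0 z hz.1 hz.2)
  refine Submodule.iSup_induction _ (motive := p) hy ?_ hp0 hadd
  intro α w hw
  by_cases hα : α ∈ P
  · rw [iSup_pos hα] at hw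
    exact hP α hα w hw.1 hw.2
  · rw [iSup_neg hα] at hw
    rwa [(Submodule.mem_bot K).1 hw]

theorem locRad_inf_W_eq_zero {P : Set (Module.Dual K S.h)}
    (hP : ∀ α ∈ P, α ≠ 0 ∧ ∀ γ ∈ P, α + γ ≠ 0)
    (hst : ∀ y : g, ∀ x ∈ S.locRadPart P, ⁅y, x⁆ ∈ S.locRadPart P) {α : Module.Dual K S.h}
    (hα : α ∈ P) {x : g} (hx : x ∈ S.locRad) (hxα : x ∈ S.W α) : x = 0 := by
  refine S.eq_zero_of_mem_cent (hP α hα).1 hxα ?_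
  have hab : ∀ x ∈ S.locRadPart P, ∀ y ∈ S.locRadPart P, ⁅x, y⁆ = 0 := by
    intro x hx y hy
    refine locRadPart_induction (p := fun x => ⁅x, y⁆ = 0) ?_ ?_ ?_ hx
    · intro x x' h h'
      rw [add_lie, h, h', add_zero]
    · intro x _ hx
      rw [← lie_skew, hx, neg_zero]
    · intro β hβ x hxN hxβ
      refine locRadPart_induction (p := fun y => ⁅x, y⁆ = 0) ?_ ?_ ?_ hy
      · intro x x' h h'
        rw [lie_add, h, h', add_zero]
      · intro y _ hy
        exact hy x
      · intro γ hγ y hyN hyγ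
        exact S.eq_zero_of_mem_cent ((hP β hβ).2 γ hγ) (S.lie_mem_W hxβ hyγ)
          (S.lie_mem_cent hxN hyN)
  intro y
  classical
  obtain ⟨n, hn⟩ := S.exists_mem_F {x, y}
  let I : LieIdeal K (S.F n) :=
    { (S.locRadPart P).comap (S.F n).toSubmodule.subtype with
      lie_mem := fun {y x} hx => hst y x hx }
  have hI : I ≤ LieAlgebra.center K (S.F n) :=
    (S.abelianIdealsCentral n).le_center I fun x hx y hy => Subtype.ext (hab x hx y hy)
  have hxI : (⟨x, hn x (by simp)⟩ : S.F n) ∈ I := mem_locRadPart hα hx hxα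
  exact congrArg (Subtype.val : S.F n → g)
    (lie_center (K := K) (hI hxI) (⟨y, hn y (by simp)⟩ : S.F n))

theorem isRootOf_of_mem {α : Module.Dual K S.h} (hα : α ≠ 0) {x : g} (hx : x ∈ S.W α)
    (hx0 : x ≠ 0) : IsRootOf K g S.h α :=
  ⟨hα, fun h => hx0 (by rw [W, h] at hx; exact hx)⟩

theorem IsRoot.exists_mem {α : Module.Dual K S.h} (hα : IsRootOf K g S.h α) :
    ∃ x ∈ S.W α, x ≠ 0 := Submodule.exists_mem_ne_zero_of_ne_bot hα.2

theorem zero_notMem_pos : (0 : Module.Dual K S.h) ∉ S.pos := fun h => (S.pos_root 0 h).1 rfl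

theorem IsRoot.neg_mem_pos {α : Module.Dual K S.h} (hα : IsRootOf K g S.h α) (h : α ∉ S.pos) :
    -α ∈ S.pos := by
  by_contra h'
  exact h ((S.pos_polar α hα).2 h')

theorem neg_notMem_pos {α : Module.Dual K S.h} (h : α ∈ S.pos) : -α ∉ S.pos :=
  (S.pos_polar α (S.pos_root α h)).1 h

theorem W_le_b {α : Module.Dual K S.h} (hα : α ∈ S.pos) {x : g} (hx : x ∈ S.W α) : x ∈ S.b := by
  change x ∈ S.b.toSubmodule
  rw [S.b_eq]
  exact Submodule.mem_sup_right (Submodule.mem_iSup_of_mem α (Submodule.mem_iSup_of_mem hα hx))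

theorem h_le_b {x : g} (hx : x ∈ S.h) : x ∈ S.b := by
  change x ∈ S.b.toSubmodule
  rw [S.b_eq]
  exact Submodule.mem_sup_left hx

theorem b_induction {p : g → Prop} (hadd : ∀ x y, p x → p y → p (x + y))
    (hh : ∀ x ∈ S.h, p x) (hpos : ∀ α ∈ S.pos, ∀ x ∈ S.W α, p x) {x : g} (hx : x ∈ S.b) : p x := by
  change x ∈ S.b.toSubmodule at hx
  rw [S.b_eq] at hx
  obtain ⟨y, hy, z, hz, rfl⟩ := Submodule.mem_sup.1 hx
  have hp0 : p 0 := hh 0 (zero_mem _)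
  refine hadd _ _ (hh y hy) ?_
  refine Submodule.iSup_induction _ (motive := p) hz ?_ hp0 hadd
  intro α w hw
  by_cases hα : α ∈ S.pos
  · rw [iSup_pos hα] at hw
    exact hpos α hα w hw
  · rw [iSup_neg hα] at hw
    rwa [(Submodule.mem_bot K).1 hw]

theorem mem_b_iff {x : g} : x ∈ S.b ↔ ∀ α, S.proj α x ≠ 0 → α = 0 ∨ α ∈ S.pos := by
  constructor
  · intro hx
    refine b_induction (p := fun x => ∀ α, S.proj α x ≠ 0 → α = 0 ∨ α ∈ S.pos) ?_ ?_ ?_ hx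
    · intro x y hx hy α hα
      by_cases h : S.proj α x = 0
      · refine hy α fun h' => hα ?_
        rw [map_add, h, h', add_zero]
      · exact hx α h
    · intro x hx α hα
      by_contra h
      exact hα (S.proj_of_ne (S.mem_W_zero.2 hx) (fun h' => h (Or.inl h'.symm)))
    · intro β hβ x hx α hα
      by_contra h
      exact hα (S.proj_of_ne hx (fun h' => h (Or.inr (h' ▸ hβ))))
  · intro h
    rw [← S.sum_proj x]
    refine sum_mem fun α hα => ?_
    rcases h α (by simpa using hα) with rfl | h1
    · exact h_le_b (S.mem_W_zero.1 (S.proj_mem _ _))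
    · exact W_le_b h1 (S.proj_mem _ _)

/-- A Lie subalgebra containing `h`, the simple root spaces and the negative root spaces is `g`. -/
theorem IsDynkin.b_le (hD : S.IsDynkin) {A : LieSubalgebra K g} (hh : ∀ x ∈ S.h, x ∈ A)
    (hs : ∀ β, S.IsSimpleRoot β → ∀ x ∈ S.W β, x ∈ A) {x : g} (hx : x ∈ S.b) : x ∈ A := by
  rw [IsDynkin] at hD
  rw [hD] at hx
  refine LieSubalgebra.lieSpan_le.2 ?_ hx
  rintro y (hy | hy)
  · exact hh y hy
  · obtain ⟨β, hβ, hy⟩ := Set.mem_iUnion₂.1 hy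
    exact hs β hβ y hy

theorem IsSimpleRoot.not_add {β : Module.Dual K S.h} (hβ : S.IsSimpleRoot β)
    {γ δ : Module.Dual K S.h} (hγ : γ ∈ S.pos) (hδ : δ ∈ S.pos) : γ + δ ≠ β := fun h =>
  hβ.2 ⟨{γ, δ}, by simp, by simp [hγ, hδ], by simpa using h⟩

theorem IsDynkin.locRad_inf_W (hD : S.IsDynkin) {α : Module.Dual K S.h} (hα : α ≠ 0) {x : g}
    (hx : x ∈ S.locRad) (hxα : x ∈ S.W α) : x = 0 := by
  have hneg : ∀ α, IsRootOf K g S.h α → α ∉ S.pos → ∀ x ∈ S.locRad, x ∈ S.W α → x = 0 := by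
    intro α hα hα' x hx hxα
    refine locRad_inf_W_eq_zero (P := {α | IsRootOf K g S.h α ∧ α ∉ S.pos}) ?_ ?_ ⟨hα, hα'⟩ hx hxα
    · rintro α ⟨hα, hα'⟩
      refine ⟨hα.1, fun γ hγ h => hγ.2 ?_⟩
      rw [← neg_eq_of_add_eq_zero_right h]
      exact IsRoot.neg_mem_pos hα hα'
    · set P := {α | IsRootOf K g S.h α ∧ α ∉ S.pos} with hP
      let A : LieSubalgebra K g :=
        { carrier := {y | ∀ x ∈ S.locRadPart P, ⁅y, x⁆ ∈ S.locRadPart P}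
          add_mem' := fun ha hb x hx => by rw [add_lie]; exact add_mem (ha x hx) (hb x hx)
          zero_mem' := fun x _ => by rw [zero_lie]; exact zero_mem _
          smul_mem' := fun c y hy x hx => by rw [smul_lie]; exact Submodule.smul_mem _ c (hy x hx)
          lie_mem' := fun {a b} ha hb x hx => by
            rw [lie_lie]
            exact sub_mem (ha _ (hb x hx)) (hb _ (ha x hx)) }
      have hA : ∀ γ y, y ∈ S.W γ → (∀ α ∈ P, ∀ x ∈ S.locRad, x ∈ S.W α →
          ⁅y, x⁆ ∈ S.locRadPart P) → y ∈ A := by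
        intro γ y _ h x hx
        refine locRadPart_induction (p := fun x => ⁅y, x⁆ ∈ S.locRadPart P) ?_ ?_ h hx
        · intro x x' h h'
          rw [lie_add]
          exact add_mem h h'
        · intro x _ hx
          rw [hx y]
          exact zero_mem _
      have hbA : ∀ y ∈ S.b, y ∈ A := by
        intro y hy
        refine hD.b_le ?_ ?_ hy
        · intro y hy
          refine hA 0 y (S.mem_W_zero.2 hy) fun α hα x hxN hx => ?_
          rw [hx ⟨y, hy⟩]
          exact Submodule.smul_mem _ _ (mem_locRadPart hα hxN hx)
        · intro β hβ y hy
          refine hA β y hy fun α hα x hxN hx => ?_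
          have h1 := S.lie_mem_W hy hx
          have h2 := S.lie_mem_locRad y hxN
          by_cases h0 : β + α = 0
          · rw [h0, S.mem_W_zero] at h1
            exact Submodule.mem_sup_right ⟨h2, S.mem_cent_of_mem_locRad h2 h1⟩
          by_cases hz : ⁅y, x⁆ = 0
          · rw [hz]; exact zero_mem _
          have h3 := isRootOf_of_mem h0 h1 hz
          have h4 : β + α ∈ P := ⟨h3, fun h4 =>
            hβ.not_add h4 (IsRoot.neg_mem_pos hα.1 hα.2) (by abel)⟩
          exact mem_locRadPart h4 h2 h1
      intro y
      refine S.W_induction (p := fun y => y ∈ A) (fun _ _ => add_mem) ?_ y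
      intro γ y hy
      by_cases hy0 : y = 0
      · rw [hy0]; exact zero_mem _
      by_cases hγ0 : γ = 0
      · subst hγ0
        exact hbA y (h_le_b (S.mem_W_zero.1 hy))
      have hγ := isRootOf_of_mem hγ0 hy hy0
      by_cases hγp : γ ∈ S.pos
      · exact hbA y (W_le_b hγp hy)
      refine hA γ y hy fun α hα x hxN hx => ?_
      have h1 := S.lie_mem_W hy hx
      have h2 := S.lie_mem_locRad y hxN
      by_cases hz : ⁅y, x⁆ = 0
      · rw [hz]; exact zero_mem _
      have h0 : γ + α ≠ 0 := by
        intro h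
        apply hα.2
        rw [← neg_eq_of_add_eq_zero_right h]
        exact IsRoot.neg_mem_pos hγ hγp
      have h3 := isRootOf_of_mem h0 h1 hz
      have h4 : γ + α ∈ P := ⟨h3, S.neg_add γ α hγ hα.1 hγp hα.2 h3⟩
      exact mem_locRadPart h4 h2 h1
  have hpos : ∀ α ∈ S.pos, ∀ x ∈ S.locRad, x ∈ S.W α → x = 0 := by
    intro α hα x hx hxα
    refine locRad_inf_W_eq_zero (P := S.pos) ?_ ?_ hα hx hxα
    · intro α hα
      refine ⟨(S.pos_root α hα).1, fun γ hγ h => ?_⟩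
      rw [← neg_eq_of_add_eq_zero_right h] at hγ
      exact neg_notMem_pos hα hγ
    · intro y x hx
      refine locRadPart_induction (p := fun x => ⁅y, x⁆ ∈ S.locRadPart S.pos) ?_ ?_ ?_ hx
      · intro x x' h h'
        rw [lie_add]
        exact add_mem h h'
      · intro x _ hx
        rw [hx y]
        exact zero_mem _
      · intro α hα x hxN hx
        refine S.W_induction (p := fun y => ⁅y, x⁆ ∈ S.locRadPart S.pos) ?_ ?_ y
        · intro x x' h h'
          rw [add_lie]
          exact add_mem h h'
        · intro γ y hy
          have h1 := S.lie_mem_W hy hx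
          have h2 := S.lie_mem_locRad y hxN
          by_cases h0 : γ + α = 0
          · rw [h0, S.mem_W_zero] at h1
            exact Submodule.mem_sup_right ⟨h2, S.mem_cent_of_mem_locRad h2 h1⟩
          by_cases hz : ⁅y, x⁆ = 0
          · rw [hz]; exact zero_mem _
          have h3 := isRootOf_of_mem h0 h1 hz
          by_cases h4 : γ + α ∈ S.pos
          · exact mem_locRadPart h4 h2 h1
          · exact absurd (hneg _ h3 h4 _ h2 h1) hz
  by_contra hx0
  have hr := isRootOf_of_mem hα hxα hx0
  by_cases h : α ∈ S.pos
  · exact hx0 (hpos α h x hx hxα)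
  · exact hx0 (hneg α hr h x hx hxα)

end Setup
end Paper

namespace Paper

section Theta

variable {K : Type*} [Field K] [CharZero K] {L : Type*} [LieRing L] [LieAlgebra K L]

theorem exists_exp_ad (e : L) (he : IsNilpotent (LieAlgebra.ad K L e)) :
    ∃ θ : L ≃ₗ⁅K⁆ L, (∀ x, ⁅e, ⁅e, x⁆⁆ = 0 → θ x = x + ⁅e, x⁆) ∧
      (∀ x, ⁅e, ⁅e, ⁅e, x⁆⁆⁆ = 0 → θ x = x + ⁅e, x⁆ + (2⁻¹ : K) • ⁅e, ⁅e, x⁆⁆) ∧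
      ∀ N : Submodule K L, (∀ x ∈ N, ⁅e, x⁆ ∈ N) → ∀ x ∈ N, θ x ∈ N := by
  let : Module ℚ L := Module.compHom L (algebraMap ℚ K)
  have hsm : ∀ (q : ℚ) (x : L), q • x = (algebraMap ℚ K q) • x := fun _ _ => rfl
  let : LieAlgebra ℚ L := { lie_smul := fun q x y => by rw [hsm, hsm, lie_smul] }
  have : IsScalarTower ℚ K L := ⟨fun q c x => by rw [hsm, Algebra.smul_def, mul_smul]⟩
  have : SMulCommClass K ℚ L := ⟨fun c q x => by rw [hsm, hsm, smul_comm]⟩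
  have hD : (LieDerivation.ad K L e).toLinearMap = LieAlgebra.ad K L e :=
    LinearMap.ext fun x => by simp
  have hn : IsNilpotent (LieDerivation.ad K L e).toLinearMap := by rwa [hD]
  have key : ∀ x k, ((LieAlgebra.ad K L e) ^ k) x = 0 → (LieDerivation.ad K L e).exp hn x =
      ∑ i ∈ Finset.range k, (i.factorial : ℚ)⁻¹ • ((LieAlgebra.ad K L e) ^ i) x := by
    intro x k hk
    rw [← hD] at hk ⊢
    rw [LieDerivation.exp_map_apply]
    exact IsNilpotent.exp_smul_eq_sum (M := L) (m := x) hk hn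
  refine ⟨(LieDerivation.ad K L e).exp hn, ?_, ?_, ?_⟩
  · intro x hx
    rw [key x 2 (by simpa [pow_succ] using hx)]
    simp [Finset.sum_range_succ]
  · intro x hx
    rw [key x 3 (by simpa [pow_succ] using hx)]
    simp [Finset.sum_range_succ, pow_succ, hsm, Nat.factorial]
  · intro N hN x hx
    obtain ⟨k, hk⟩ := he
    rw [key x k (by rw [hk]; rfl)]
    refine sum_mem fun i _ => ?_
    rw [hsm]
    refine Submodule.smul_mem _ _ ?_
    clear * - hN hx
    induction i with
    | zero => simpa using hx
    | succ i ih => rw [pow_succ', Module.End.mul_apply]; exact hN _ ih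

theorem exists_theta {e f h : L} (hef : ⁅e, f⁆ = h) (hhe : ⁅h, e⁆ = (2 : K) • e)
    (hhf : ⁅h, f⁆ = -((2 : K) • f)) (he : IsNilpotent (LieAlgebra.ad K L e))
    (hf : IsNilpotent (LieAlgebra.ad K L f)) :
    ∃ θ : L ≃ₗ⁅K⁆ L, (∀ (x : L) (c : K), ⁅x, e⁆ = c • e → ⁅x, f⁆ = -(c • f) → θ x = x - c • h) ∧
      ∀ N : Submodule K L, (∀ x ∈ N, ⁅e, x⁆ ∈ N) → (∀ x ∈ N, ⁅f, x⁆ ∈ N) → ∀ x ∈ N, θ x ∈ N := by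
  obtain ⟨θ₁, h1, h1', hN1⟩ := exists_exp_ad e he
  obtain ⟨θ₂, h2, h2', hN2⟩ := exists_exp_ad (K := K) (-f) (by rw [map_neg]; exact hf.neg)
  have hfe : ⁅f, e⁆ = -h := by rw [← lie_skew, hef]
  have heh : ⁅e, h⁆ = -((2 : K) • e) := by rw [← lie_skew, hhe]
  have hfh : ⁅f, h⁆ = (2 : K) • f := by rw [← lie_skew, hhf, neg_neg]
  refine ⟨(θ₁.trans θ₂).trans θ₁, fun x c hxe hxf => ?_, fun N he hf x hx => ?_⟩
  · have hex : ⁅e, x⁆ = -(c • e) := by rw [← lie_skew, hxe]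
    have hfx : ⁅f, x⁆ = c • f := by rw [← lie_skew, hxf, neg_neg]
    have a1 : θ₁ x = x - c • e := by
      rw [h1 x (by simp [hex]), hex]; abel
    have a2 : θ₂ x = x - c • f := by
      rw [h2 x (by simp [hfx]), neg_lie, hfx]; abel
    have a3 : θ₂ e = e + h - f := by
      rw [h2' e (by simp [hfe, hfh])]
      simp only [neg_lie, hfe, hfh, neg_neg]
      module
    have a4 : θ₁ e = e := by rw [h1 e (by simp)]; simp
    have a5 : θ₁ h = h - (2 : K) • e := by
      rw [h1 h (by simp [heh]), heh]; abel
    have a6 : θ₁ (x - c • h - c • e) = x - c • h := by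
      rw [map_sub, map_sub, map_smul, map_smul, a1, a4, a5]
      module
    change θ₁ (θ₂ (θ₁ x)) = _
    rw [a1, map_sub, map_smul, a2, a3, ← a6]
    congr 1
    module
  · exact hN1 N he _ (hN2 N (fun x hx => by rw [neg_lie]; exact neg_mem (hf x hx)) _ (hN1 N he x hx))

end Theta
end Paper

namespace Paper

namespace Setup

variable {K : Type} [Field K] [CharZero K] [IsAlgClosed K] {g : Type} [LieRing g] [LieAlgebra K g]
variable {S : Setup K g}

theorem finite_weights (S : Setup K g) (n : ℕ) :
    {δ | ∃ x ∈ S.F n, x ∈ S.W δ ∧ x ≠ 0}.Finite := by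
  have hfin : FiniteDimensional K (S.F n) := S.F_findim n
  set P := {δ | ∃ x ∈ S.F n, x ∈ S.W δ ∧ x ≠ 0} with hP
  choose v hv using fun δ : P => δ.2
  have h1 : LinearIndependent K v := iSupIndep.linearIndependent (fun δ : P => S.W δ)
    (S.h_indep.comp (Subtype.val_injective (p := (· ∈ P)))) (fun δ => (hv δ).2.1)
    (fun δ => (hv δ).2.2)
  have h2 : LinearIndependent K (fun δ : P => (⟨v δ, (hv δ).1⟩ : S.F n)) :=
    LinearIndependent.of_comp (S.F n).toSubmodule.subtype h1
  have := h2.finite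
  exact Set.toFinite P

theorem exists_pow_ad_eq_zero {β : Module.Dual K S.h} (hβ : β ≠ 0) {e : g} (he : e ∈ S.W β)
    (x : g) : ∃ k, ((LieAlgebra.ad K g e) ^ k) x = 0 := by
  refine S.W_induction (p := fun x => ∃ k, ((LieAlgebra.ad K g e) ^ k) x = 0) ?_ ?_ x
  · rintro x y ⟨k, hk⟩ ⟨l, hl⟩
    refine ⟨k + l, ?_⟩
    rw [map_add, pow_add, Module.End.mul_apply, Module.End.mul_apply, hl, map_zero, add_zero,
      ← Module.End.mul_apply, ← pow_add, add_comm, pow_add, Module.End.mul_apply, hk, map_zero]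
  · intro δ x hx
    by_contra! h
    classical
    obtain ⟨m, hm⟩ := S.exists_mem_F {e, x}
    have hW : ∀ k, ((LieAlgebra.ad K g e) ^ k) x ∈ S.W (δ + k • β) := by
      intro k
      induction k with
      | zero => simpa using hx
      | succ k ih =>
        rw [pow_succ', Module.End.mul_apply, LieAlgebra.ad_apply]
        have := S.lie_mem_W he ih
        rwa [show β + (δ + k • β) = δ + (k + 1) • β by rw [succ_nsmul]; abel] at this
    have hF : ∀ k, ((LieAlgebra.ad K g e) ^ k) x ∈ S.F m := by
      intro k
      induction k with
      | zero => exact hm x (by simp)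
      | succ k ih =>
        rw [pow_succ', Module.End.mul_apply, LieAlgebra.ad_apply]
        exact (S.F m).lie_mem (hm e (by simp)) ih
    have hmem : ∀ k : ℕ, δ + k • β ∈ {δ | ∃ x ∈ S.F m, x ∈ S.W δ ∧ x ≠ 0} :=
      fun k => ⟨_, hF k, hW k, h k⟩
    refine Set.infinite_of_injective_forall_mem ?_ hmem (S.finite_weights m)
    intro k l hkl
    have h1 : k • β = l • β := add_left_cancel hkl
    rw [← Nat.cast_smul_eq_nsmul K, ← Nat.cast_smul_eq_nsmul K] at h1
    exact_mod_cast smul_left_injective K hβ h1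

theorem isNilpotent_ad {β : Module.Dual K S.h} (hβ : β ≠ 0) {e : g} (he : e ∈ S.W β) {m : ℕ}
    (hem : e ∈ S.F m) : IsNilpotent (LieAlgebra.ad K (S.F m) ⟨e, hem⟩) := by
  have hfin : FiniteDimensional K (S.F m) := S.F_findim m
  refine Module.End.isNilpotent_iff_of_finite.2 fun x => ?_
  obtain ⟨k, hk⟩ := exists_pow_ad_eq_zero hβ he (x : g)
  refine ⟨k, Subtype.ext ?_⟩
  rw [ZeroMemClass.coe_zero, ← hk]
  clear hk
  induction k with
  | zero => rfl
  | succ k ih =>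
    rw [pow_succ', pow_succ', Module.End.mul_apply, Module.End.mul_apply, ← ih]
    rfl

/-- `e`, `f` and the coroot `H` form an `sl₂`-triple for the root `β`. -/
structure Triple (S : Setup K g) (β : Module.Dual K S.h) (e f : g) (H : S.h) : Prop where
  he : e ∈ S.W β
  hf : f ∈ S.W (-β)
  ef : ⁅e, f⁆ = H
  two : β H = 2

namespace Triple

variable {β : Module.Dual K S.h} {e f : g} {H : S.h}

theorem fe (T : S.Triple β e f H) : ⁅f, e⁆ = -(H : g) := by rw [← lie_skew, T.ef]

theorem symm (T : S.Triple β e f H) : S.Triple (-β) f e (-H) :=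
  ⟨T.hf, by rw [neg_neg]; exact T.he, by rw [T.fe]; rfl, by simp [T.two]⟩

theorem ne_zero (T : S.Triple β e f H) : β ≠ 0 := by
  rintro rfl
  simpa using T.two

theorem H_ne_zero (T : S.Triple β e f H) : H ≠ 0 := by
  rintro rfl
  simpa using T.two

theorem e_ne_zero (T : S.Triple β e f H) : e ≠ 0 := by
  rintro rfl
  exact T.H_ne_zero (Subtype.ext (by rw [← T.ef, zero_lie]; rfl))

theorem f_ne_zero (T : S.Triple β e f H) : f ≠ 0 := T.symm.e_ne_zero

theorem isRootOf (T : S.Triple β e f H)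
    : IsRootOf K g S.h β := isRootOf_of_mem T.ne_zero T.he T.e_ne_zero

theorem exists_theta (T : S.Triple β e f H) {m : ℕ} (hem : e ∈ S.F m) (hfm : f ∈ S.F m) :
    ∃ θ : S.F m ≃ₗ⁅K⁆ S.F m,
      (∀ (H' : S.h) (hH' : (H' : g) ∈ S.F m), (θ ⟨H', hH'⟩ : g) = (H' - β H' • H : S.h)) ∧
      ∀ N : Submodule K g, (∀ x ∈ N, ⁅e, x⁆ ∈ N) → (∀ x ∈ N, ⁅f, x⁆ ∈ N) →
        ∀ x : S.F m, (x : g) ∈ N → (θ x : g) ∈ N := by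
  have hHm : (H : g) ∈ S.F m := by rw [← T.ef]; exact (S.F m).lie_mem hem hfm
  obtain ⟨θ, h1, h2⟩ := Paper.exists_theta (K := K) (e := (⟨e, hem⟩ : S.F m)) (f := ⟨f, hfm⟩)
    (h := ⟨H, hHm⟩) (Subtype.ext T.ef) (Subtype.ext (by
      have := T.he H; rw [T.two] at this; exact this))
    (Subtype.ext (by
      have := T.hf H; rw [LinearMap.neg_apply, T.two, neg_smul] at this; exact this))
    (isNilpotent_ad T.ne_zero T.he hem) (isNilpotent_ad T.symm.ne_zero T.hf hfm)
  refine ⟨θ, fun H' hH' => ?_, fun N he hf x hx => ?_⟩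
  · rw [h1 _ (β H') (Subtype.ext (T.he H')) (Subtype.ext (by
      have := T.hf H'; rw [LinearMap.neg_apply, neg_smul] at this; exact this))]
    rfl
  · exact h2 (N.comap (S.F m).toSubmodule.subtype) (fun x hx => he x hx) (fun x hx => hf x hx) x hx

end Triple

theorem exists_level (hD : S.IsDynkin) {β : Module.Dual K S.h} (hβ : β ≠ 0) {e : g}
    (he : e ∈ S.W β) (he0 : e ≠ 0) (e' : g) :
    ∃ m, e ∈ S.F m ∧ e' ∈ S.F m ∧ e ∉ S.radN m ∧ S.resDual m β ≠ 0 := by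
  obtain ⟨H, hH⟩ := exists_apply_ne_zero hβ
  classical
  obtain ⟨n, hn⟩ := S.exists_mem_F {e, e', (H : g)}
  have h1 : ¬∃ n, ∀ m ≥ n, e ∈ S.radN m := fun h => he0 (hD.locRad_inf_W hβ h he)
  push Not at h1
  obtain ⟨m, hm, hem⟩ := h1 n
  refine ⟨m, S.F_mono hm (hn e (by simp)), S.F_mono hm (hn e' (by simp)), hem, fun h => hH ?_⟩
  exact LinearMap.congr_fun h ⟨H, H.2, S.F_mono hm (hn H (by simp))⟩

theorem mem_rootSpaceN {m : ℕ} {β : Module.Dual K S.h} {e : g} (he : e ∈ S.W β)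
    (hem : e ∈ S.F m) : e ∈ S.rootSpaceN m (S.resDual m β) :=
  ⟨hem, fun H => he ⟨H, H.2.1⟩⟩

theorem exists_smul_eq (hD : S.IsDynkin) {β : Module.Dual K S.h} (hβ : β ≠ 0) {e e' : g}
    (he : e ∈ S.W β) (he0 : e ≠ 0) (he' : e' ∈ S.W β) : ∃ c : K, e' = c • e := by
  obtain ⟨m, hem, hem', her, hβm⟩ := exists_level hD hβ he he0 e'
  exact (S.rootSpaceN_dichotomy hβm (mem_rootSpaceN he hem) her).1 e' (mem_rootSpaceN he' hem')

theorem exists_triple (hD : S.IsDynkin) {β : Module.Dual K S.h} (hβ : β ≠ 0) {e : g}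
    (he : e ∈ S.W β) (he0 : e ≠ 0) : ∃ f H, S.Triple β e f H := by
  obtain ⟨m, hem, -, her, hβm⟩ := exists_level hD hβ he he0 e
  obtain ⟨y, -, H, hy, hH⟩ := (S.rootSpaceN_dichotomy hβm (mem_rootSpaceN he hem) her).2
  have hH' : β ⟨H, H.2.1⟩ ≠ 0 := hH
  refine ⟨(2 / β ⟨H, H.2.1⟩) • S.proj (-β) y, (2 / β ⟨H, H.2.1⟩) • ⟨H, H.2.1⟩, he,
    Submodule.smul_mem _ _ (S.proj_mem _ _), ?_, ?_⟩
  · have h1 := S.proj_lie (β := -β) he y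
    rw [hy, add_neg_cancel, S.proj_self (S.mem_W_zero.2 H.2.1)] at h1
    rw [lie_smul, ← h1]
    rfl
  · rw [map_smul, smul_eq_mul, div_mul_cancel₀ _ hH']

theorem IsRoot.exists_triple (hD : S.IsDynkin) {β : Module.Dual K S.h}
    (hβ : IsRootOf K g S.h β) : ∃ e f H, S.Triple β e f H := by
  obtain ⟨e, he, he0⟩ := IsRoot.exists_mem hβ
  obtain ⟨f, H, T⟩ := Setup.exists_triple hD hβ.1 he he0
  exact ⟨e, f, H, T⟩

theorem IsRoot.neg (hD : S.IsDynkin) {β : Module.Dual K S.h}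
    (hβ : IsRootOf K g S.h β) : IsRootOf K g S.h (-β) := by
  obtain ⟨e, f, H, T⟩ := IsRoot.exists_triple hD hβ
  exact T.symm.isRootOf

theorem Triple.coroot_unique (hD : S.IsDynkin) {β : Module.Dual K S.h} {e f e' f' : g}
    {H H' : S.h} (T : S.Triple β e f H) (T' : S.Triple β e' f' H') : H' = H := by
  obtain ⟨c, rfl⟩ := exists_smul_eq hD T.ne_zero T.he T.e_ne_zero T'.he
  obtain ⟨d, rfl⟩ := exists_smul_eq hD T.symm.ne_zero T.hf T.f_ne_zero T'.hf
  have h1 : H' = (d * c) • H := Subtype.ext (by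
    rw [← T'.ef, lie_smul, smul_lie, T.ef, smul_smul]; rfl)
  have h2 := T'.two
  rw [h1, map_smul, T.two, smul_eq_mul] at h2
  have h3 : d * c = 1 := mul_right_cancel₀ two_ne_zero (h2.trans (one_mul _).symm)
  rw [h1, h3, one_smul]

theorem IsCoroot.exists_triple {β : Module.Dual K S.h} {H : S.h} (h : S.IsCoroot β H) :
    ∃ e f, S.Triple β e f H := by
  obtain ⟨h2, e, he, f, hf, hef⟩ := h
  exact ⟨e, f, he, hf, hef.symm, h2⟩

end Setup
end Paper

namespace Paper

namespace Setup

variable {K : Type} [Field K] [CharZero K] [IsAlgClosed K] {g : Type} [LieRing g] [LieAlgebra K g]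
variable {S : Setup K g}

theorem lie_mem_iSup {ι : Type*} {φ : ι → Module.Dual K S.h} {β : Module.Dual K S.h} {e : g}
    (he : e ∈ S.W β) (h : ∀ i, ∀ x ∈ S.W (φ i), ⁅e, x⁆ ≠ 0 → ∃ j, φ j = β + φ i) {x : g}
    (hx : x ∈ ⨆ i, S.W (φ i)) : ⁅e, x⁆ ∈ ⨆ i, S.W (φ i) := by
  refine Submodule.iSup_induction _ (motive := fun x => ⁅e, x⁆ ∈ ⨆ i, S.W (φ i)) hx ?_ ?_ ?_
  · intro i x hx
    by_cases h0 : ⁅e, x⁆ = 0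
    · rw [h0]; exact zero_mem _
    obtain ⟨j, hj⟩ := h i x hx h0
    exact Submodule.mem_iSup_of_mem j (hj ▸ S.lie_mem_W he hx)
  · rw [lie_zero]; exact zero_mem _
  · intro x y hx hy
    rw [lie_add]
    exact add_mem hx hy

theorem exists_of_proj_ne_zero {ι : Type*} {φ : ι → Module.Dual K S.h} {x : g}
    (hx : x ∈ ⨆ i, S.W (φ i)) {γ : Module.Dual K S.h} (hγ : S.proj γ x ≠ 0) : ∃ i, φ i = γ := by
  by_contra! h
  apply hγ
  refine Submodule.iSup_induction _ (motive := fun x => S.proj γ x = 0) hx ?_ (map_zero _) ?_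
  · intro i x hx
    exact S.proj_of_ne hx (h i)
  · intro x y hx hy
    rw [map_add, hx, hy, add_zero]

theorem mem_W_of_proj {x : g} {δ : Module.Dual K S.h} (h : ∀ γ, S.proj γ x ≠ 0 → γ = δ) :
    x ∈ S.W δ := by
  rw [← S.sum_proj x]
  refine sum_mem fun γ hγ => ?_
  rw [← h γ (by simpa using hγ)]
  exact S.proj_mem _ _

theorem proj_h_lie (H : S.h) (γ : Module.Dual K S.h) (x : g) :
    S.proj γ ⁅(H : g), x⁆ = γ H • S.proj γ x := by
  have := S.proj_lie (β := γ) (S.mem_W_zero.2 H.2) x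
  rw [zero_add] at this
  rw [this, S.proj_mem γ x H]

theorem LieEquiv.eq_zero_of_apply {m : ℕ} (θ : S.F m ≃ₗ⁅K⁆ S.F m) {x : S.F m}
    (h : (θ x : g) = 0) : x = 0 :=
  θ.toLinearEquiv.map_eq_zero_iff.1 (Subtype.ext h : θ.toLinearEquiv x = 0)

namespace Triple

variable {β : Module.Dual K S.h} {e f : g} {H : S.h}

theorem theta_spec (T : S.Triple β e f H) {m : ℕ} (hem : e ∈ S.F m) (hfm : f ∈ S.F m) :
    ∃ θ : S.F m ≃ₗ⁅K⁆ S.F m,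
      (∀ (H' : S.h) (hH' : (H' : g) ∈ S.F m), (θ ⟨H', hH'⟩ : g) = (H' - β H' • H : S.h)) ∧
      (∀ N : Submodule K g, (∀ x ∈ N, ⁅e, x⁆ ∈ N) → (∀ x ∈ N, ⁅f, x⁆ ∈ N) →
        ∀ x : S.F m, (x : g) ∈ N → (θ x : g) ∈ N) ∧
      (∀ (x : S.F m) (δ : Module.Dual K S.h), (x : g) ∈ S.W δ → (θ x : g) ∈ S.W (δ - δ H • β)) ∧
      ∀ (x : S.F m) (δ : Module.Dual K S.h), (x : g) ∈ S.W δ → x ≠ 0 → ∃ n : ℤ, δ H = n := by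
  obtain ⟨θ, h1, h2⟩ := T.exists_theta hem hfm
  have hHm : (H : g) ∈ S.F m := by rw [← T.ef]; exact (S.F m).lie_mem hem hfm
  have key : ∀ (x : S.F m) (δ γ : Module.Dual K S.h), (x : g) ∈ S.W δ →
      S.proj γ (θ x) ≠ 0 → (∃ n : ℤ, δ H = n) ∧ γ = δ - δ H • β := by
    intro x δ γ hx hγ
    have h3 : (θ x : g) ∈ ⨆ j : ℤ, S.W (δ + (j : K) • β) := by
      refine h2 _ (fun y hy => ?_) (fun y hy => ?_) x ?_
      · refine lie_mem_iSup T.he (fun i _ _ _ => ⟨i + 1, ?_⟩) hy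
        push_cast
        module
      · refine lie_mem_iSup T.hf (fun i _ _ _ => ⟨i - 1, ?_⟩) hy
        push_cast
        module
      · refine Submodule.mem_iSup_of_mem 0 ?_
        simpa using hx
    obtain ⟨j, rfl⟩ := exists_of_proj_ne_zero h3 hγ
    have h4 : ⁅(H : g), (θ x : g)⁆ = -(δ H • (θ x : g)) := by
      have h5 : θ ⟨H, hHm⟩ = -⟨H, hHm⟩ := Subtype.ext (by
        rw [h1 H hHm, T.two, two_smul]
        simp)
      have h6 : ⁅(⟨H, hHm⟩ : S.F m), x⁆ = δ H • x := Subtype.ext (hx H)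
      have h7 := θ.map_lie ⟨H, hHm⟩ x
      rw [h6, h5, map_smul, neg_lie] at h7
      rw [← neg_eq_iff_eq_neg]
      exact congrArg (Subtype.val : S.F m → g) h7.symm
    have h5 := proj_h_lie H (δ + (j : K) • β) (θ x : g)
    rw [h4, map_neg, map_smul, ← neg_smul] at h5
    have h6 := smul_left_injective K hγ h5
    rw [LinearMap.add_apply, LinearMap.smul_apply, T.two, smul_eq_mul] at h6
    have h7 : δ H = -j := by
      have : (2 : K) * (δ H + j) = 0 := by linear_combination -h6
      linear_combination (mul_eq_zero.1 this).resolve_left two_ne_zero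
    refine ⟨⟨-j, by rw [h7]; push_cast; rfl⟩, ?_⟩
    rw [h7]
    module
  refine ⟨θ, h1, h2, fun x δ hx => mem_W_of_proj fun γ hγ => (key x δ γ hx hγ).2,
    fun x δ hx hx0 => ?_⟩
  by_contra h
  refine hx0 (LieEquiv.eq_zero_of_apply θ (S.eq_zero_of_proj fun γ => ?_))
  by_contra h0
  exact h (key x δ γ hx h0).1

theorem exists_level (_T : S.Triple β e f H) (x : g) : ∃ m, e ∈ S.F m ∧ f ∈ S.F m ∧ x ∈ S.F m := by
  classical
  obtain ⟨n, hn⟩ := S.exists_mem_F {e, f, x}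
  exact ⟨n, hn e (by simp), hn f (by simp), hn x (by simp)⟩

theorem exists_int (T : S.Triple β e f H)
    {δ : Module.Dual K S.h} {x : g} (hx : x ∈ S.W δ) (hx0 : x ≠ 0) :
    ∃ n : ℤ, δ H = n := by
  obtain ⟨m, hem, hfm, hxm⟩ := T.exists_level x
  obtain ⟨θ, -, -, -, h⟩ := T.theta_spec hem hfm
  exact h ⟨x, hxm⟩ δ hx (fun h => hx0 (congrArg (Subtype.val : S.F m → g) h))

theorem reflect (T : S.Triple β e f H)
    {δ : Module.Dual K S.h} {e' f' : g} {H' : S.h} (T' : S.Triple δ e' f' H') :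
    ∃ e'' f'', S.Triple (δ - δ H • β) e'' f'' (H' - β H' • H) := by
  classical
  obtain ⟨m, hm⟩ := S.exists_mem_F {e, f, e', f'}
  have he'm := hm e' (by simp)
  have hf'm := hm f' (by simp)
  have hH'm : (H' : g) ∈ S.F m := by rw [← T'.ef]; exact (S.F m).lie_mem he'm hf'm
  obtain ⟨θ, h1, -, h3, -⟩ := T.theta_spec (hm e (by simp)) (hm f (by simp))
  refine ⟨θ ⟨e', he'm⟩, θ ⟨f', hf'm⟩, h3 _ _ T'.he, ?_, ?_, ?_⟩
  · have := h3 ⟨f', hf'm⟩ _ T'.hf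
    rwa [show -δ - (-δ) H • β = -(δ - δ H • β) by
      rw [LinearMap.neg_apply]; module] at this
  · rw [← h1 H' hH'm, ← LieSubalgebra.coe_bracket, ← LieEquiv.map_lie]
    congr 2
    exact Subtype.ext T'.ef
  · simp only [map_sub, map_smul, LinearMap.sub_apply, LinearMap.smul_apply, smul_eq_mul, T.two,
      T'.two]
    ring

theorem eq_zero_of_mem_W_two (T : S.Triple β e f H)
    (hD : S.IsDynkin) {x : g} (hx : x ∈ S.W ((2 : K) • β)) : x = 0 := by
  have h1 : ⁅e, x⁆ = 0 := by
    by_contra h0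
    have h1 := S.lie_mem_W T.he hx
    have h3 : β + (2 : K) • β = (3 : K) • β := by module
    rw [h3] at h1
    obtain ⟨f', H', T'⟩ := exists_triple hD (smul_ne_zero three_ne_zero T.ne_zero) h1 h0
    obtain ⟨n, hn⟩ := T'.exists_int T.he T.e_ne_zero
    have h4 := T'.two
    rw [LinearMap.smul_apply, smul_eq_mul, hn] at h4
    have h5 : 3 * n = 2 := by exact_mod_cast h4
    omega
  have h2 : ⁅f, x⁆ ∈ S.W β := by
    have := S.lie_mem_W T.hf hx
    rwa [show -β + (2 : K) • β = β by module] at this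
  obtain ⟨c, hc⟩ := exists_smul_eq hD T.ne_zero T.he T.e_ne_zero h2
  have h3 : ⁅(H : g), x⁆ = 0 := by
    rw [← T.ef, lie_lie, hc, h1, lie_smul, lie_self, lie_zero, smul_zero, sub_zero]
  rw [hx H, LinearMap.smul_apply, T.two, smul_eq_mul] at h3
  exact (smul_eq_zero.1 h3).resolve_left (mul_ne_zero two_ne_zero two_ne_zero)

theorem not_isRootOf_two (T : S.Triple β e f H)
    (hD : S.IsDynkin) : ¬IsRootOf K g S.h ((2 : K) • β) := fun h => by
  obtain ⟨x, hx, hx0⟩ := IsRoot.exists_mem h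
  exact hx0 (T.eq_zero_of_mem_W_two hD hx)

theorem simplePart_stable (T : S.Triple β e f H) (hD : S.IsDynkin) (hβ : S.IsSimpleRoot β) :
    (∀ y ∈ ⨆ γ : {γ // γ ∈ S.pos ∧ γ ≠ β}, S.W γ, ⁅e, y⁆ ∈ ⨆ γ : {γ // γ ∈ S.pos ∧ γ ≠ β}, S.W γ) ∧
      ∀ y ∈ ⨆ γ : {γ // γ ∈ S.pos ∧ γ ≠ β}, S.W γ,
        ⁅f, y⁆ ∈ ⨆ γ : {γ // γ ∈ S.pos ∧ γ ≠ β}, S.W γ := by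
  refine ⟨fun y hy => ?_, fun y hy => ?_⟩
  · refine lie_mem_iSup (φ := fun γ : {γ // γ ∈ S.pos ∧ γ ≠ β} => γ.1) T.he ?_ hy
    rintro ⟨γ, hγ, hγβ⟩ y hy h0
    have h8 : β + γ ≠ 0 := by
      intro h
      rw [← neg_eq_of_add_eq_zero_right h] at hγ
      exact neg_notMem_pos hβ.1 hγ
    refine ⟨⟨β + γ, S.pos_add β hβ.1 γ hγ (isRootOf_of_mem h8 (S.lie_mem_W T.he hy) h0), ?_⟩, rfl⟩
    intro h
    exact (S.pos_root γ hγ).1 (add_eq_left.1 h)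
  · refine lie_mem_iSup (φ := fun γ : {γ // γ ∈ S.pos ∧ γ ≠ β} => γ.1) T.hf ?_ hy
    rintro ⟨γ, hγ, hγβ⟩ y hy h0
    have h8 : -β + γ ≠ 0 := fun h => hγβ (by rw [← neg_eq_of_add_eq_zero_right h, neg_neg])
    have h9 := isRootOf_of_mem h8 (S.lie_mem_W T.hf hy) h0
    refine ⟨⟨-β + γ, ?_, ?_⟩, rfl⟩
    · by_contra h
      exact hβ.not_add hγ (IsRoot.neg_mem_pos h9 h) (by abel)
    · intro h
      have h10 : γ = (2 : K) • β := by
        rw [two_smul, ← eq_neg_add_iff_add_eq.1 h.symm]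
      exact T.not_isRootOf_two hD (h10 ▸ S.pos_root γ hγ)

theorem reflect_mem_pos (T : S.Triple β e f H)
    (hD : S.IsDynkin) (hβ : S.IsSimpleRoot β) {δ : Module.Dual K S.h}
    (hδ : δ ∈ S.pos) (hne : δ ≠ β) : δ - δ H • β ∈ S.pos ∧ δ - δ H • β ≠ β := by
  obtain ⟨x, hx, hx0⟩ := IsRoot.exists_mem (S.pos_root δ hδ)
  obtain ⟨m, hem, hfm, hxm⟩ := T.exists_level x
  obtain ⟨θ, -, h2, h3, -⟩ := T.theta_spec hem hfm
  have h4 := h3 ⟨x, hxm⟩ δ hx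
  have h5 : (θ ⟨x, hxm⟩ : g) ≠ 0 := fun h => hx0
    (congrArg (Subtype.val : S.F m → g) (LieEquiv.eq_zero_of_apply θ h))
  have h6 : (θ ⟨x, hxm⟩ : g) ∈ ⨆ γ : {γ // γ ∈ S.pos ∧ γ ≠ β}, S.W γ := by
    exact h2 _ (T.simplePart_stable hD hβ).1 (T.simplePart_stable hD hβ).2 _
      (Submodule.mem_iSup_of_mem ⟨δ, hδ, hne⟩ hx)
  obtain ⟨⟨γ, hγ⟩, h7⟩ := exists_of_proj_ne_zero h6
    (show S.proj (δ - δ H • β) _ ≠ 0 by rw [S.proj_self h4]; exact h5)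
  change γ = _ at h7
  rwa [← h7]

end Triple

end Setup
end Paper

namespace Paper

namespace Setup

variable {K : Type} [Field K] [CharZero K] [IsAlgClosed K] {g : Type} [LieRing g] [LieAlgebra K g]
variable {S : Setup K g}

theorem resDual_of_proj {n : ℕ} {α : Module.Dual K (S.hn n)} {x : g} (hx : x ∈ S.rootSpaceN n α)
    {δ : Module.Dual K S.h} (hδ : S.proj δ x ≠ 0) : α = S.resDual n δ := by
  refine LinearMap.ext fun H => ?_
  have h1 := proj_h_lie (S := S) (⟨(H : g), H.2.1⟩ : S.h) δ x
  rw [show ⁅((⟨(H : g), H.2.1⟩ : S.h) : g), x⁆ = α H • x from hx.2 H, map_smul] at h1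
  exact smul_left_injective K hδ h1

theorem exists_proj_ne_zero {x : g} (hx : x ≠ 0) : ∃ δ, S.proj δ x ≠ 0 := by
  by_contra! h
  exact hx (S.eq_zero_of_proj h)

theorem finite_posRootsN (S : Setup K g) (n : ℕ) : (S.posRootsN n).Finite := by
  have hfin : FiniteDimensional K (S.F n) := S.F_findim n
  let b := Module.finBasis K (S.F n)
  refine ((Set.finite_iUnion fun i => S.finite_proj (b i)).image (S.resDual n)).subset ?_
  rintro α ⟨-, hα, -⟩
  obtain ⟨x, hx, hx0⟩ := Submodule.exists_mem_ne_zero_of_ne_bot hα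
  obtain ⟨δ, hδ⟩ := exists_proj_ne_zero (S := S) hx0
  refine ⟨δ, ?_, (resDual_of_proj hx hδ).symm⟩
  by_contra h
  simp only [Set.mem_iUnion, Set.mem_ofPred_eq, not_exists, not_not] at h
  have h1 : S.proj δ ∘ₗ (S.F n).toSubmodule.subtype = 0 := b.ext h
  exact hδ (LinearMap.congr_fun h1 ⟨x, hx.1⟩)

namespace Triple

variable {β : Module.Dual K S.h} {e f : g} {H : S.h}

theorem mem_hn (T : S.Triple β e f H)
    {n : ℕ} (hen : e ∈ S.F n) (hfn : f ∈ S.F n) : (H : g) ∈ S.hn n :=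
  ⟨H.2, by rw [SetLike.mem_coe, ← T.ef]; exact (S.F n).lie_mem hen hfn⟩

theorem resDual_mem_posRootsN (T : S.Triple β e f H)
    {n : ℕ} (hβ : β ∈ S.pos) (hen : e ∈ S.F n) (hfn : f ∈ S.F n) :
    S.resDual n β ∈ S.posRootsN n := by
  have hH := T.mem_hn hen hfn
  have h0 : S.resDual n β ≠ 0 := fun h => by
    have := LinearMap.congr_fun h ⟨H, hH⟩
    exact two_ne_zero (T.two.symm.trans this)
  have he := mem_rootSpaceN T.he hen
  refine ⟨h0, fun h => ?_, ?_⟩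
  · rw [h] at he
    exact T.e_ne_zero ((Submodule.mem_bot K).1 he)
  · have her : e ∉ S.radN n := by
      intro her
      have h1 : (H : g) ∈ S.radN n := by
        rw [← neg_mem_iff, ← T.fe]
        exact S.lie_mem_radN hfn her
      have h2 := S.lie_eq_zero_of_mem_radN_of_mem_h h1 H.2 hen
      rw [← lie_skew, neg_eq_zero, T.he H, T.two] at h2
      exact T.e_ne_zero ((smul_eq_zero.1 h2).resolve_left two_ne_zero)
    intro x hx
    obtain ⟨c, rfl⟩ := (S.rootSpaceN_dichotomy h0 he her).1 x hx
    exact Submodule.smul_mem _ _ (W_le_b hβ T.he)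

theorem theta_mem_rootSpaceN_iff (T : S.Triple β e f H) {n : ℕ} {θ : S.F n ≃ₗ⁅K⁆ S.F n}
    (hen : e ∈ S.F n) (hfn : f ∈ S.F n)
    (h1 : ∀ (H' : S.h) (hH' : (H' : g) ∈ S.F n), (θ ⟨H', hH'⟩ : g) = (H' - β H' • H : S.h))
    (α : Module.Dual K (S.hn n)) (x : S.F n) :
    (θ x : g) ∈ S.rootSpaceN n (α - α ⟨H, T.mem_hn hen hfn⟩ • S.resDual n β) ↔
      (x : g) ∈ S.rootSpaceN n α := by
  have hHn := T.mem_hn hen hfn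
  have key : ∀ (H' : S.hn n) (c : K), ⁅(H' : g), (x : g)⁆ = c • (x : g) ↔
      ⁅(H' : g), (θ x : g)⁆ - S.resDual n β H' • ⁅(H : g), (θ x : g)⁆ = c • (θ x : g) := by
    intro H' c
    have h2 := θ.map_lie ⟨H', H'.2.2⟩ x
    have h3 : ((⁅θ ⟨H', H'.2.2⟩, θ x⁆ : S.F n) : g) =
        ⁅(H' : g), (θ x : g)⁆ - S.resDual n β H' • ⁅(H : g), (θ x : g)⁆ := by
      rw [LieSubalgebra.coe_bracket, h1 ⟨H', H'.2.1⟩ H'.2.2, ← smul_lie, ← sub_lie]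
      rfl
    rw [← h3, ← h2]
    constructor
    · intro h
      have : ⁅(⟨H', H'.2.2⟩ : S.F n), x⁆ = c • x := Subtype.ext h
      rw [this, map_smul]
      rfl
    · intro h
      have h4 : θ ⁅(⟨H', H'.2.2⟩ : S.F n), x⁆ = θ (c • x) := by
        rw [map_smul]
        exact Subtype.ext h
      exact congrArg (Subtype.val : S.F n → g) (θ.injective h4)
  have hβH : S.resDual n β ⟨H, hHn⟩ = 2 := T.two
  constructor
  · rintro ⟨-, hx⟩
    refine ⟨x.2, fun H' => (key H' _).2 ?_⟩
    rw [hx H', show ⁅(H : g), (θ x : g)⁆ = _ from hx ⟨H, hHn⟩]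
    simp only [LinearMap.sub_apply, LinearMap.smul_apply, smul_eq_mul, hβH, smul_smul, ← sub_smul]
    congr 1
    ring
  · rintro ⟨-, hx⟩
    refine ⟨(θ x).2, fun H' => ?_⟩
    have h2 := (key ⟨H, hHn⟩ _).1 (hx ⟨H, hHn⟩)
    have h3 := (key H' _).1 (hx H')
    rw [hβH] at h2
    have h4 : ⁅(H : g), (θ x : g)⁆ = -(α ⟨H, hHn⟩ • (θ x : g)) := by
      rw [← h2]
      module
    rw [h4] at h3
    rw [LinearMap.sub_apply, LinearMap.smul_apply, sub_smul, ← h3, smul_eq_mul, mul_smul]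
    module

theorem reflect_mem_posRootsN (T : S.Triple β e f H)
    {n : ℕ} (hD : S.IsDynkin) (hβ : S.IsSimpleRoot β)
    (hen : e ∈ S.F n) (hfn : f ∈ S.F n) {α : Module.Dual K (S.hn n)} (hα : α ∈ S.posRootsN n)
    (hne : α ≠ S.resDual n β) :
    α - α ⟨H, T.mem_hn hen hfn⟩ • S.resDual n β ∈ S.posRootsN n ∧
      α - α ⟨H, T.mem_hn hen hfn⟩ • S.resDual n β ≠ S.resDual n β := by
  have hHn := T.mem_hn hen hfn
  have hβH : S.resDual n β ⟨H, hHn⟩ = 2 := T.two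
  obtain ⟨hα0, hα1, hα2⟩ := hα
  have heq : ∀ c : K, α - α ⟨H, hHn⟩ • S.resDual n β = c • S.resDual n β →
      α = -c • S.resDual n β := by
    intro c h
    have h2 := LinearMap.congr_fun h ⟨H, hHn⟩
    simp only [LinearMap.sub_apply, LinearMap.smul_apply, smul_eq_mul, hβH] at h2
    rw [sub_eq_iff_eq_add, ← add_smul] at h
    rw [h]
    congr 1
    linear_combination -h2
  obtain ⟨θ, h1, h2, -, -⟩ := T.theta_spec hen hfn
  refine ⟨⟨fun h => hα0 ?_, ?_, ?_⟩, fun h => ?_⟩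
  · rw [heq 0 (by rw [h, zero_smul]), neg_zero, zero_smul]
  · obtain ⟨x, hx, hx0⟩ := Submodule.exists_mem_ne_zero_of_ne_bot hα1
    refine (Submodule.ne_bot_iff _).2 ⟨_, (T.theta_mem_rootSpaceN_iff hen hfn h1 α ⟨x, hx.1⟩).2 hx,
      fun h => hx0 (congrArg (Subtype.val : S.F n → g) (LieEquiv.eq_zero_of_apply θ h))⟩
  · intro y hy
    obtain ⟨x, hx⟩ := θ.surjective ⟨y, hy.1⟩
    have hxy : (θ x : g) = y := congrArg (Subtype.val : S.F n → g) hx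
    rw [← hxy] at hy ⊢
    have hxα := (T.theta_mem_rootSpaceN_iff hen hfn h1 α x).1 hy
    have hxb := mem_b_iff.1 (hα2 hxα)
    have hxN : (x : g) ∈ ⨆ γ : {γ // γ ∈ S.pos ∧ γ ≠ β}, S.W γ := by
      rw [← S.sum_proj (x : g)]
      refine sum_mem fun γ hγ => ?_
      have hγ0 : S.proj γ (x : g) ≠ 0 := by simpa using hγ
      have hγα := resDual_of_proj hxα hγ0
      rcases hxb γ hγ0 with rfl | hγp
      · exact absurd hγα hα0
      · exact Submodule.mem_iSup_of_mem ⟨γ, hγp, fun h => hne (by rw [hγα, h])⟩ (S.proj_mem _ _)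
    have h3 := h2 _ (T.simplePart_stable hD hβ).1 (T.simplePart_stable hD hβ).2 x hxN
    refine mem_b_iff.2 fun γ hγ => Or.inr ?_
    obtain ⟨⟨γ', hγ'⟩, rfl⟩ := exists_of_proj_ne_zero h3 hγ
    exact hγ'.1
  · have h3 := heq 1 (by rw [h, one_smul])
    have h4 : f ∈ S.rootSpaceN n α := by
      have := mem_rootSpaceN T.hf hfn
      rwa [show S.resDual n (-β) = α by
          rw [h3]
          exact LinearMap.ext fun x => by
            rw [LinearMap.smul_apply, smul_eq_mul, neg_one_mul]
            rfl] at this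
    rcases mem_b_iff.1 (hα2 h4) (-β) (by rw [S.proj_self T.hf]; exact T.f_ne_zero) with h5 | h5
    · exact T.ne_zero (neg_eq_zero.1 h5)
    · exact neg_notMem_pos hβ.1 h5

theorem rho_apply (T : S.Triple β e f H)
    (hD : S.IsDynkin) (hβ : S.IsSimpleRoot β) {ρ : Module.Dual K S.h}
    (hρ : S.IsGlobalRho ρ) : ρ H = 1 := by
  classical
  obtain ⟨n, hen, hfn, -⟩ := T.exists_level 0
  have hHn := T.mem_hn hen hfn
  have hβH : S.resDual n β ⟨H, hHn⟩ = 2 := T.two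
  have hfin := S.finite_posRootsN n
  have h1 : ρ H = S.rhoN n ⟨H, hHn⟩ := LinearMap.congr_fun (hρ n) ⟨H, hHn⟩
  have hβP := T.resDual_mem_posRootsN hβ.1 hen hfn
  rw [h1, rhoN, finsum_mem_eq_finite_toFinset_sum _ hfin, LinearMap.smul_apply,
    LinearMap.sum_apply, ← Finset.add_sum_erase _ _ (hfin.mem_toFinset.2 hβP), hβH,
    Finset.sum_involution (fun α _ => α - α ⟨H, hHn⟩ • S.resDual n β)]
  · simp
  · intro α _
    simp only [LinearMap.sub_apply, LinearMap.smul_apply, smul_eq_mul, hβH]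
    ring
  · intro α hα h h'
    rw [sub_eq_self] at h'
    exact (smul_eq_zero.1 h').elim h fun h => two_ne_zero (α := K) (by rw [← hβH, h]; rfl)
  · intro α hα
    simp only [Finset.mem_erase, Set.Finite.mem_toFinset] at hα ⊢
    exact (T.reflect_mem_posRootsN hD hβ hen hfn hα.2 hα.1).symm
  · intro α hα
    simp only [LinearMap.sub_apply, LinearMap.smul_apply, smul_eq_mul, hβH]
    module

end Triple

end Setup
end Paper

namespace Paper

namespace Setup

variable {K : Type} [Field K] [CharZero K] [IsAlgClosed K] {g : Type} [LieRing g] [LieAlgebra K g]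
variable {S : Setup K g}

/-- The subalgebra spanned by the weight spaces whose weights lie in an additive submonoid. -/
noncomputable def weightSubalgebra (S : Setup K g) (Q : AddSubmonoid (Module.Dual K S.h)) : LieSubalgebra K g where
  __ := ⨆ γ : Q, S.W γ
  lie_mem' := by
    intro x y hx hy
    refine Submodule.iSup_induction (fun γ : Q => S.W γ)
      (motive := fun x => ⁅x, y⁆ ∈ ⨆ γ : Q, S.W γ) hx (fun γ x hx => ?_)
      (by rw [zero_lie]; exact zero_mem _) (fun x x' h h' => by rw [add_lie]; exact add_mem h h')
    refine Submodule.iSup_induction (fun γ : Q => S.W γ)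
      (motive := fun y => ⁅x, y⁆ ∈ ⨆ γ : Q, S.W γ) hy (fun δ y hy => ?_)
      (by rw [lie_zero]; exact zero_mem _) (fun x x' h h' => by rw [lie_add]; exact add_mem h h')
    exact Submodule.mem_iSup_of_mem (γ + δ) (S.lie_mem_W hx hy)

theorem mem_weightSubalgebra {Q : AddSubmonoid (Module.Dual K S.h)} {x : g} :
    x ∈ S.weightSubalgebra Q ↔ x ∈ ⨆ γ : Q, S.W γ := Iff.rfl

theorem W_le_weightSubalgebra {Q : AddSubmonoid (Module.Dual K S.h)} {γ : Module.Dual K S.h}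
    (hγ : γ ∈ Q) {x : g} (hx : x ∈ S.W γ) : x ∈ S.weightSubalgebra Q :=
  mem_weightSubalgebra.2 (Submodule.mem_iSup_of_mem ⟨γ, hγ⟩ hx)

theorem mem_of_mem_weightSubalgebra {Q : AddSubmonoid (Module.Dual K S.h)} {γ : Module.Dual K S.h}
    {x : g} (hx : x ∈ S.W γ) (hx0 : x ≠ 0) (h : x ∈ S.weightSubalgebra Q) : γ ∈ Q := by
  obtain ⟨i, rfl⟩ := exists_of_proj_ne_zero (φ := fun γ : Q => γ.1) (mem_weightSubalgebra.1 h)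
    (γ := γ) (by rwa [S.proj_self hx])
  exact i.2

theorem exists_multiset (hD : S.IsDynkin) {α : Module.Dual K S.h} (hα : α ∈ S.pos) :
    ∃ s : Multiset (Module.Dual K S.h), (∀ β ∈ s, S.IsSimpleRoot β) ∧ s.sum = α := by
  obtain ⟨x, hx, hx0⟩ := IsRoot.exists_mem (S.pos_root α hα)
  refine AddSubmonoid.exists_multiset_of_mem_closure
    (s := {β | S.IsSimpleRoot β}) (mem_of_mem_weightSubalgebra hx hx0 ?_)
  refine IsDynkin.b_le hD (fun y hy => ?_) (fun β hβ y hy => ?_) (W_le_b hα hx)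
  · exact W_le_weightSubalgebra (zero_mem _) (S.mem_W_zero.2 hy)
  · exact W_le_weightSubalgebra (AddSubmonoid.subset_closure hβ) hy

theorem exists_apply_eq_one (hD : S.IsDynkin) (P : Finset (Module.Dual K S.h))
    (hP : ∀ β ∈ P, S.IsSimpleRoot β) : ∃ H : S.h, ∀ β ∈ P, β H = 1 := by
  classical
  have hT : ∀ γ : Module.Dual K S.h, ∃ t : g × g × S.h,
      IsRootOf K g S.h γ → S.Triple γ t.1 t.2.1 t.2.2 := by
    intro γ
    by_cases hγ : IsRootOf K g S.h γ
    · obtain ⟨e, f, H, T⟩ := IsRoot.exists_triple hD hγ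
      exact ⟨(e, f, H), fun _ => T⟩
    · exact ⟨(0, 0, 0), fun h => absurd h hγ⟩
  choose t ht using hT
  obtain ⟨n, hn⟩ := S.exists_mem_F (P.image (fun β => (t β).1) ∪ P.image (fun β => (t β).2.1))
  have hfin := (S.finite_weights n).subset (Set.inter_subset_left (t := S.pos))
  set Γ := hfin.toFinset with hΓ
  have hΓmem : ∀ γ, γ ∈ Γ ↔ (∃ x ∈ S.F n, x ∈ S.W γ ∧ x ≠ 0) ∧ γ ∈ S.pos := fun γ => by
    rw [hΓ, Set.Finite.mem_toFinset]; rfl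
  refine ⟨(2 : K)⁻¹ • ∑ γ ∈ Γ, (t γ).2.2, fun β hβ => ?_⟩
  have T := ht β (S.pos_root β (hP β hβ).1)
  have hen : (t β).1 ∈ S.F n :=
    hn _ (Finset.mem_union_left _ (Finset.mem_image_of_mem (fun β => (t β).1) hβ))
  have hfn : (t β).2.1 ∈ S.F n :=
    hn _ (Finset.mem_union_right _ (Finset.mem_image_of_mem (fun β => (t β).2.1) hβ))
  have hβΓ : β ∈ Γ := (hΓmem β).2 ⟨⟨_, hen, T.he, T.e_ne_zero⟩, (hP β hβ).1⟩
  obtain ⟨θ, -, -, h3, -⟩ := T.theta_spec hen hfn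
  have hrefl : ∀ γ ∈ Γ.erase β, (t (γ - γ (t β).2.2 • β)).2.2 =
      (t γ).2.2 - β (t γ).2.2 • (t β).2.2 := by
    intro γ hγ
    have hγ' := (hΓmem γ).1 (Finset.mem_of_mem_erase hγ)
    have T' := ht γ (S.pos_root γ hγ'.2)
    obtain ⟨e'', f'', T''⟩ := T.reflect T'
    exact (Triple.coroot_unique hD (ht _ T''.isRootOf) T'').symm
  rw [map_smul, map_sum, ← Finset.add_sum_erase _ _ hβΓ, T.two,
    Finset.sum_involution (fun γ _ => γ - γ (t β).2.2 • β)]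
  · simp
  · intro γ hγ
    rw [hrefl γ hγ, map_sub, map_smul, T.two, smul_eq_mul]
    ring
  · intro γ hγ h h'
    rw [sub_eq_self, smul_eq_zero] at h'
    rcases h' with h' | h'
    · have h4 := hrefl γ hγ
      rw [h', zero_smul, sub_zero, eq_comm, sub_eq_self, smul_eq_zero] at h4
      exact h4.elim h T.H_ne_zero
    · exact T.ne_zero h'
  · intro γ hγ
    rw [Finset.mem_erase, hΓmem] at hγ ⊢
    obtain ⟨hne, ⟨x, hxn, hx, hx0⟩, hγp⟩ := hγ
    have h5 := T.reflect_mem_pos hD (hP β hβ) hγp hne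
    exact ⟨h5.2, ⟨_, (θ ⟨x, hxn⟩).2, h3 _ _ hx,
      fun h => hx0 (congrArg (Subtype.val : S.F n → g) (LieEquiv.eq_zero_of_apply θ h))⟩, h5.1⟩
  · intro γ hγ
    simp only [LinearMap.sub_apply, LinearMap.smul_apply, smul_eq_mul, T.two]
    module

theorem sum_apply_eq_card {s : Multiset (Module.Dual K S.h)} {H : S.h} (h : ∀ β ∈ s, β H = 1) :
    s.sum H = Multiset.card s := by
  induction s using Multiset.induction with
  | empty => simp
  | cons β s ih =>
    rw [Multiset.sum_cons, LinearMap.add_apply, h β (Multiset.mem_cons_self β s),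
      ih fun γ hγ => h γ (Multiset.mem_cons_of_mem hγ), Multiset.card_cons]
    push_cast
    ring

open Classical in
/-- The height of a sum of simple roots. -/
noncomputable def ht (S : Setup K g) (γ : Module.Dual K S.h) : ℕ :=
  if h : ∃ s : Multiset (Module.Dual K S.h), (∀ β ∈ s, S.IsSimpleRoot β) ∧ s.sum = γ then
    Multiset.card h.choose else 0

theorem ht_sum (hD : S.IsDynkin) {s : Multiset (Module.Dual K S.h)}
    (hs : ∀ β ∈ s, S.IsSimpleRoot β) : S.ht s.sum = Multiset.card s := by
  classical
  have h : ∃ s' : Multiset (Module.Dual K S.h), (∀ β ∈ s', S.IsSimpleRoot β) ∧ s'.sum = s.sum :=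
    ⟨s, hs, rfl⟩
  rw [ht, dif_pos h]
  obtain ⟨h1, h2⟩ := h.choose_spec
  obtain ⟨H, hH⟩ := exists_apply_eq_one hD (h.choose + s).toFinset (fun β hβ => by
    rw [Multiset.mem_toFinset, Multiset.mem_add] at hβ
    exact hβ.elim (h1 β) (hs β))
  have h3 := sum_apply_eq_card (s := s) (H := H) fun β hβ => hH β (by simp [hβ])
  have h4 := sum_apply_eq_card (s := h.choose) (H := H) fun β hβ => hH β (by simp [hβ])
  rw [h2, h3] at h4
  exact_mod_cast h4.symm

theorem ht_pos (hD : S.IsDynkin) {α : Module.Dual K S.h} (hα : α ∈ S.pos) : 0 < S.ht α := by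
  obtain ⟨s, hs, rfl⟩ := exists_multiset hD hα
  rw [ht_sum hD hs, Multiset.card_pos]
  rintro rfl
  exact zero_notMem_pos hα

theorem exists_apply_eq_ht (hD : S.IsDynkin) (Φ : Finset (Module.Dual K S.h))
    (hΦ : ∀ γ ∈ Φ, γ ∈ S.pos) : ∃ H : S.h, ∀ γ ∈ Φ, γ H = S.ht γ := by
  classical
  choose! s hs using fun γ (hγ : γ ∈ S.pos) => exists_multiset hD hγ
  obtain ⟨H, hH⟩ := exists_apply_eq_one hD (Φ.biUnion fun γ => (s γ).toFinset) (fun β hβ => by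
    obtain ⟨γ, hγ, hβ⟩ := Finset.mem_biUnion.1 hβ
    exact (hs γ (hΦ γ hγ)).1 β (Multiset.mem_toFinset.1 hβ))
  refine ⟨H, fun γ hγ => ?_⟩
  have h1 := sum_apply_eq_card (s := s γ) (H := H) fun β hβ =>
    hH β (Finset.mem_biUnion.2 ⟨γ, hγ, Multiset.mem_toFinset.2 hβ⟩)
  have h2 := hs γ (hΦ γ hγ)
  rw [← ht_sum hD h2.1, h2.2] at h1
  exact h1

end Setup
end Paper

namespace Paper

namespace Setup

variable {K : Type} [Field K] [CharZero K] [IsAlgClosed K] {g : Type} [LieRing g] [LieAlgebra K g]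
variable {S : Setup K g}

theorem Triple.exists_stable {β γ : Module.Dual K S.h} {e f e' f' : g} {H H' : S.h}
    (T : S.Triple β e f H) (T' : S.Triple γ e' f' H') :
    ∃ Φ : Set (Module.Dual K S.h), Φ.Finite ∧ β ∈ Φ ∧ γ ∈ Φ ∧ (∀ δ ∈ Φ, -δ ∈ Φ) ∧
      (∀ δ ∈ Φ, δ - δ H • β ∈ Φ) ∧ ∀ δ ∈ Φ, δ - δ H' • γ ∈ Φ := by
  classical
  obtain ⟨n, hn⟩ := S.exists_mem_F {e, f, e', f'}
  have hen := hn e (by simp)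
  have he'n := hn e' (by simp)
  obtain ⟨θ, -, -, h3, -⟩ := T.theta_spec hen (hn f (by simp))
  obtain ⟨θ', -, -, h3', -⟩ := T'.theta_spec he'n (hn f' (by simp))
  set P := {δ | ∃ x ∈ S.F n, x ∈ S.W δ ∧ x ≠ 0} with hP
  have hs : ∀ δ ∈ P, δ - δ H • β ∈ P := by
    rintro δ ⟨x, hxn, hx, hx0⟩
    exact ⟨_, (θ ⟨x, hxn⟩).2, h3 _ _ hx,
      fun h => hx0 (congrArg (Subtype.val : S.F n → g) (LieEquiv.eq_zero_of_apply θ h))⟩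
  have hs' : ∀ δ ∈ P, δ - δ H' • γ ∈ P := by
    rintro δ ⟨x, hxn, hx, hx0⟩
    exact ⟨_, (θ' ⟨x, hxn⟩).2, h3' _ _ hx,
      fun h => hx0 (congrArg (Subtype.val : S.F n → g) (LieEquiv.eq_zero_of_apply θ' h))⟩
  have hneg : ∀ (δ β : Module.Dual K S.h) (H : S.h), -(δ - δ H • β) = -δ - (-δ) H • β := by
    intro δ β H
    rw [LinearMap.neg_apply]
    module
  refine ⟨P ∪ Neg.neg ⁻¹' P, (S.finite_weights n).union
    ((S.finite_weights n).preimage neg_injective.injOn), Or.inl ⟨e, hen, T.he, T.e_ne_zero⟩,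
    Or.inl ⟨e', he'n, T'.he, T'.e_ne_zero⟩, ?_, ?_, ?_⟩
  · rintro δ (h | h)
    · exact Or.inr (by rwa [Set.mem_preimage, neg_neg])
    · exact Or.inl h
  · rintro δ (h | h)
    · exact Or.inl (hs δ h)
    · refine Or.inr ?_
      rw [Set.mem_preimage, hneg]
      exact hs _ h
  · rintro δ (h | h)
    · exact Or.inl (hs' δ h)
    · refine Or.inr ?_
      rw [Set.mem_preimage, hneg]
      exact hs' _ h

theorem Triple.exists_nat_of_pos {β γ : Module.Dual K S.h} {e f e' f' : g} {H H' : S.h}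
    (hD : S.IsDynkin) (hβ : β ∈ S.pos) (hγ : γ ∈ S.pos)
    (T : S.Triple β e f H) (T' : S.Triple γ e' f' H') {a : ℤ} (ha : 0 < a) (haH : β H' = a) :
    ∃ c : ℕ, 0 < c ∧ γ H = c := by
  classical
  obtain ⟨c, hc⟩ := T.exists_int T'.he T'.e_ne_zero
  by_contra! hcon
  have hc0 : c ≤ 0 := by
    by_contra! h
    lift c to ℕ using h.le
    exact hcon c (by exact_mod_cast h) (by exact_mod_cast hc)
  obtain ⟨Φ, hfin, hβΦ, -, hn, hs, hs'⟩ := T.exists_stable T'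
  obtain ⟨X, hX⟩ := exists_apply_eq_ht hD {β, γ} (by simp [hβ, hγ])
  have hXβ := hX β (by simp)
  have hXγ := hX γ (by simp)
  have hhβ := ht_pos hD hβ
  have hhγ := ht_pos hD hγ
  have key : ∀ k : ℕ, ∃ p q : ℤ, 1 ≤ p ∧ (k : ℤ) ≤ q ∧ (p : K) • β + (q : K) • γ ∈ Φ := by
    intro k
    induction k with
    | zero => exact ⟨1, 0, le_rfl, le_rfl, by simpa using hβΦ⟩
    | succ k ih =>
      obtain ⟨p, q, hp, hq, hpq⟩ := ih
      refine ⟨p - c * (p * a + q), p * a + q, ?_, ?_, ?_⟩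
      · nlinarith [mul_pos (by omega : 0 < p) ha]
      · push_cast
        nlinarith
      · have h1 := hn _ (hs _ (hs' _ hpq))
        convert h1 using 1
        simp only [LinearMap.sub_apply, LinearMap.add_apply, LinearMap.smul_apply, smul_eq_mul,
          T.two, T'.two, hc, haH]
        push_cast
        module
  choose p q hp hq hpq using key
  have hinf : ∀ N : ℤ, ∃ δ ∈ Φ, ∃ m : ℤ, N ≤ m ∧ δ X = m := by
    intro N
    refine ⟨_, hpq N.toNat, p N.toNat * S.ht β + q N.toNat * S.ht γ, ?_, ?_⟩
    · have := hp N.toNat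
      have := hq N.toNat
      have h1 : N ≤ N.toNat := Int.self_le_toNat N
      nlinarith [mul_pos (by omega : 0 < p N.toNat) (by omega : (0 : ℤ) < S.ht β)]
    · simp only [LinearMap.add_apply, LinearMap.smul_apply, smul_eq_mul, hXβ, hXγ]
      push_cast
      ring
  have hfin2 : {m : ℤ | ∃ δ ∈ Φ, δ X = m}.Finite := by
    refine Set.Finite.preimage (f := fun m : ℤ => (m : K)) Int.cast_injective.injOn
      ((hfin.image fun δ => δ X)) |>.subset ?_
    rintro m ⟨δ, hδ, h⟩
    exact ⟨δ, hδ, h⟩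
  obtain ⟨N, hN⟩ := hfin2.bddAbove
  obtain ⟨δ, hδ, m, hm, h⟩ := hinf (N + 1)
  have : m ≤ N := hN ⟨δ, hδ, h⟩
  omega

theorem exists_simple_pos (hD : S.IsDynkin) {α : Module.Dual K S.h} {e f : g} {H : S.h}
    (hα : α ∈ S.pos) (T : S.Triple α e f H) :
    ∃ β, S.IsSimpleRoot β ∧ ∃ a : ℤ, 0 < a ∧ β H = a := by
  obtain ⟨s, hs, hsum⟩ := exists_multiset hD hα
  have hcoef : ∀ β, S.IsSimpleRoot β → ∃ a : ℤ, β H = a := fun β hβ => by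
    obtain ⟨x, hx, hx0⟩ := IsRoot.exists_mem (S.pos_root β hβ.1)
    exact T.exists_int hx hx0
  by_contra! hcon
  have key : ∀ s : Multiset (Module.Dual K S.h), (∀ β ∈ s, S.IsSimpleRoot β) →
      ∃ a : ℤ, a ≤ 0 ∧ s.sum H = a := by
    intro s
    induction s using Multiset.induction with
    | empty => exact fun _ => ⟨0, le_rfl, by simp⟩
    | cons β s ih =>
      intro hs
      obtain ⟨a, ha, h1⟩ := ih fun γ hγ => hs γ (Multiset.mem_cons_of_mem hγ)
      have hβ := hs β (Multiset.mem_cons_self β s)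
      obtain ⟨c, hc⟩ := hcoef β hβ
      have hc0 : c ≤ 0 := by
        by_contra! h
        exact hcon β hβ c h hc
      exact ⟨c + a, by omega, by rw [Multiset.sum_cons, LinearMap.add_apply, hc, h1]; push_cast; rfl⟩
  obtain ⟨a, ha, h1⟩ := key s hs
  rw [hsum, T.two] at h1
  have : (2 : ℤ) = a := by exact_mod_cast h1
  omega

theorem coroot_independent {α β : Module.Dual K S.h} {e f e' f' : g} {H H' : S.h}
    (hα : α ∈ S.pos) (T : S.Triple α e f H) (T' : S.Triple β e' f' H')
    (hγ : α - α H' • β ∈ S.pos) (c : K) : H' ≠ c • H := by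
  rintro rfl
  have h1 : α (c • H) = 2 * c := by rw [map_smul, T.two, smul_eq_mul]; ring
  have h2 : c * β H = 2 := by rw [← T'.two, map_smul, smul_eq_mul]
  have hc : c ≠ 0 := by rintro rfl; simp at h2
  have hη : α - c • β = 0 := by
    by_contra hη
    obtain ⟨Φ, hfin, -, hβΦ, -, hs, hs'⟩ := T.exists_stable T'
    have key : ∀ k : ℕ, β + ((k : K) * β H) • (α - c • β) ∈ Φ := by
      intro k
      induction k with
      | zero => simpa using hβΦ
      | succ k ih =>
        have h3 := hs _ (hs' _ ih)
        convert h3 using 1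
        simp only [LinearMap.sub_apply, LinearMap.add_apply, LinearMap.smul_apply, smul_eq_mul,
          T.two, map_smul, h2]
        have h4 : β H = 2 / c := by field_simp; linear_combination h2
        rw [h4]
        match_scalars <;> field_simp <;> ring
    refine Set.infinite_of_injective_forall_mem (fun k l hkl => ?_) key hfin
    have hb : β H ≠ 0 := fun h => by rw [h, mul_zero] at h2; exact two_ne_zero h2.symm
    have h5 := mul_right_cancel₀ hb (smul_left_injective K hη (add_left_cancel hkl))
    exact_mod_cast h5
  have h6 := neg_notMem_pos hα
  apply h6
  rw [h1] at hγ
  convert hγ using 1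
  rw [sub_eq_zero] at hη
  rw [mul_smul, ← hη]
  module

/-- A non-simple positive root can be reflected in a simple root so as to become lower. -/
theorem exists_reduction (hD : S.IsDynkin) {α : Module.Dual K S.h} {e f : g} {H : S.h}
    (hα : α ∈ S.pos) (hns : ¬S.IsSimpleRoot α) (T : S.Triple α e f H) :
    ∃ (β : Module.Dual K S.h) (e' f' : g) (H' : S.h) (r : ℕ), S.IsSimpleRoot β ∧
      S.Triple β e' f' H' ∧ 0 < r ∧ α H' = r ∧ α - (r : K) • β ∈ S.pos ∧
      S.ht (α - (r : K) • β) < S.ht α ∧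
      (∃ e'' f'', S.Triple (α - (r : K) • β) e'' f'' (H - β H • H')) ∧
      ∀ c : K, H' ≠ c • H := by
  classical
  obtain ⟨β, hβ, a, ha, haH⟩ := exists_simple_pos hD hα T
  obtain ⟨e', f', H', T'⟩ := IsRoot.exists_triple hD (S.pos_root β hβ.1)
  obtain ⟨r, hr, hrH⟩ := T'.exists_nat_of_pos hD hβ.1 hα T ha haH
  have hne : α ≠ β := by rintro rfl; exact hns hβ
  have hγ := (T'.reflect_mem_pos hD hβ hα hne).1
  have hind := coroot_independent hα T T' hγ
  have hT := T'.reflect T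
  rw [hrH] at hγ hT
  refine ⟨β, e', f', H', r, hβ, T', hr, hrH, hγ, ?_, hT, hind⟩
  obtain ⟨X, hX⟩ := exists_apply_eq_ht hD {β, α, α - (r : K) • β} (by simp [hα, hβ.1, hγ])
  have h1 := hX _ (by simp : α - (r : K) • β ∈ _)
  rw [LinearMap.sub_apply, LinearMap.smul_apply, hX α (by simp), hX β (by simp), smul_eq_mul,
    sub_eq_iff_eq_add] at h1
  have h2 : S.ht α = S.ht (α - (r : K) • β) + r * S.ht β := by exact_mod_cast h1
  have := mul_pos hr (ht_pos hD hβ.1)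
  omega

end Setup
end Paper

namespace Paper

namespace Setup

variable {K : Type} [Field K] [CharZero K] [IsAlgClosed K] {g : Type} [LieRing g] [LieAlgebra K g]
variable {S : Setup K g}

theorem exists_finset_int {x : Module.Dual K S.h}
    (hx : x ∈ AddSubgroup.closure {δ | IsRootOf K g S.h δ}) :
    ∃ Φ : Finset (Module.Dual K S.h), (∀ γ ∈ Φ, γ ∈ S.pos) ∧
      ∀ H : S.h, (∀ γ ∈ Φ, ∃ n : ℤ, γ H = n) → ∃ n : ℤ, x H = n := by
  classical
  induction hx using AddSubgroup.closure_induction with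
  | mem δ hδ =>
    by_cases h : δ ∈ S.pos
    · exact ⟨{δ}, by simpa using h, fun H hH => hH δ (by simp)⟩
    · refine ⟨{-δ}, by simpa using IsRoot.neg_mem_pos hδ h, fun H hH => ?_⟩
      obtain ⟨n, hn⟩ := hH (-δ) (by simp)
      exact ⟨-n, by rw [Int.cast_neg, ← hn, LinearMap.neg_apply, neg_neg]⟩
  | zero => exact ⟨∅, by simp, fun H _ => ⟨0, by simp⟩⟩
  | add x y _ _ hx hy =>
    obtain ⟨Φ, h1, h2⟩ := hx
    obtain ⟨Ψ, h3, h4⟩ := hy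
    refine ⟨Φ ∪ Ψ, fun γ hγ => (Finset.mem_union.1 hγ).elim (h1 γ) (h3 γ), fun H hH => ?_⟩
    obtain ⟨n, hn⟩ := h2 H fun γ hγ => hH γ (Finset.mem_union_left _ hγ)
    obtain ⟨m, hm⟩ := h4 H fun γ hγ => hH γ (Finset.mem_union_right _ hγ)
    exact ⟨n + m, by rw [LinearMap.add_apply, hn, hm]; push_cast; rfl⟩
  | neg x _ hx =>
    obtain ⟨Φ, h1, h2⟩ := hx
    refine ⟨Φ, h1, fun H hH => ?_⟩
    obtain ⟨n, hn⟩ := h2 H hH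
    exact ⟨-n, by rw [LinearMap.neg_apply, hn]; push_cast; rfl⟩

theorem Triple.exists_int_of_mem_closure {β : Module.Dual K S.h} {e f : g} {H : S.h}
    (T : S.Triple β e f H) {x : Module.Dual K S.h}
    (hx : x ∈ AddSubgroup.closure {δ | IsRootOf K g S.h δ}) : ∃ n : ℤ, x H = n := by
  obtain ⟨Φ, h1, h2⟩ := exists_finset_int hx
  refine h2 H fun γ hγ => ?_
  obtain ⟨y, hy, hy0⟩ := IsRoot.exists_mem (S.pos_root γ (h1 γ hγ))
  exact T.exists_int hy hy0

theorem exists_int_of_smul_mem_closure (hD : S.IsDynkin) {c : K} (n : ℕ) :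
    ∀ α ∈ S.pos, S.ht α = n → c • α ∈ AddSubgroup.closure {δ | IsRootOf K g S.h δ} →
      ∃ m : ℤ, c = m := by
  classical
  induction n using Nat.strong_induction_on with
  | _ n ih =>
  intro α hα hn hc
  obtain ⟨e, f, H, T⟩ := IsRoot.exists_triple hD (S.pos_root α hα)
  by_cases hs : S.IsSimpleRoot α
  · obtain ⟨Φ, h1, h2⟩ := exists_finset_int hc
    obtain ⟨X, hX⟩ := exists_apply_eq_ht hD (insert α Φ) (by simpa [hα] using h1)
    obtain ⟨m, hm⟩ := h2 X fun γ hγ => ⟨S.ht γ, by rw [hX γ (by simp [hγ])]; simp⟩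
    have h3 : S.ht α = 1 := by
      have := ht_sum hD (s := {α}) (by simpa using hs)
      simpa using this
    rw [LinearMap.smul_apply, hX α (by simp), h3] at hm
    exact ⟨m, by simpa using hm⟩
  · obtain ⟨β, e', f', H', r, hβ, T', hr, hrH, hγ, hlt, -, -⟩ := exists_reduction hD hα hs T
    refine ih _ (hn ▸ hlt) _ hγ rfl ?_
    obtain ⟨m, hm⟩ := T'.exists_int_of_mem_closure hc
    have h1 : c • (α - (r : K) • β) = c • α - m • β := by
      rw [LinearMap.smul_apply, hrH, smul_eq_mul] at hm
      rw [← Int.cast_smul_eq_zsmul K, ← hm]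
      module
    rw [h1]
    have hr : β ∈ {δ | IsRootOf K g S.h δ} := S.pos_root β hβ.1
    exact sub_mem hc (zsmul_mem (AddSubgroup.subset_closure hr) m)

/-- If `c • α` is a sum of positive roots, then `c` is a natural number. -/
theorem exists_nat_of_smul_eq_sum (hD : S.IsDynkin) {α : Module.Dual K S.h} (hα : α ∈ S.pos) {c : K}
    {s : Multiset (Module.Dual K S.h)} (hs : ∀ β ∈ s, β ∈ S.pos) (hc : c • α = s.sum) :
    ∃ k : ℕ, c = k := by
  classical
  have h1 : c • α ∈ AddSubgroup.closure {δ | IsRootOf K g S.h δ} := by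
    rw [hc]
    refine multiset_sum_mem _ fun β hβ => ?_
    have hr : β ∈ {δ | IsRootOf K g S.h δ} := S.pos_root β (hs β hβ)
    exact AddSubgroup.subset_closure hr
  obtain ⟨m, rfl⟩ := exists_int_of_smul_mem_closure hD _ α hα rfl h1
  obtain ⟨X, hX⟩ := exists_apply_eq_ht hD (insert α s.toFinset) (by simpa [hα] using hs)
  have h2 : ∀ s : Multiset (Module.Dual K S.h), (∀ β ∈ s, β X = S.ht β) →
      s.sum X = ((s.map S.ht).sum : ℕ) := by
    intro s
    induction s using Multiset.induction with
    | empty => simp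
    | cons β s ih =>
      intro h
      rw [Multiset.sum_cons, LinearMap.add_apply, h β (Multiset.mem_cons_self β s),
        ih fun γ hγ => h γ (Multiset.mem_cons_of_mem hγ), Multiset.map_cons, Multiset.sum_cons]
      push_cast
      rfl
  have h3 := h2 s fun β hβ => hX β (by simp [hβ])
  rw [← hc, LinearMap.smul_apply, hX α (by simp), smul_eq_mul] at h3
  generalize (s.map S.ht).sum = N at h3
  have h4 : m * (S.ht α : ℤ) = N := by exact_mod_cast h3
  have h5 : 0 ≤ m := by
    by_contra! h
    have := ht_pos hD hα
    nlinarith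
  lift m to ℕ using h5
  exact ⟨m, by simp⟩

end Setup
end Paper

namespace Paper

open MvPolynomial

namespace Straightening

variable {K L I J : Type} [Field K] [LieRing L] [LieAlgebra K L] [LinearOrder I]

/-- The span of the monomials of degree less than `n`. -/
noncomputable def degLT (K I : Type) [Field K] (n : ℕ) : Submodule K (MvPolynomial I K) :=
  Submodule.span K {p | ∃ M : I →₀ ℕ, M.degree < n ∧ p = monomial M 1}

theorem monomial_mem_degLT {M : I →₀ ℕ} {n : ℕ} (h : M.degree < n) :
    (monomial M 1 : MvPolynomial I K) ∈ degLT K I n := Submodule.subset_span ⟨M, h, rfl⟩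

theorem degLT_mono {m n : ℕ} (h : m ≤ n) : degLT K I m ≤ degLT K I n :=
  Submodule.span_mono fun _ ⟨M, hM, hp⟩ => ⟨M, hM.trans_le h, hp⟩

theorem map_mem_of_degLT {V : Type} [AddCommGroup V] [Module K V] (A : MvPolynomial I K →ₗ[K] V)
    (N : Submodule K V) {n : ℕ} (h : ∀ M : I →₀ ℕ, M.degree < n → A (monomial M 1) ∈ N)
    {p : MvPolynomial I K} (hp : p ∈ degLT K I n) : A p ∈ N := by
  have : degLT K I n ≤ N.comap A := Submodule.span_le.2 (by
    rintro _ ⟨M, hM, rfl⟩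
    exact h M hM)
  exact this hp

theorem exists_mem_degLT (p : MvPolynomial I K) : ∃ n, p ∈ degLT K I n := by
  induction p using MvPolynomial.induction_on' with
  | monomial M c =>
    refine ⟨M.degree + 1, ?_⟩
    rw [← mul_one c, ← smul_eq_mul, ← smul_monomial]
    exact Submodule.smul_mem _ _ (monomial_mem_degLT (Nat.lt_succ_self _))
  | add p q hp hq =>
    obtain ⟨n, hn⟩ := hp
    obtain ⟨m, hm⟩ := hq
    exact ⟨max n m, add_mem (degLT_mono (le_max_left _ _) hn) (degLT_mono (le_max_right _ _) hm)⟩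

/-- All variables occurring in the monomial `M` are at least `j`. -/
def IsLE (j : I) (M : I →₀ ℕ) : Prop := ∀ a ∈ M.support, j ≤ a

theorem IsLE.single_add {j i : I} {M : I →₀ ℕ} (h : IsLE j M) (hji : j ≤ i) :
    IsLE j (Finsupp.single i 1 + M) := by
  classical
  intro a ha
  rcases Finset.mem_union.1 (Finsupp.support_add ha) with h1 | h1
  · rw [Finset.mem_singleton.1 (Finsupp.support_single_subset h1)]; exact hji
  · exact h a h1

theorem IsLE.le_of_single_add {j i : I} {M : I →₀ ℕ} (h : IsLE j (Finsupp.single i 1 + M)) : j ≤ i :=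
  h i (by simp)

theorem exists_eq_single_add {M : I →₀ ℕ} (hM : M ≠ 0) :
    ∃ jN : I × (I →₀ ℕ), M = Finsupp.single jN.1 1 + jN.2 ∧ IsLE jN.1 jN.2 := by
  classical
  have h : M.support.Nonempty := Finsupp.support_nonempty_iff.2 hM
  have h1 : Finsupp.single (M.support.min' h) 1 ≤ M := by
    rw [Finsupp.single_le_iff]
    exact Nat.one_le_iff_ne_zero.2 (Finsupp.mem_support_iff.1 (M.support.min'_mem h))
  refine ⟨(M.support.min' h, M - Finsupp.single (M.support.min' h) 1),
    (add_tsub_cancel_of_le h1).symm, fun a ha => M.support.min'_le a ?_⟩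
  rw [Finsupp.mem_support_iff] at ha ⊢
  rw [Finsupp.tsub_apply] at ha
  omega

theorem single_add_inj {j j' : I} {N N' : I →₀ ℕ} (hN : IsLE j N) (hN' : IsLE j' N')
    (h : Finsupp.single j 1 + N = Finsupp.single j' 1 + N') : j = j' ∧ N = N' := by
  have h1 : j = j' := le_antisymm
    ((h ▸ hN.single_add le_rfl : IsLE j (Finsupp.single j' 1 + N')).le_of_single_add)
    ((h ▸ hN'.single_add le_rfl : IsLE j' (Finsupp.single j 1 + N)).le_of_single_add)
  subst h1
  exact ⟨rfl, add_left_cancel h⟩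

/-- The leading term of the action of a basis vector on a monomial. -/
noncomputable def lead (K : Type) [Field K] : I ⊕ J → (I →₀ ℕ) → MvPolynomial I K
  | Sum.inl i, M => monomial (Finsupp.single i 1 + M) 1
  | Sum.inr _, _ => 0

/-- `j` precedes the basis index `k`; indices in `J` come after all those in `I`. -/
def Prec (j : I) (k : I ⊕ J) : Prop := ∀ i, k = Sum.inl i → j < i

theorem lead_mem (k : I ⊕ J) (M : I →₀ ℕ) : lead K k M ∈ degLT K I (M.degree + 2) := by
  cases k with
  | inl i => exact monomial_mem_degLT (by simp [map_add, Finsupp.degree_single]; omega)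
  | inr k => exact zero_mem _

variable (bas : Module.Basis (I ⊕ J) K L)

/-- Bilinear extension of an action of basis vectors on monomials. -/
noncomputable def ext (f : I ⊕ J → (I →₀ ℕ) → MvPolynomial I K) :
    L →ₗ[K] MvPolynomial I K →ₗ[K] MvPolynomial I K :=
  bas.constr K fun k => (basisMonomials I K).constr K (f k)

theorem ext_apply (f : I ⊕ J → (I →₀ ℕ) → MvPolynomial I K) (k : I ⊕ J) (M : I →₀ ℕ) :
    ext bas f (bas k) (monomial M 1) = f k M := by
  rw [ext, Module.Basis.constr_basis]
  have := (basisMonomials I K).constr_basis K (f k) M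
  rwa [coe_basisMonomials] at this

variable (χ : J → K)

open Classical in
/-- The action by straightening, computed on monomials of degree at most `n`. -/
noncomputable def actN : ℕ → I ⊕ J → (I →₀ ℕ) → MvPolynomial I K
  | 0, k, M => Sum.elim (fun i => monomial (Finsupp.single i 1 + M) 1) (fun k => χ k • monomial M 1) k
  | n + 1, k, M =>
    if M.degree ≤ n then actN n k M else
    if ∃ i, k = Sum.inl i ∧ IsLE i M then lead K k M else
    if h : ∃ jN : I × (I →₀ ℕ), M = Finsupp.single jN.1 1 + jN.2 ∧ IsLE jN.1 jN.2 then
      lead K k M +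
        ext bas (actN n) (bas (Sum.inl h.choose.1)) (actN n k h.choose.2 - lead K k h.choose.2) +
        ext bas (actN n) ⁅bas k, bas (Sum.inl h.choose.1)⁆ (monomial h.choose.2 1)
    else 0

/-- The action by straightening on polynomials in the variables `I`. -/
noncomputable def act : L →ₗ[K] MvPolynomial I K →ₗ[K] MvPolynomial I K :=
  ext bas fun k M => actN bas χ M.degree k M

theorem actN_of_le {n : ℕ} (k : I ⊕ J) {M : I →₀ ℕ} (h : M.degree ≤ n) :
    actN bas χ n k M = actN bas χ M.degree k M := by
  induction n with
  | zero => rw [Nat.le_zero.1 h]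
  | succ n ih =>
    rcases Nat.lt_or_ge n M.degree with h1 | h1
    · rw [le_antisymm h h1]
    · rw [actN, if_pos h1, ih h1]

theorem ext_actN {n : ℕ} (x : L) {p : MvPolynomial I K} (hp : p ∈ degLT K I (n + 1)) :
    ext bas (actN bas χ n) x p = act bas χ x p := by
  have h1 : ∀ M : I →₀ ℕ, M.degree < n + 1 →
      (ext bas (actN bas χ n)).flip (monomial M 1) = (act bas χ).flip (monomial M 1) := by
    intro M hM
    refine bas.ext fun k => ?_
    rw [LinearMap.flip_apply, LinearMap.flip_apply, act, ext_apply, ext_apply,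
      actN_of_le bas χ k (Nat.lt_succ_iff.1 hM)]
  have h2 := map_mem_of_degLT (ext bas (actN bas χ n) x - act bas χ x) ⊥ (n := n + 1)
    (fun M hM => by
      rw [Submodule.mem_bot, LinearMap.sub_apply, sub_eq_zero]
      exact LinearMap.congr_fun (h1 M hM) x) hp
  rwa [Submodule.mem_bot, LinearMap.sub_apply, sub_eq_zero] at h2

theorem act_of_LE {i : I} {M : I →₀ ℕ} (h : IsLE i M) :
    act bas χ (bas (Sum.inl i)) (monomial M 1) = monomial (Finsupp.single i 1 + M) 1 := by
  rw [act, ext_apply]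
  rcases hn : M.degree with _ | n
  · rfl
  · rw [actN, if_neg (by omega), if_pos ⟨i, rfl, h⟩, lead]

theorem act_one (k : J) : act bas χ (bas (Sum.inr k)) 1 = χ k • 1 := by
  have h : (1 : MvPolynomial I K) = monomial 0 1 := rfl
  rw [h, act, ext_apply]
  rfl

theorem act_single_add_aux {j : I} {N : I →₀ ℕ} (hN : IsLE j N) {k : I ⊕ J} (hk : Prec j k)
    (h : act bas χ (bas k) (monomial N 1) - lead K k N ∈ degLT K I (N.degree + 1)) :
    act bas χ (bas k) (monomial (Finsupp.single j 1 + N) 1) =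
      lead K k (Finsupp.single j 1 + N) +
        act bas χ (bas (Sum.inl j)) (act bas χ (bas k) (monomial N 1) - lead K k N) +
        act bas χ ⁅bas k, bas (Sum.inl j)⁆ (monomial N 1) := by
  have hdeg : (Finsupp.single j 1 + N).degree = N.degree + 1 := by
    rw [map_add, Finsupp.degree_single, add_comm]
  have hex : ∃ jN : I × (I →₀ ℕ), Finsupp.single j 1 + N = Finsupp.single jN.1 1 + jN.2 ∧
      IsLE jN.1 jN.2 := ⟨(j, N), rfl, hN⟩
  have hlhs : act bas χ (bas k) (monomial (Finsupp.single j 1 + N) 1) =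
      actN bas χ (N.degree + 1) k (Finsupp.single j 1 + N) := by
    rw [act, ext_apply, hdeg]
  have hneg : ¬∃ i, k = Sum.inl i ∧ IsLE i (Finsupp.single j 1 + N) := by
    rintro ⟨i, hi, h1⟩
    exact absurd h1.le_of_single_add (not_le.2 (hk i hi))
  rw [hlhs, actN, if_neg (by omega), if_neg hneg, dif_pos hex]
  obtain ⟨h1, h2⟩ := single_add_inj hN hex.choose_spec.2 hex.choose_spec.1
  rw [← h1, ← h2]
  have h3 : actN bas χ N.degree k N = act bas χ (bas k) (monomial N 1) := by rw [act, ext_apply]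
  rw [h3, ext_actN bas χ _ h, ext_actN bas χ _ (monomial_mem_degLT (Nat.lt_succ_self _))]

theorem act_mem {n : ℕ} (h : ∀ (k : I ⊕ J) (M : I →₀ ℕ), M.degree < n →
      act bas χ (bas k) (monomial M 1) - lead K k M ∈ degLT K I (M.degree + 1))
    (x : L) {p : MvPolynomial I K} (hp : p ∈ degLT K I n) : act bas χ x p ∈ degLT K I (n + 1) := by
  refine map_mem_of_degLT (act bas χ x) _ (fun M hM => ?_) hp
  have h1 : ∀ x, (act bas χ).flip (monomial M 1) x ∈ degLT K I (n + 1) := by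
    intro x
    rw [← bas.linearCombination_repr x, Finsupp.linearCombination_apply, Finsupp.sum, map_sum]
    refine sum_mem fun k _ => ?_
    rw [map_smul]
    refine Submodule.smul_mem _ _ ?_
    have h2 := add_mem (degLT_mono (by omega) (h k M hM) : _ ∈ degLT K I (n + 1))
      (degLT_mono (by omega) (lead_mem k M))
    rwa [sub_add_cancel] at h2
  exact h1 x

theorem act_sub_lead_mem (k : I ⊕ J) (M : I →₀ ℕ) :
    act bas χ (bas k) (monomial M 1) - lead K k M ∈ degLT K I (M.degree + 1) := by
  induction hn : M.degree using Nat.strong_induction_on generalizing k M with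
  | _ n ih =>
  by_cases hM : M = 0
  · cases k with
    | inl i =>
      rw [act_of_LE bas χ (by rw [hM]; intro a ha; simp at ha), lead, sub_self]
      exact zero_mem _
    | inr k =>
      subst hM
      rw [lead, sub_zero, show (monomial 0 1 : MvPolynomial I K) = 1 from rfl, act_one]
      exact Submodule.smul_mem _ _ (monomial_mem_degLT (by simp))
  · obtain ⟨⟨j, N⟩, rfl, hN⟩ := exists_eq_single_add hM
    dsimp only at *
    have hdeg : (Finsupp.single j 1 + N).degree = N.degree + 1 := by
      rw [map_add, Finsupp.degree_single, add_comm]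
    by_cases hk : Prec j k
    · rw [act_single_add_aux bas χ hN hk (ih _ (by omega) k N rfl), add_assoc, add_sub_cancel_left]
      have h1 : ∀ (k : I ⊕ J) (M : I →₀ ℕ), M.degree < N.degree + 1 →
          act bas χ (bas k) (monomial M 1) - lead K k M ∈ degLT K I (M.degree + 1) :=
        fun k M hM => ih _ (by omega) k M rfl
      have h2 := act_mem bas χ h1 (bas (Sum.inl j)) (h1 k N (by omega))
      have h3 := act_mem bas χ h1 ⁅bas k, bas (Sum.inl j)⁆ (monomial_mem_degLT (Nat.lt_succ_self _))
      rw [← hn, hdeg]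
      exact add_mem h2 h3
    · simp only [Prec, not_forall, not_lt] at hk
      obtain ⟨i, rfl, hij⟩ := hk
      have hLE : IsLE i (Finsupp.single j 1 + N) := by
        refine IsLE.single_add (fun a ha => hij.trans (hN a ha)) hij
      rw [act_of_LE bas χ hLE, lead, sub_self]
      exact zero_mem _

theorem act_single_add {j : I} {N : I →₀ ℕ} (hN : IsLE j N) {k : I ⊕ J} (hk : Prec j k) :
    act bas χ (bas k) (monomial (Finsupp.single j 1 + N) 1) =
      act bas χ (bas (Sum.inl j)) (act bas χ (bas k) (monomial N 1)) +
        act bas χ ⁅bas k, bas (Sum.inl j)⁆ (monomial N 1) := by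
  rw [act_single_add_aux bas χ hN hk (act_sub_lead_mem bas χ k N), map_sub]
  have h1 : act bas χ (bas (Sum.inl j)) (lead K k N) = lead K k (Finsupp.single j 1 + N) := by
    cases k with
    | inl i =>
      rw [lead, lead, act_of_LE bas χ (hN.single_add (hk i rfl).le), add_left_comm]
    | inr k => rw [lead, lead, map_zero]
  rw [h1]
  abel

end Straightening
end Paper

namespace Paper

open MvPolynomial

namespace Straightening

variable {K L I J : Type} [Field K] [LieRing L] [LieAlgebra K L] [LinearOrder I]
variable (bas : Module.Basis (I ⊕ J) K L) (χ : J → K)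

theorem basis_induction {κ : Type} (bas : Module.Basis κ K L) {p : L → Prop} (x : L) (h0 : p 0)
    (hadd : ∀ x y, p x → p y → p (x + y)) (hsmul : ∀ (c : K) x, p x → p (c • x))
    (hbas : ∀ k, p (bas k)) : p x := by
  have hx : x ∈ Submodule.span K (Set.range bas) := by rw [bas.span_eq]; trivial
  induction hx using Submodule.span_induction with
  | mem x hx => obtain ⟨k, rfl⟩ := hx; exact hbas k
  | zero => exact h0
  | add x y _ _ hx hy => exact hadd x y hx hy
  | smul c x _ hx => exact hsmul c x hx

theorem monomial_induction {p : (I →₀ ℕ) → Prop} (M : I →₀ ℕ)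
    (h0 : (∀ j : I, IsLE j 0) → p 0)
    (hadd : ∀ (j : I) (N : I →₀ ℕ), IsLE j N → (∀ M, M.degree < N.degree + 1 → p M) →
      p (Finsupp.single j 1 + N)) : p M := by
  induction hn : M.degree using Nat.strong_induction_on generalizing M with
  | _ n ih =>
  by_cases hM : M = 0
  · subst hM
    exact h0 fun j a ha => by simp at ha
  · obtain ⟨⟨j, N⟩, rfl, hN⟩ := exists_eq_single_add hM
    refine hadd j N hN fun M hM => ih _ ?_ M rfl
    rw [← hn, map_add, Finsupp.degree_single, add_comm]
    exact hM

theorem isLE_or_prec (k : I ⊕ J) {j : I} {N : I →₀ ℕ} (hN : IsLE j N) :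
    (∃ i, k = Sum.inl i ∧ IsLE i (Finsupp.single j 1 + N)) ∨ Prec j k := by
  by_cases hk : Prec j k
  · exact Or.inr hk
  · simp only [Prec, not_forall, not_lt] at hk
    obtain ⟨i, rfl, hij⟩ := hk
    exact Or.inl ⟨i, rfl, IsLE.single_add (fun a ha => hij.trans (hN a ha)) hij⟩

theorem map_act_eq_zero {V : Type} [AddCommGroup V] [Module K V] (A : MvPolynomial I K →ₗ[K] V)
    {j : I} {N : I →₀ ℕ} (hN : IsLE j N) {k : I ⊕ J} (hk : Prec j k)
    (h1 : ∀ M : I →₀ ℕ, M.degree < N.degree + 1 → A (monomial M 1) = 0)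
    (h2 : ∀ M : I →₀ ℕ, IsLE j M → A (monomial M 1) = 0) :
    A (act bas χ (bas k) (monomial N 1)) = 0 := by
  have h3 := map_mem_of_degLT A ⊥ (fun M hM => (Submodule.mem_bot K).2 (h1 M hM))
    (act_sub_lead_mem bas χ k N)
  rw [Submodule.mem_bot, map_sub] at h3
  rw [← sub_add_cancel (A (act bas χ (bas k) (monomial N 1))) (A (lead K k N)), h3, zero_add]
  cases k with
  | inl i => exact h2 _ (hN.single_add (hk i rfl).le)
  | inr k => exact map_zero A

/-- The defect of `act` being a Lie algebra action. -/
noncomputable def defect (x y : L) : MvPolynomial I K →ₗ[K] MvPolynomial I K :=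
  act bas χ ⁅x, y⁆ - (act bas χ x ∘ₗ act bas χ y - act bas χ y ∘ₗ act bas χ x)

theorem defect_apply (x y : L) (p : MvPolynomial I K) : defect bas χ x y p =
    act bas χ ⁅x, y⁆ p - (act bas χ x (act bas χ y p) - act bas χ y (act bas χ x p)) := rfl

theorem defect_symm (x y : L) : defect bas χ x y = -defect bas χ y x := by
  rw [defect, defect, ← lie_skew, map_neg]
  abel

theorem defect_eq_zero_of_basis {p : MvPolynomial I K}
    (h : ∀ k l, defect bas χ (bas k) (bas l) p = 0) (x y : L) : defect bas χ x y p = 0 := by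
  refine basis_induction bas (p := fun x => defect bas χ x y p = 0) x ?_ ?_ ?_ fun k => ?_
  · simp [defect_apply]
  · intro x x' h h'
    rw [defect_apply] at *
    simp only [add_lie, map_add, LinearMap.add_apply]
    rw [← add_zero (0 : MvPolynomial I K)]
    nth_rewrite 1 [← h]
    rw [← h']
    abel
  · intro c x h
    rw [defect_apply] at *
    simp only [smul_lie, map_smul, LinearMap.smul_apply]
    rw [← smul_zero c, ← h, smul_sub, smul_sub]
  refine basis_induction bas (p := fun y => defect bas χ (bas k) y p = 0) y ?_ ?_ ?_ fun l => h k l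
  · simp [defect_apply]
  · intro x x' h h'
    rw [defect_apply] at *
    simp only [lie_add, map_add, LinearMap.add_apply]
    rw [← add_zero (0 : MvPolynomial I K)]
    nth_rewrite 1 [← h]
    rw [← h']
    abel
  · intro c x h
    rw [defect_apply] at *
    simp only [lie_smul, map_smul, LinearMap.smul_apply]
    rw [← smul_zero c, ← h, smul_sub, smul_sub]

theorem defect_of_isLE {i : I} {k : I ⊕ J} (h : Sum.inl i = k ∨ Prec i k) {M : I →₀ ℕ}
    (hM : IsLE i M) : defect bas χ (bas k) (bas (Sum.inl i)) (monomial M 1) = 0 := by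
  rcases h with rfl | h
  · simp [defect_apply]
  · rw [defect_apply, act_of_LE bas χ hM, act_single_add bas χ hM h]
    abel

theorem defect_eq_zero
    (hχ : ∀ k l : J, act bas χ ⁅bas (Sum.inr k), bas (Sum.inr l)⁆ 1 = 0) (x y : L)
    (p : MvPolynomial I K) : defect bas χ x y p = 0 := by
  have hLE : ∀ (M : I →₀ ℕ) (i : I) (l : I ⊕ J), IsLE i M → (∀ i', l = Sum.inl i' → IsLE i' M) →
      defect bas χ (bas (Sum.inl i)) (bas l) (monomial M 1) = 0 ∧
      defect bas χ (bas l) (bas (Sum.inl i)) (monomial M 1) = 0 := by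
    intro M i l hi hl
    have h1 : defect bas χ (bas l) (bas (Sum.inl i)) (monomial M 1) = 0 := by
      cases l with
      | inr l => exact defect_of_isLE bas χ (Or.inr fun i' h => by cases h) hi
      | inl l =>
        rcases lt_trichotomy i l with h | h | h
        · exact defect_of_isLE bas χ (Or.inr fun i' h' => by cases h'; exact h) hi
        · subst h; exact defect_of_isLE bas χ (Or.inl rfl) hi
        · rw [defect_symm, LinearMap.neg_apply,
            defect_of_isLE bas χ (Or.inr fun i' h' => by cases h'; exact h) (hl l rfl), neg_zero]
    exact ⟨by rw [defect_symm, LinearMap.neg_apply, h1, neg_zero], h1⟩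
  have key : ∀ (M : I →₀ ℕ) (x y : L), defect bas χ x y (monomial M 1) = 0 := by
    intro M
    refine monomial_induction (p := fun M => ∀ x y, defect bas χ x y (monomial M 1) = 0) M
      (fun h0 => ?_) fun j N hN ih => ?_
    · refine defect_eq_zero_of_basis bas χ fun k l => ?_
      rcases k with i | k
      · exact (hLE 0 i l (h0 i) fun i _ => h0 i).1
      rcases l with i | l
      · exact (hLE 0 i _ (h0 i) fun i _ => h0 i).2
      rw [show (monomial 0 1 : MvPolynomial I K) = 1 from rfl, defect_apply, hχ, act_one, act_one,
        map_smul, map_smul, act_one, act_one, smul_comm]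
      simp
    · have hdeg : N.degree < N.degree + 1 := Nat.lt_succ_self _
      refine defect_eq_zero_of_basis bas χ fun k l => ?_
      have hjM : IsLE j (Finsupp.single j 1 + N) := hN.single_add le_rfl
      have hprec : ∀ {k l : I ⊕ J}, Prec j k → Prec j l →
          act bas χ (bas k) (act bas χ (bas l) (monomial (Finsupp.single j 1 + N) 1)) =
          act bas χ (bas (Sum.inl j)) (act bas χ (bas k) (act bas χ (bas l) (monomial N 1))) +
          act bas χ ⁅bas k, bas (Sum.inl j)⁆ (act bas χ (bas l) (monomial N 1)) +
          act bas χ ⁅bas l, bas (Sum.inl j)⁆ (act bas χ (bas k) (monomial N 1)) +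
          act bas χ ⁅bas k, ⁅bas l, bas (Sum.inl j)⁆⁆ (monomial N 1) := by
        intro k l hk hl
        have h1 : defect bas χ (bas k) (bas (Sum.inl j)) (act bas χ (bas l) (monomial N 1)) = 0 :=
          map_act_eq_zero bas χ _ hN hl (fun M hM => ih M hM _ _)
            fun M hM => defect_of_isLE bas χ (Or.inr hk) hM
        have h2 := ih N hdeg (bas k) ⁅bas l, bas (Sum.inl j)⁆
        rw [defect_apply, sub_eq_zero] at h1 h2
        rw [act_single_add bas χ hN hl, map_add, h1, h2]
        abel
      have hmin : ∀ {k : I ⊕ J}, Prec j k →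
          ∀ {i : I}, IsLE i (Finsupp.single j 1 + N) → Prec i k :=
        fun hk i hi i' h => hi.le_of_single_add.trans_lt (hk i' h)
      rcases isLE_or_prec k hN with ⟨i, rfl, hi⟩ | hk
      · rcases isLE_or_prec l hN with ⟨i', rfl, hi'⟩ | hl
        · exact (hLE _ i _ hi fun _ h => by cases h; exact hi').1
        · rw [defect_symm, LinearMap.neg_apply, defect_of_isLE bas χ (Or.inr (hmin hl hi)) hi,
            neg_zero]
      · rcases isLE_or_prec l hN with ⟨i', rfl, hi'⟩ | hl
        · exact defect_of_isLE bas χ (Or.inr (hmin hk hi')) hi'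
        · have h1 := ih N hdeg (bas (Sum.inl j)) ⁅bas k, bas l⁆
          have h2 := ih N hdeg (bas k) (bas l)
          rw [defect_apply, sub_eq_zero] at h1 h2
          have h3 : ⁅bas k, ⁅bas l, bas (Sum.inl j)⁆⁆ =
              ⁅⁅bas k, bas l⁆, bas (Sum.inl j)⁆ + ⁅bas l, ⁅bas k, bas (Sum.inl j)⁆⁆ :=
            leibniz_lie _ _ _
          rw [← lie_skew, map_neg, LinearMap.neg_apply] at h1
          rw [defect_apply, hprec hk hl, hprec hl hk, h3, ← act_of_LE bas χ hN]
          rw [h2, map_sub] at h1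
          simp only [map_add, LinearMap.add_apply]
          linear_combination h1
  obtain ⟨n, hn⟩ := exists_mem_degLT p
  exact (Submodule.mem_bot K).1 (map_mem_of_degLT _ ⊥
    (fun M _ => (Submodule.mem_bot K).2 (key M x y)) hn)

theorem act_lie (hχ : ∀ k l : J, act bas χ ⁅bas (Sum.inr k), bas (Sum.inr l)⁆ 1 = 0) (x y : L)
    (p : MvPolynomial I K) :
    act bas χ ⁅x, y⁆ p = act bas χ x (act bas χ y p) - act bas χ y (act bas χ x p) :=
  sub_eq_zero.1 (defect_eq_zero bas χ hχ x y p)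

end Straightening
end Paper

namespace Paper

open MvPolynomial

namespace Straightening

variable {K L I J V : Type} [Field K] [LieRing L] [LieAlgebra K L] [LinearOrder I]
variable [AddCommGroup V] [Module K V]

/-- The linear map sending a monomial to the corresponding ordered product of operators applied
to `v`. -/
noncomputable def ordProd (A : I → V →ₗ[K] V) (v : V) : MvPolynomial I K →ₗ[K] V :=
  (basisMonomials I K).constr K fun M => (Finsupp.toMultiset M).sort.foldr (fun i u => A i u) v

theorem ordProd_monomial (A : I → V →ₗ[K] V) (v : V) (M : I →₀ ℕ) :
    ordProd A v (monomial M 1) = (Finsupp.toMultiset M).sort.foldr (fun i u => A i u) v := by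
  have := (basisMonomials I K).constr_basis K
    (fun M => (Finsupp.toMultiset M).sort.foldr (fun i u => A i u) v) M
  rwa [coe_basisMonomials] at this

theorem ordProd_one (A : I → V →ₗ[K] V) (v : V) : ordProd A v 1 = v := by
  rw [show (1 : MvPolynomial I K) = monomial 0 1 from rfl, ordProd_monomial]
  simp

theorem ordProd_single_add (A : I → V →ₗ[K] V) (v : V) {j : I} {N : I →₀ ℕ} (h : IsLE j N) :
    ordProd A v (monomial (Finsupp.single j 1 + N) 1) = A j (ordProd A v (monomial N 1)) := by
  rw [ordProd_monomial, ordProd_monomial, map_add, Finsupp.toMultiset_single, one_smul,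
    Multiset.singleton_add, Multiset.sort_cons, List.foldr_cons]
  intro b hb
  exact h b (Finsupp.mem_toMultiset N b |>.1 hb)

theorem linearMap_ext {A B : MvPolynomial I K →ₗ[K] V}
    (h : ∀ M : I →₀ ℕ, A (monomial M 1) = B (monomial M 1)) : A = B := by
  refine (basisMonomials I K).ext fun M => ?_
  rw [coe_basisMonomials]
  exact h M

theorem ordProd_unique {A : I → V →ₗ[K] V} {T : MvPolynomial I K →ₗ[K] V}
    (h : ∀ (j : I) (N : I →₀ ℕ), IsLE j N →
      T (monomial (Finsupp.single j 1 + N) 1) = A j (T (monomial N 1))) :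
    T = ordProd A (T 1) := by
  refine linearMap_ext fun M => ?_
  refine monomial_induction (p := fun M => T (monomial M 1) = ordProd A (T 1) (monomial M 1)) M
    (fun _ => ?_) fun j N hN ih => ?_
  · rw [show (monomial 0 1 : MvPolynomial I K) = 1 from rfl, ordProd_one]
  · rw [h j N hN, ordProd_single_add _ _ hN, ih N (Nat.lt_succ_self _)]

variable (bas : Module.Basis (I ⊕ J) K L) (χ : J → K)

theorem ordProd_act_one :
    ordProd (fun i => act bas χ (bas (Sum.inl i))) 1 = LinearMap.id := by
  refine (ordProd_unique (T := LinearMap.id) fun j N hN => ?_).symm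
  rw [LinearMap.id_apply, LinearMap.id_apply, act_of_LE bas χ hN]

theorem ordProd_act (φ : L →ₗ[K] V →ₗ[K] V)
    (hφ : ∀ x y v, φ ⁅x, y⁆ v = φ x (φ y v) - φ y (φ x v)) (v : V)
    (hv : ∀ k : J, φ (bas (Sum.inr k)) v = χ k • v) (x : L) (p : MvPolynomial I K) :
    ordProd (fun i => φ (bas (Sum.inl i))) v (act bas χ x p) =
      φ x (ordProd (fun i => φ (bas (Sum.inl i))) v p) := by
  set T := ordProd (fun i => φ (bas (Sum.inl i))) v with hT
  have key : ∀ M : I →₀ ℕ, ∀ x, T (act bas χ x (monomial M 1)) = φ x (T (monomial M 1)) := by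
    have hLE : ∀ {i : I} {M : I →₀ ℕ}, IsLE i M →
        T (act bas χ (bas (Sum.inl i)) (monomial M 1)) = φ (bas (Sum.inl i)) (T (monomial M 1)) := by
      intro i M h
      rw [act_of_LE bas χ h, hT, ordProd_single_add _ _ h]
    have hext : ∀ M : I →₀ ℕ, (∀ k, T (act bas χ (bas k) (monomial M 1)) =
        φ (bas k) (T (monomial M 1))) →
        ∀ x, T (act bas χ x (monomial M 1)) = φ x (T (monomial M 1)) := by
      intro M h x
      have : T ∘ₗ (act bas χ).flip (monomial M 1) = φ.flip (T (monomial M 1)) :=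
        bas.ext fun k => h k
      exact LinearMap.congr_fun this x
    intro M
    refine monomial_induction (p := fun M => ∀ x, T (act bas χ x (monomial M 1)) =
      φ x (T (monomial M 1))) M (fun h0 => ?_) fun j N hN ih => ?_
    · refine hext _ fun k => ?_
      rcases k with i | k
      · exact hLE (h0 i)
      · rw [show (monomial 0 1 : MvPolynomial I K) = 1 from rfl, act_one, map_smul, hT,
          ordProd_one, hv]
    · refine hext _ fun k => ?_
      rcases isLE_or_prec k hN with ⟨i, rfl, hi⟩ | hk
      · exact hLE hi
      · have h1 := map_act_eq_zero bas χ
          (T ∘ₗ act bas χ (bas (Sum.inl j)) - φ (bas (Sum.inl j)) ∘ₗ T) hN hk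
          (fun M hM => sub_eq_zero.2 (ih M hM _)) (fun M hM => sub_eq_zero.2 (hLE hM))
        have h2 : T (act bas χ (bas (Sum.inl j)) (act bas χ (bas k) (monomial N 1))) =
          φ (bas (Sum.inl j)) (T (act bas χ (bas k) (monomial N 1))) := sub_eq_zero.1 h1
        have hN' := ih N (Nat.lt_succ_self _)
        rw [act_single_add bas χ hN hk, map_add, h2, hN', hN', hφ, ← act_of_LE bas χ hN, hN']
        abel
  exact LinearMap.congr_fun (linearMap_ext (A := T ∘ₗ act bas χ x) (B := φ x ∘ₗ T)
    fun M => key M x) p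

theorem act_inl_eq (χ χ' : J → K)
    (hI : ∀ i i' : I, ⁅bas (Sum.inl i), bas (Sum.inl i')⁆ ∈
      Submodule.span K (Set.range fun i => bas (Sum.inl i))) (i : I) :
    act bas χ (bas (Sum.inl i)) = act bas χ' (bas (Sum.inl i)) := by
  refine linearMap_ext fun M => ?_
  refine monomial_induction (p := fun M => ∀ i, act bas χ (bas (Sum.inl i)) (monomial M 1) =
    act bas χ' (bas (Sum.inl i)) (monomial M 1)) M (fun h0 i => ?_) (fun j N hN ih i => ?_) i
  · rw [act_of_LE _ _ (h0 i), act_of_LE _ _ (h0 i)]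
  · rcases isLE_or_prec (Sum.inl i : I ⊕ J) hN with ⟨i', hii, hi⟩ | hk
    · cases hii
      rw [act_of_LE _ _ hi, act_of_LE _ _ hi]
    · have hspan : ∀ y ∈ Submodule.span K (Set.range fun i => bas (Sum.inl i)),
          act bas χ y (monomial N 1) = act bas χ' y (monomial N 1) := by
        intro y hy
        induction hy using Submodule.span_induction with
        | mem y hy =>
          obtain ⟨i, rfl⟩ := hy
          exact ih N (Nat.lt_succ_self _) i
        | zero => simp
        | add y y' _ _ h h' => rw [map_add, map_add, LinearMap.add_apply, LinearMap.add_apply, h, h']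
        | smul c y _ h => rw [map_smul, map_smul, LinearMap.smul_apply, LinearMap.smul_apply, h]
      have h1 := map_act_eq_zero bas χ
          (act bas χ (bas (Sum.inl j)) - act bas χ' (bas (Sum.inl j))) hN hk
          (fun M hM => sub_eq_zero.2 (ih M hM j))
          (fun M hM => sub_eq_zero.2 (by rw [act_of_LE _ _ hM, act_of_LE _ _ hM]))
      rw [LinearMap.sub_apply, sub_eq_zero, ih N (Nat.lt_succ_self _) i] at h1
      rw [act_single_add bas χ hN hk, act_single_add bas χ' hN hk,
        ih N (Nat.lt_succ_self _) i, h1, hspan _ (hI i j)]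

theorem act_affine (χ δ : J → K)
    (hI : ∀ i i' : I, ⁅bas (Sum.inl i), bas (Sum.inl i')⁆ ∈
      Submodule.span K (Set.range fun i => bas (Sum.inl i))) (t : K) (x : L) :
    act bas (χ + t • δ) x = act bas χ x + t • (act bas (χ + δ) x - act bas χ x) := by
  have hext : ∀ M : I →₀ ℕ, (∀ k, act bas (χ + t • δ) (bas k) (monomial M 1) =
      act bas χ (bas k) (monomial M 1) +
        t • (act bas (χ + δ) (bas k) (monomial M 1) - act bas χ (bas k) (monomial M 1))) →
      ∀ x, act bas (χ + t • δ) x (monomial M 1) = act bas χ x (monomial M 1) +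
        t • (act bas (χ + δ) x (monomial M 1) - act bas χ x (monomial M 1)) := by
    intro M h x
    have : (act bas (χ + t • δ)).flip (monomial M 1) = (act bas χ).flip (monomial M 1) +
        t • ((act bas (χ + δ)).flip (monomial M 1) - (act bas χ).flip (monomial M 1)) :=
      bas.ext fun k => h k
    exact LinearMap.congr_fun this x
  refine linearMap_ext fun M => ?_
  refine monomial_induction (p := fun M => ∀ x, act bas (χ + t • δ) x (monomial M 1) =
      act bas χ x (monomial M 1) +
        t • (act bas (χ + δ) x (monomial M 1) - act bas χ x (monomial M 1))) M (fun h0 => ?_)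
      (fun j N hN ih => ?_) x
  · refine hext _ fun k => ?_
    rcases k with i | k
    · simp only [act_of_LE _ _ (h0 i), sub_self, smul_zero, add_zero]
    · simp only [show (monomial 0 1 : MvPolynomial I K) = 1 from rfl, act_one, Pi.add_apply,
        Pi.smul_apply, smul_eq_mul]
      module
  · refine hext _ fun k => ?_
    rcases isLE_or_prec k hN with ⟨i, rfl, hi⟩ | hk
    · simp only [act_of_LE _ _ hi, sub_self, smul_zero, add_zero]
    · rw [act_single_add bas _ hN hk, act_single_add bas _ hN hk, act_single_add bas _ hN hk,
        ih N (Nat.lt_succ_self _), ih N (Nat.lt_succ_self _), act_inl_eq bas (χ + t • δ) χ hI,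
        act_inl_eq bas (χ + δ) χ hI, map_add, map_smul, map_sub]
      module

theorem mem_degLT_iff {n : ℕ} {p : MvPolynomial I K} :
    p ∈ degLT K I n ↔ ∀ M ∈ p.support, M.degree < n := by
  constructor
  · intro hp
    induction hp using Submodule.span_induction with
    | mem p hp =>
      obtain ⟨M, hM, rfl⟩ := hp
      intro N hN
      rw [Finset.mem_singleton.1 (support_monomial_subset hN)]
      exact hM
    | zero => simp
    | add p q _ _ hp hq =>
      classical
      intro M hM
      rcases Finset.mem_union.1 (support_add hM) with h | h
      · exact hp M h
      · exact hq M h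
    | smul c p _ hp => exact fun M hM => hp M (support_smul hM)
  · intro h
    rw [p.as_sum]
    refine sum_mem fun M hM => ?_
    rw [← mul_one (coeff M p), ← smul_eq_mul, ← smul_monomial]
    exact Submodule.smul_mem _ _ (monomial_mem_degLT (h M hM))

theorem mem_degLT_totalDegree (p : MvPolynomial I K) : p ∈ degLT K I (p.totalDegree + 1) := by
  rw [mem_degLT_iff]
  intro M hM
  exact Nat.lt_succ_of_le (le_totalDegree hM)

theorem totalDegree_lt_of_mem_degLT {n : ℕ} {p : MvPolynomial I K} (hp : p ∈ degLT K I n)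
    (h0 : p ≠ 0) : p.totalDegree < n := by
  rw [mem_degLT_iff] at hp
  have hn : 0 < n := by
    obtain ⟨M, hM⟩ := support_nonempty.2 h0
    exact (Nat.zero_le _).trans_lt (hp M hM)
  rw [totalDegree, Finset.sup_lt_iff hn]
  exact fun M hM => hp M hM

theorem monomial_mul_mem_degLT (N : I →₀ ℕ) {n : ℕ} {p : MvPolynomial I K} (hp : p ∈ degLT K I n) :
    monomial N 1 * p ∈ degLT K I (N.degree + n) := by
  refine map_mem_of_degLT (LinearMap.mulLeft K (monomial N 1)) _ (fun M hM => ?_) hp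
  rw [LinearMap.mulLeft_apply, monomial_mul, mul_one]
  exact monomial_mem_degLT (by rw [map_add]; omega)

theorem act_sub_mul_mem (i : I) {n : ℕ} {p : MvPolynomial I K} (hp : p ∈ degLT K I n) :
    act bas χ (bas (Sum.inl i)) p - monomial (Finsupp.single i 1) 1 * p ∈ degLT K I n := by
  refine map_mem_of_degLT (act bas χ (bas (Sum.inl i)) -
    LinearMap.mulLeft K (monomial (Finsupp.single i 1) 1)) _ (fun M hM => ?_) hp
  rw [LinearMap.sub_apply, LinearMap.mulLeft_apply, monomial_mul, mul_one]
  exact degLT_mono (Nat.succ_le_of_lt hM) (act_sub_lead_mem bas χ (Sum.inl i) M)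

theorem ordProd_sub_mul_mem {d : ℕ} {w : MvPolynomial I K} (hw : w ∈ degLT K I (d + 1))
    (M : I →₀ ℕ) : ordProd (fun i => act bas χ (bas (Sum.inl i))) w (monomial M 1) -
      monomial M 1 * w ∈ degLT K I (M.degree + d) := by
  set T := ordProd (fun i => act bas χ (bas (Sum.inl i))) w with hT
  refine monomial_induction (p := fun M => T (monomial M 1) - monomial M 1 * w ∈
    degLT K I (M.degree + d)) M (fun _ => ?_) fun j N hN ih => ?_
  · rw [show (monomial 0 1 : MvPolynomial I K) = 1 from rfl, hT, ordProd_one, one_mul, sub_self]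
    exact zero_mem _
  · have h1 := ih N (Nat.lt_succ_self _)
    have h2 : T (monomial N 1) ∈ degLT K I (N.degree + (d + 1)) := by
      have := add_mem (degLT_mono (by omega) h1) (monomial_mul_mem_degLT N hw)
      rwa [sub_add_cancel] at this
    have h3 := act_sub_mul_mem bas χ j h2
    have h4 := monomial_mul_mem_degLT (Finsupp.single j 1) h1
    have h5 : (monomial (Finsupp.single j 1 + N) 1 : MvPolynomial I K) =
      monomial (Finsupp.single j 1) 1 * monomial N 1 := by rw [monomial_mul, mul_one]
    have h6 := add_mem (degLT_mono (n := (Finsupp.single j 1 + N).degree + d)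
      (by rw [map_add, Finsupp.degree_single]; omega) h3)
      (degLT_mono (by rw [map_add]; omega) h4)
    rw [mul_sub, sub_add_sub_cancel, ← mul_assoc, ← h5] at h6
    rwa [hT, ordProd_single_add _ _ hN]

theorem ordProd_act_injective {w : MvPolynomial I K} (hw : w ≠ 0) :
    Function.Injective (ordProd (fun i => act bas χ (bas (Sum.inl i))) w) := by
  rw [injective_iff_map_eq_zero]
  intro p hp
  by_contra hp0
  have h1 := map_mem_of_degLT (ordProd (fun i => act bas χ (bas (Sum.inl i))) w -
    (LinearMap.mul K (MvPolynomial I K)).flip w) (degLT K I (p.totalDegree + w.totalDegree))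
    (fun M hM => degLT_mono (by omega) (ordProd_sub_mul_mem bas χ (mem_degLT_totalDegree w) M))
    (mem_degLT_totalDegree p)
  rw [LinearMap.sub_apply, hp, zero_sub, neg_mem_iff, LinearMap.flip_apply,
    LinearMap.mul_apply'] at h1
  have h2 := totalDegree_lt_of_mem_degLT h1 (mul_ne_zero hp0 hw)
  rw [totalDegree_mul_of_isDomain hp0 hw] at h2
  exact lt_irrefl _ h2

end Straightening
end Paper

namespace Paper

namespace Setup

variable {K : Type} [Field K] [CharZero K] [IsAlgClosed K] {g : Type} [LieRing g] [LieAlgebra K g]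
variable {S : Setup K g}

/-- The extension of a functional on `h` by zero on all root spaces. -/
noncomputable def extend (S : Setup K g) (lam : Module.Dual K S.h) : g →ₗ[K] K :=
  (lam : S.h.toSubmodule →ₗ[K] K) ∘ₗ
    (S.proj 0).codRestrict S.h.toSubmodule fun x => S.mem_W_zero.1 (S.proj_mem 0 x)

theorem extend_h (lam : Module.Dual K S.h) (H : S.h) : S.extend lam H = lam H := by
  have h1 : S.proj 0 (H : g) = H := S.proj_self (S.mem_W_zero.2 H.2)
  exact congrArg lam (Subtype.ext h1)

theorem extend_of_proj (lam : Module.Dual K S.h) {x : g} (hx : S.proj 0 x = 0) :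
    S.extend lam x = 0 := by
  refine (congrArg lam (Subtype.ext hx : _ = (0 : S.h))).trans (map_zero lam)

theorem extend_of_mem_W (lam : Module.Dual K S.h) {α : Module.Dual K S.h} (hα : α ≠ 0) {x : g}
    (hx : x ∈ S.W α) : S.extend lam x = 0 := extend_of_proj lam (S.proj_of_ne hx hα)

theorem lie_mem_b {x y : g} (hx : x ∈ S.b) (hy : y ∈ S.b) : ⁅x, y⁆ ∈ S.b := S.b.lie_mem hx hy

theorem proj_zero_lie {x y : g} (hx : x ∈ S.b) (hy : y ∈ S.b) : S.proj 0 ⁅x, y⁆ = 0 := by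
  have hWW : ∀ α γ : Module.Dual K S.h, α = 0 ∨ α ∈ S.pos → γ ∈ S.pos → ∀ x ∈ S.W α, ∀ y ∈ S.W γ,
      S.proj 0 ⁅x, y⁆ = 0 := by
    intro α γ hα hγ x hx y hy
    refine S.proj_of_ne (S.lie_mem_W hx hy) ?_
    rcases hα with rfl | hα
    · rw [zero_add]; rintro rfl; exact zero_notMem_pos hγ
    · intro h
      rw [← neg_eq_of_add_eq_zero_right h] at hγ
      exact neg_notMem_pos hα hγ
  refine b_induction (p := fun x => S.proj 0 ⁅x, y⁆ = 0) ?_ ?_ ?_ hx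
  · intro x x' h h'
    rw [add_lie, map_add, h, h', add_zero]
  · intro x hx
    refine b_induction (p := fun y => S.proj 0 ⁅x, y⁆ = 0) ?_ ?_ ?_ hy
    · intro x x' h h'
      rw [lie_add, map_add, h, h', add_zero]
    · intro y hy
      rw [S.h_lie_h ⟨x, hx⟩ ⟨y, hy⟩, map_zero]
    · intro α hα y hy
      exact hWW 0 α (Or.inl rfl) hα x (S.mem_W_zero.2 hx) y hy
  · intro α hα x hx
    refine b_induction (p := fun y => S.proj 0 ⁅x, y⁆ = 0) ?_ ?_ ?_ hy
    · intro x x' h h'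
      rw [lie_add, map_add, h, h', add_zero]
    · intro y hy
      rw [← lie_skew, map_neg, hWW 0 α (Or.inl rfl) hα y (S.mem_W_zero.2 hy) x hx, neg_zero]
    · intro γ hγ y hy
      exact hWW α γ (Or.inr hα) hγ x hx y hy

theorem exists_neg_mem (hD : S.IsDynkin) {α : Module.Dual K S.h} (hα : α ∈ S.pos) :
    ∃ f ∈ S.W (-α), f ≠ 0 := IsRoot.exists_mem (IsRoot.neg hD (S.pos_root α hα))

theorem eq_zero_or_pos_or_neg_pos {α : Module.Dual K S.h} {x : g} (hx : x ∈ S.W α) (hx0 : x ≠ 0) :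
    α = 0 ∨ α ∈ S.pos ∨ -α ∈ S.pos := by
  by_cases h0 : α = 0
  · exact Or.inl h0
  by_cases h : α ∈ S.pos
  · exact Or.inr (Or.inl h)
  · exact Or.inr (Or.inr (IsRoot.neg_mem_pos (isRootOf_of_mem h0 hx hx0) h))

theorem exists_basis (hD : S.IsDynkin) :
    ∃ (J : Type) (bas : Module.Basis (S.pos ⊕ J) K g),
      (∀ i : S.pos, bas (Sum.inl i) ∈ S.W (-(i : Module.Dual K S.h))) ∧
      (∀ i : S.pos, ∀ x ∈ S.W (-(i : Module.Dual K S.h)), ∃ c : K, x = c • bas (Sum.inl i)) ∧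
      (∀ k, bas (Sum.inr k) ∈ S.b) ∧
      ∀ x ∈ S.b, x ∈ Submodule.span K (Set.range fun k => bas (Sum.inr k)) := by
  choose! f hf hf0 using fun α (hα : α ∈ S.pos) => exists_neg_mem hD hα
  set v : S.pos → g := fun i => f i with hv
  have hvm : ∀ i : S.pos, v i ∈ S.W (-(i : Module.Dual K S.h)) := fun i => hf i i.2
  have hv0 : ∀ i : S.pos, v i ≠ 0 := fun i => hf0 i i.2
  have hsm : ∀ i : S.pos, ∀ x ∈ S.W (-(i : Module.Dual K S.h)), ∃ c : K, x = c • v i :=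
    fun i x hx => exists_smul_eq hD
      (neg_ne_zero.2 (S.pos_root i i.2).1) (hvm i) (hv0 i) hx
  have hli : LinearIndependent K v := by
    have h1 : iSupIndep fun i : S.pos => S.W (-(i : Module.Dual K S.h)) :=
      S.h_indep.comp (f := fun i : S.pos => -(i : Module.Dual K S.h))
        (neg_injective.comp Subtype.val_injective)
    exact h1.linearIndependent _ hvm hv0
  have hproj : ∀ x ∈ Submodule.span K (Set.range v), ∀ γ, S.proj γ x ≠ 0 → -γ ∈ S.pos := by
    intro x hx
    induction hx using Submodule.span_induction with
    | mem x hx =>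
      obtain ⟨i, rfl⟩ := hx
      intro γ hγ
      by_cases h : -(i : Module.Dual K S.h) = γ
      · rw [← h, neg_neg]; exact i.2
      · exact absurd (S.proj_of_ne (hvm i) h) hγ
    | zero => intro γ h; simp at h
    | add x y _ _ hx hy =>
      intro γ h
      by_cases h1 : S.proj γ x = 0
      · refine hy γ fun h2 => h ?_
        rw [map_add, h1, h2, add_zero]
      · exact hx γ h1
    | smul c x _ hx =>
      intro γ h
      refine hx γ fun h2 => h ?_
      rw [map_smul, h2, smul_zero]
  have hcompl : IsCompl (Submodule.span K (Set.range v)) S.b.toSubmodule := by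
    constructor
    · rw [Submodule.disjoint_def]
      intro x hx hxb
      refine S.eq_zero_of_proj fun γ => ?_
      by_contra h
      have h1 := hproj x hx γ h
      rcases mem_b_iff.1 hxb γ h with rfl | h2
      · rw [neg_zero] at h1; exact zero_notMem_pos h1
      · exact neg_notMem_pos h2 h1
    · rw [codisjoint_iff, eq_top_iff]
      intro x _
      refine S.W_induction (p := fun x => x ∈ Submodule.span K (Set.range v) ⊔ S.b.toSubmodule)
        (fun x y => add_mem) (fun α x hx => ?_) x
      by_cases hx0 : x = 0
      · rw [hx0]; exact zero_mem _
      rcases eq_zero_or_pos_or_neg_pos hx hx0 with rfl | h | h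
      · exact Submodule.mem_sup_right (h_le_b (S.mem_W_zero.1 hx))
      · exact Submodule.mem_sup_right (W_le_b h hx)
      · obtain ⟨c, rfl⟩ := hsm ⟨-α, h⟩ x (by rw [neg_neg]; exact hx)
        exact Submodule.mem_sup_left (Submodule.smul_mem _ _ (Submodule.subset_span ⟨_, rfl⟩))
  set bb := Module.Basis.ofVectorSpace K S.b.toSubmodule with hbb
  set bas := ((Module.Basis.span hli).prod bb).map (Submodule.prodEquivOfIsCompl _ _ hcompl)
    with hbas
  have hl : ∀ i, bas (Sum.inl i) = v i := by
    intro i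
    simp [hbas, Module.Basis.span_apply]
  have hr : ∀ k, bas (Sum.inr k) = bb k := by
    intro k
    simp [hbas]
  refine ⟨_, bas, fun i => by rw [hl]; exact hvm i, fun i x hx => by rw [hl]; exact hsm i x hx,
    fun k => by rw [hr]; exact (bb k).2, fun x hx => ?_⟩
  simp only [hr]
  have h1 := congrArg (Submodule.subtype _) (bb.linearCombination_repr ⟨x, hx⟩)
  rw [Finsupp.linearCombination_apply, Finsupp.sum, map_sum] at h1
  rw [← show ∑ k ∈ (bb.repr ⟨x, hx⟩).support, _ = x from h1]
  exact sum_mem fun k _ => Submodule.smul_mem _ _ (Submodule.subset_span ⟨k, rfl⟩)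

end Setup
end Paper

namespace Paper

namespace Setup

variable {K : Type} [Field K] [CharZero K] [IsAlgClosed K] {g : Type} [LieRing g] [LieAlgebra K g]
variable {S : Setup K g}

/-- A realization of all Verma modules of `g` on one vector space `P`, the one of highest weight
`lam` being given by the action `act lam`. -/
structure VermaModel (S : Setup K g) where
  /-- the underlying space -/
  P : Type
  [grp : AddCommGroup P]
  [mod : Module K P]
  /-- the highest weight vector -/
  one : P
  one_ne : one ≠ 0
  /-- the action on the Verma module of given highest weight -/
  act : Module.Dual K S.h → g →ₗ[K] P →ₗ[K] P
  act_lie : ∀ lam x y p, act lam ⁅x, y⁆ p = act lam x (act lam y p) - act lam y (act lam x p)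
  act_one : ∀ lam, ∀ x ∈ S.b, act lam x one = S.extend lam x • one
  act_neg : ∀ lam mu, ∀ α ∈ S.pos, ∀ x ∈ S.W (-α), act lam x = act mu x
  act_affine : ∀ lam δ (t : K) x,
    act (lam + t • δ) x = act lam x + t • (act (lam + δ) x - act lam x)
  exists_map : ∀ lam (V : Type) [AddCommGroup V] [Module K V] (φ : g →ₗ[K] V →ₗ[K] V) (v : V),
    (∀ x y u, φ ⁅x, y⁆ u = φ x (φ y u) - φ y (φ x u)) → (∀ x ∈ S.b, φ x v = S.extend lam x • v) →
    ∃ T : P →ₗ[K] V, T one = v ∧ ∀ x p, T (act lam x p) = φ x (T p)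
  map_injective : ∀ lam mu (T : P →ₗ[K] P), (∀ x p, T (act lam x p) = act mu x (T p)) →
    T one ≠ 0 → Function.Injective T
  map_eq_id : ∀ lam (T : P →ₗ[K] P), (∀ x p, T (act lam x p) = act lam x (T p)) →
    T one = one → T = LinearMap.id

attribute [instance] VermaModel.grp VermaModel.mod

open Straightening in
theorem nonempty_vermaModel (hD : S.IsDynkin) : Nonempty (VermaModel S) := by
  obtain ⟨J, bas, hf, hfs, hb, hbs⟩ := exists_basis hD
  let _ : LinearOrder S.pos := IsWellOrder.linearOrder WellOrderingRel
  let χ : Module.Dual K S.h → J → K := fun lam k => S.extend lam (bas (Sum.inr k))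
  have hone : ∀ lam, ∀ x ∈ S.b, act bas (χ lam) x 1 = S.extend lam x • 1 := by
    intro lam x hx
    have key : ∀ y ∈ Submodule.span K (Set.range fun k => bas (Sum.inr k)),
        act bas (χ lam) y 1 = S.extend lam y • 1 := by
      intro y hy
      induction hy using Submodule.span_induction with
      | mem y hy => obtain ⟨k, rfl⟩ := hy; exact Straightening.act_one bas (χ lam) k
      | zero => simp
      | add y z _ _ h h' => rw [map_add, LinearMap.add_apply, h, h', map_add, add_smul]
      | smul c y _ h => rw [map_smul, LinearMap.smul_apply, h, map_smul, smul_assoc]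
    exact key x (hbs x hx)
  have hI : ∀ i i' : S.pos, ⁅bas (Sum.inl i), bas (Sum.inl i')⁆ ∈
      Submodule.span K (Set.range fun i => bas (Sum.inl i)) := by
    intro i i'
    by_cases h0 : ⁅bas (Sum.inl i), bas (Sum.inl i')⁆ = 0
    · rw [h0]; exact zero_mem _
    have h1 := S.lie_mem_W (hf i) (hf i')
    rw [← _root_.neg_add] at h1
    have hne : (i : Module.Dual K S.h) + i' ≠ 0 := by
      intro h
      have := i'.2
      rw [← neg_eq_of_add_eq_zero_right h] at this
      exact neg_notMem_pos i.2 this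
    have h2 := IsRoot.neg hD (isRootOf_of_mem (neg_ne_zero.2 hne) h1 h0)
    rw [neg_neg] at h2
    obtain ⟨c, hc⟩ := hfs ⟨_, S.pos_add _ i.2 _ i'.2 h2⟩ _ h1
    rw [hc]
    exact Submodule.smul_mem _ _ (Submodule.subset_span ⟨_, rfl⟩)
  have hχ : ∀ lam, ∀ k l : J, act bas (χ lam) ⁅bas (Sum.inr k), bas (Sum.inr l)⁆ 1 = 0 := by
    intro lam k l
    rw [hone lam _ (lie_mem_b (hb k) (hb l)), extend_of_proj lam (proj_zero_lie (hb k) (hb l)),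
      zero_smul]
  have hT : ∀ lam (V : Type) [AddCommGroup V] [Module K V] (φ : g →ₗ[K] V →ₗ[K] V)
      (T : MvPolynomial S.pos K →ₗ[K] V), (∀ x p, T (act bas (χ lam) x p) = φ x (T p)) →
      T = ordProd (fun i => φ (bas (Sum.inl i))) (T 1) := by
    intro lam V _ _ φ T h
    refine ordProd_unique fun j N hN => ?_
    rw [← act_of_LE bas (χ lam) hN, h]
  exact ⟨{
    P := MvPolynomial S.pos K
    one := 1
    one_ne := one_ne_zero
    act := fun lam => act bas (χ lam)
    act_lie := fun lam => Straightening.act_lie bas (χ lam) (hχ lam)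
    act_one := hone
    act_neg := fun lam mu α hα x hx => by
      obtain ⟨c, rfl⟩ := hfs ⟨α, hα⟩ x hx
      rw [map_smul, map_smul, act_inl_eq bas (χ lam) (χ mu) hI]
    act_affine := fun lam δ t x => Straightening.act_affine bas (χ lam) (χ δ) hI t x
    exists_map := fun lam V _ _ φ v hφ hv => ⟨_, ordProd_one _ _,
      ordProd_act bas (χ lam) φ hφ v fun k => hv _ (hb k)⟩
    map_injective := fun lam mu T h h1 => by
      rw [hT lam _ _ T h]
      exact ordProd_act_injective bas (χ mu) h1
    map_eq_id := fun lam T h h1 => by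
      rw [hT lam _ _ T h, h1, ordProd_act_one] }⟩

end Setup
end Paper

namespace Paper

section Env

variable {K g V V' : Type} [Field K] [LieRing g] [LieAlgebra K g] [AddCommGroup V] [Module K V]
  [AddCommGroup V'] [Module K V']

attribute [local instance] LieRing.ofAssociativeRing LieAlgebra.ofAssociativeAlgebra

theorem ι_lie (x y : g) : UniversalEnvelopingAlgebra.ι K ⁅x, y⁆ =
    UniversalEnvelopingAlgebra.ι K x * UniversalEnvelopingAlgebra.ι K y -
      UniversalEnvelopingAlgebra.ι K y * UniversalEnvelopingAlgebra.ι K x := by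
  rw [LieHom.map_lie, LieRing.of_associative_ring_bracket]

/-- The canonical map to the enveloping algebra as a linear map. -/
noncomputable def ιLinear (K g : Type) [Field K] [LieRing g] [LieAlgebra K g] : g →ₗ[K] Env K g :=
  ((UniversalEnvelopingAlgebra.ι K : g →ₗ⁅K⁆ Env K g) : g →ₗ[K] Env K g)

theorem exists_algHom (φ : g →ₗ[K] V →ₗ[K] V)
    (hφ : ∀ x y u, φ ⁅x, y⁆ u = φ x (φ y u) - φ y (φ x u)) :
    ∃ Φ : Env K g →ₐ[K] Module.End K V, ∀ x, Φ (UniversalEnvelopingAlgebra.ι K x) = φ x := by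
  let f : g →ₗ⁅K⁆ Module.End K V :=
    { toFun := φ
      map_add' := φ.map_add
      map_smul' := φ.map_smul
      map_lie' := fun {x y} => LinearMap.ext fun u => hφ x y u }
  exact ⟨UniversalEnvelopingAlgebra.lift K f, UniversalEnvelopingAlgebra.lift_ι_apply K f⟩

theorem env_induction {p : Env K g → Prop} (halg : ∀ c, p (algebraMap K (Env K g) c))
    (hι : ∀ x, p (UniversalEnvelopingAlgebra.ι K x)) (hmul : ∀ a b, p a → p b → p (a * b))
    (hadd : ∀ a b, p a → p b → p (a + b)) (a : Env K g) : p a := by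
  let A : Subalgebra K (Env K g) :=
    { carrier := {a | p a}
      mul_mem' := fun {a b} => hmul a b
      add_mem' := fun {a b} => hadd a b
      algebraMap_mem' := halg }
  let f : g →ₗ⁅K⁆ A :=
    { toFun := fun x => ⟨UniversalEnvelopingAlgebra.ι K x, hι x⟩
      map_add' := fun x y => Subtype.ext (map_add _ x y)
      map_smul' := fun c x => Subtype.ext (map_smul _ c x)
      map_lie' := fun {x y} => Subtype.ext (ι_lie x y) }
  have h : A.val.comp (UniversalEnvelopingAlgebra.lift K f) = AlgHom.id K (Env K g) := by
    refine UniversalEnvelopingAlgebra.hom_ext K (LieHom.ext fun x => ?_)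
    change ((UniversalEnvelopingAlgebra.lift K f (UniversalEnvelopingAlgebra.ι K x) : A) :
      Env K g) = UniversalEnvelopingAlgebra.ι K x
    rw [UniversalEnvelopingAlgebra.lift_ι_apply]
    rfl
  rw [← AlgHom.id_apply (R := K) a, ← h]
  exact (UniversalEnvelopingAlgebra.lift K f a).2

theorem map_algHom (Φ : Env K g →ₐ[K] Module.End K V) (Φ' : Env K g →ₐ[K] Module.End K V')
    (T : V →ₗ[K] V') (h : ∀ x v, T (Φ (UniversalEnvelopingAlgebra.ι K x) v) =
      Φ' (UniversalEnvelopingAlgebra.ι K x) (T v)) (a : Env K g) (v : V) :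
    T (Φ a v) = Φ' a (T v) := by
  refine env_induction (p := fun a => ∀ v, T (Φ a v) = Φ' a (T v)) ?_ h ?_ ?_ a v
  · intro c v
    simp [Algebra.algebraMap_eq_smul_one]
  · intro a b ha hb v
    rw [map_mul, map_mul, Module.End.mul_apply, Module.End.mul_apply, ha, hb]
  · intro a b ha hb v
    rw [map_add, map_add, LinearMap.add_apply, LinearMap.add_apply, map_add, ha, hb]

end Env

namespace Setup

variable {K : Type} [Field K] [CharZero K] [IsAlgClosed K] {g : Type} [LieRing g] [LieAlgebra K g]
variable {S : Setup K g}

namespace VermaModel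

variable (M : VermaModel S)

/-- The algebra homomorphism given by left multiplication on a Verma module. -/
noncomputable def lmul (lam : Module.Dual K S.h) : Env K g →ₐ[K] Module.End K (S.Verma lam) :=
  Algebra.lsmul K K (S.Verma lam)

theorem lmul_apply (lam : Module.Dual K S.h) (a : Env K g) (v : S.Verma lam) :
    lmul lam a v = a • v := rfl

theorem smul_mk_one (lam : Module.Dual K S.h) (a : Env K g) :
    a • (Submodule.Quotient.mk 1 : S.Verma lam) = Submodule.Quotient.mk a := by
  rw [← Submodule.Quotient.mk_smul, smul_eq_mul, mul_one]

theorem ι_smul_mk_one (lam : Module.Dual K S.h) {x : g} (hx : x ∈ S.b) :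
    UniversalEnvelopingAlgebra.ι K x • (Submodule.Quotient.mk 1 : S.Verma lam) =
      S.extend lam x • (Submodule.Quotient.mk 1 : S.Verma lam) := by
  rw [smul_mk_one]
  refine b_induction (p := fun x => (Submodule.Quotient.mk (UniversalEnvelopingAlgebra.ι K x) :
    S.Verma lam) = S.extend lam x • (Submodule.Quotient.mk 1 : S.Verma lam)) ?_ ?_ ?_ hx
  · intro x y hx hy
    rw [map_add, Submodule.Quotient.mk_add, hx, hy, map_add, add_smul]
  · intro x hx
    rw [extend_h lam ⟨x, hx⟩, ← Submodule.Quotient.mk_smul, Submodule.Quotient.eq,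
      ← Algebra.algebraMap_eq_smul_one]
    exact Submodule.subset_span (Or.inr ⟨⟨x, hx⟩, rfl⟩)
  · intro α hα x hx
    rw [extend_of_mem_W lam (S.pos_root α hα).1 hx, zero_smul, Submodule.Quotient.mk_eq_zero]
    exact Submodule.subset_span (Or.inl ⟨x, Submodule.mem_iSup_of_mem α
      (Submodule.mem_iSup_of_mem hα hx), rfl⟩)

theorem exists_toVerma (lam : Module.Dual K S.h) : ∃ T : M.P →ₗ[K] S.Verma lam,
    T M.one = Submodule.Quotient.mk 1 ∧
      ∀ x p, T (M.act lam x p) = UniversalEnvelopingAlgebra.ι K x • T p := by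
  refine M.exists_map lam (S.Verma lam)
    ((lmul lam).toLinearMap ∘ₗ ιLinear K g)
    (Submodule.Quotient.mk 1) ?_ ?_
  · intro x y u
    change lmul lam (UniversalEnvelopingAlgebra.ι K ⁅x, y⁆) u =
      lmul lam (UniversalEnvelopingAlgebra.ι K x) (lmul lam (UniversalEnvelopingAlgebra.ι K y) u) -
      lmul lam (UniversalEnvelopingAlgebra.ι K y) (lmul lam (UniversalEnvelopingAlgebra.ι K x) u)
    rw [ι_lie, map_sub, map_mul, map_mul]
    rfl
  · intro x hx
    exact ι_smul_mk_one lam hx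

theorem apply_one_eq_zero {lam : Module.Dual K S.h} {Φ : Env K g →ₐ[K] Module.End K M.P}
    (hΦ : ∀ x, Φ (UniversalEnvelopingAlgebra.ι K x) = M.act lam x) {a : Env K g}
    (ha : a ∈ S.vermaIdeal lam) : Φ a M.one = 0 := by
  induction ha using Submodule.span_induction with
  | mem a ha =>
    rcases ha with ⟨x, hx, rfl⟩ | ⟨H, rfl⟩
    · have hxb : x ∈ S.b := by
        change x ∈ S.b.toSubmodule
        rw [S.b_eq]
        exact Submodule.mem_sup_right hx
      have h0 : S.extend lam x = 0 := by
        have h : S.nplus ≤ LinearMap.ker (S.extend lam) := iSup₂_le fun α hα y hy =>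
          extend_of_mem_W lam (S.pos_root α hα).1 hy
        exact h hx
      rw [hΦ, M.act_one lam x hxb, h0, zero_smul]
    · rw [map_sub, hΦ, LinearMap.sub_apply, M.act_one lam _ (h_le_b H.2), extend_h,
        AlgHom.commutes, Module.algebraMap_end_apply, sub_self]
  | zero => rw [map_zero, LinearMap.zero_apply]
  | add a b _ _ ha hb => rw [map_add, LinearMap.add_apply, ha, hb, add_zero]
  | smul c a _ ha => rw [smul_eq_mul, map_mul, Module.End.mul_apply, ha, map_zero]

theorem toVerma_injective {lam : Module.Dual K S.h} {T : M.P →ₗ[K] S.Verma lam}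
    (h1 : T M.one = Submodule.Quotient.mk 1)
    (hT : ∀ x p, T (M.act lam x p) = UniversalEnvelopingAlgebra.ι K x • T p) :
    Function.Injective T := by
  obtain ⟨Φ, hΦ⟩ := exists_algHom (M.act lam) (M.act_lie lam)
  let _ : Module (Env K g) M.P := Module.compHom M.P Φ.toRingHom
  have htow : IsScalarTower K (Env K g) M.P := ⟨fun c u p => by
    change Φ (c • u) p = c • Φ u p
    rw [map_smul, LinearMap.smul_apply]⟩
  let Θ : S.Verma lam →ₗ[Env K g] M.P :=
    (S.vermaIdeal lam).liftQ (LinearMap.toSpanSingleton (Env K g) M.P M.one) fun a ha =>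
      M.apply_one_eq_zero hΦ ha
  have hΘ : (Θ.restrictScalars K) ∘ₗ T = LinearMap.id := by
    refine M.map_eq_id lam _ (fun x p => ?_) ?_
    · rw [LinearMap.comp_apply, hT, LinearMap.restrictScalars_apply, map_smul]
      change Φ (UniversalEnvelopingAlgebra.ι K x) _ = _
      rw [hΦ]
      rfl
    · rw [LinearMap.comp_apply, h1]
      change Φ 1 M.one = _
      rw [map_one, Module.End.one_apply]
  exact Function.LeftInverse.injective (g := Θ) fun p => LinearMap.congr_fun hΘ p

theorem exists_embedding {lam mu : Module.Dual K S.h} {w : M.P} (hw : w ≠ 0)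
    (hb : ∀ x ∈ S.b, M.act lam x w = S.extend mu x • w) :
    ∃ f : S.Verma mu →ₗ[Env K g] S.Verma lam, Function.Injective f := by
  obtain ⟨T, hT1, hT⟩ := M.exists_map mu M.P (M.act lam) w (M.act_lie lam) hb
  have hTi := M.map_injective mu lam T hT (by rw [hT1]; exact hw)
  obtain ⟨Q, hQ1, hQ⟩ := M.exists_toVerma lam
  have hQi := M.toVerma_injective hQ1 hQ
  obtain ⟨R, hR1, hR⟩ := M.exists_toVerma mu
  obtain ⟨Φ, hΦ⟩ := exists_algHom (M.act mu) (M.act_lie mu)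
  have key : ∀ a : Env K g, a • Q w = Q (T (Φ a M.one)) := by
    intro a
    rw [← hT1]
    exact (map_algHom Φ (lmul lam) (Q ∘ₗ T) (fun x v => by
      rw [hΦ, LinearMap.comp_apply, hT, hQ]; rfl) a M.one).symm
  have hmk : ∀ a : Env K g, R (Φ a M.one) = Submodule.Quotient.mk a := by
    intro a
    rw [map_algHom Φ (lmul mu) R (fun x v => by rw [hΦ, hR]; rfl) a M.one, hR1, lmul_apply,
      smul_mk_one]
  refine ⟨(S.vermaIdeal mu).liftQ (LinearMap.toSpanSingleton (Env K g) _ (Q w)) fun a ha => ?_, ?_⟩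
  · rw [LinearMap.mem_ker, LinearMap.toSpanSingleton_apply, key, M.apply_one_eq_zero hΦ ha,
      map_zero, map_zero]
  · rw [injective_iff_map_eq_zero]
    intro v
    obtain ⟨a, rfl⟩ := Submodule.Quotient.mk_surjective _ v
    intro h
    rw [Submodule.liftQ_apply, LinearMap.toSpanSingleton_apply, key] at h
    rw [← hmk, hTi (hQi (h.trans ((congrArg Q (map_zero T)).trans (map_zero Q)).symm)), map_zero]

end VermaModel
end Setup
end Paper

namespace Paper

namespace Setup

variable {K : Type} [Field K] [CharZero K] [IsAlgClosed K] {g : Type} [LieRing g] [LieAlgebra K g]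
variable {S : Setup K g}

open Classical in
/-- A nonzero vector of weight `α`, if there is one. -/
noncomputable def rootVec (S : Setup K g) (α : Module.Dual K S.h) : g :=
  if h : ∃ x ∈ S.W α, x ≠ 0 then h.choose else 0

theorem rootVec_mem (α : Module.Dual K S.h) : S.rootVec α ∈ S.W α := by
  rw [rootVec]
  split_ifs with h
  · exact h.choose_spec.1
  · exact zero_mem _

theorem rootVec_ne_zero {α : Module.Dual K S.h} (h : IsRootOf K g S.h α) : S.rootVec α ≠ 0 := by
  rw [rootVec, dif_pos (IsRoot.exists_mem h)]
  exact (IsRoot.exists_mem h).choose_spec.2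

theorem eq_smul_rootVec (hD : S.IsDynkin) {α : Module.Dual K S.h} (h : IsRootOf K g S.h α) {x : g}
    (hx : x ∈ S.W α) : ∃ c : K, x = c • S.rootVec α :=
  exists_smul_eq hD h.1 (rootVec_mem α) (rootVec_ne_zero h) hx

theorem Triple.exists_rootVec (hD : S.IsDynkin) {β : Module.Dual K S.h} {e f : g} {H : S.h}
    (T : S.Triple β e f H) : ∃ e', S.Triple β e' (S.rootVec (-β)) H := by
  obtain ⟨c, hc⟩ := eq_smul_rootVec hD T.symm.isRootOf T.hf
  refine ⟨c • e, Submodule.smul_mem _ _ T.he, rootVec_mem _, ?_, T.two⟩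
  rw [smul_lie, ← lie_smul, ← hc, T.ef]

theorem IsSimpleRoot.ne_zero {β : Module.Dual K S.h} (h : S.IsSimpleRoot β) : β ≠ 0 :=
  (S.pos_root β h.1).1

theorem IsSimpleRoot.lie_eq_zero {β β' : Module.Dual K S.h} (hβ : S.IsSimpleRoot β)
    (hβ' : S.IsSimpleRoot β') (hne : β ≠ β') {e f : g} (he : e ∈ S.W β) (hf : f ∈ S.W (-β')) :
    ⁅e, f⁆ = 0 := by
  by_contra h0
  rcases eq_zero_or_pos_or_neg_pos (S.lie_mem_W he hf) h0 with h | h | h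
  · exact hne (by rw [← sub_eq_zero, sub_eq_add_neg]; exact h)
  · exact hβ.not_add h hβ'.1 (by abel)
  · exact hβ'.not_add h hβ.1 (by abel)

namespace VermaModel

variable (M : VermaModel S)

/-- The lowering operator of weight `-β`, which does not depend on the highest weight. -/
noncomputable def low (β : Module.Dual K S.h) : Module.End K M.P := M.act 0 (S.rootVec (-β))

theorem act_rootVec_neg {β : Module.Dual K S.h} (hβ : β ∈ S.pos) (lam : Module.Dual K S.h) :
    M.act lam (S.rootVec (-β)) = M.low β := M.act_neg _ _ β hβ _ (rootVec_mem _)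

/-- The span of the products of lowering operators for roots in `B` with total weight `-η`. -/
def words (B : Set (Module.Dual K S.h)) (η : Module.Dual K S.h) : Submodule K (Module.End K M.P) :=
  Submodule.span K {u | ∃ l : List (Module.Dual K S.h), (∀ b ∈ l, b ∈ B) ∧ l.sum = η ∧
    u = (l.map M.low).prod}

variable {M} {B : Set (Module.Dual K S.h)}

theorem prod_mem_words {l : List (Module.Dual K S.h)} (hl : ∀ b ∈ l, b ∈ B) :
    (l.map M.low).prod ∈ M.words B l.sum := Submodule.subset_span ⟨l, hl, rfl, rfl⟩

theorem words_mul {η θ : Module.Dual K S.h} {u v : Module.End K M.P} (hu : u ∈ M.words B η)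
    (hv : v ∈ M.words B θ) : u * v ∈ M.words B (η + θ) := by
  induction hu using Submodule.span_induction with
  | mem u hu =>
    obtain ⟨l, hl, rfl, rfl⟩ := hu
    induction hv using Submodule.span_induction with
    | mem v hv =>
      obtain ⟨l', hl', rfl, rfl⟩ := hv
      rw [← List.prod_append, ← List.map_append, ← List.sum_append]
      refine prod_mem_words fun b hb => ?_
      rcases List.mem_append.1 hb with h | h
      · exact hl b h
      · exact hl' b h
    | zero => rw [mul_zero]; exact zero_mem _
    | add v v' _ _ h h' => rw [mul_add]; exact add_mem h h'
    | smul c v _ h => rw [mul_smul_comm]; exact Submodule.smul_mem _ _ h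
  | zero => rw [zero_mul]; exact zero_mem _
  | add v v' _ _ h h' => rw [add_mul]; exact add_mem h h'
  | smul c v _ h => rw [smul_mul_assoc]; exact Submodule.smul_mem _ _ h

theorem one_mem_words : (1 : Module.End K M.P) ∈ M.words B 0 :=
  prod_mem_words (l := []) (by simp)

theorem low_mem_words {β : Module.Dual K S.h} (hβ : β ∈ B) : M.low β ∈ M.words B β := by
  have := prod_mem_words (M := M) (B := B) (l := [β]) (by simpa using hβ)
  simpa using this

theorem low_pow_mem_words {β : Module.Dual K S.h} (hβ : β ∈ B) (n : ℕ) :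
    M.low β ^ n ∈ M.words B (n • β) := by
  induction n with
  | zero => rw [pow_zero, zero_smul]; exact one_mem_words
  | succ n ih => rw [pow_succ, succ_nsmul]; exact words_mul ih (low_mem_words hβ)

theorem words_mono {B' : Set (Module.Dual K S.h)} (h : B ⊆ B') (η : Module.Dual K S.h) :
    M.words B η ≤ M.words B' η :=
  Submodule.span_mono fun _ ⟨l, hl, h1, h2⟩ => ⟨l, fun b hb => h (hl b hb), h1, h2⟩

theorem act_h_prod (hB : B ⊆ S.pos) (lam : Module.Dual K S.h) (H : S.h)
    {l : List (Module.Dual K S.h)} (hl : ∀ b ∈ l, b ∈ B) :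
    M.act lam H ((l.map M.low).prod M.one) = (lam - l.sum) H • (l.map M.low).prod M.one := by
  induction l with
  | nil =>
    simp [M.act_one lam H (h_le_b H.2), extend_h]
  | cons b l ih =>
    have ih := ih fun b hb => hl b (List.mem_cons_of_mem _ hb)
    have hb : b ∈ S.pos := hB (hl b List.mem_cons_self)
    rw [List.map_cons, List.prod_cons, List.sum_cons, Module.End.mul_apply,
      ← M.act_rootVec_neg hb lam]
    have h1 := M.act_lie lam H (S.rootVec (-b)) ((l.map M.low).prod M.one)
    rw [S.lie_of_mem_W (rootVec_mem (-b)), ih, map_smul, map_smul, LinearMap.smul_apply] at h1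
    have h2 := (eq_sub_iff_add_eq.1 h1).symm
    rw [h2, ← add_smul]
    congr 1
    simp only [LinearMap.sub_apply, LinearMap.add_apply, LinearMap.neg_apply]
    ring

theorem act_h_words (hB : B ⊆ S.pos) (lam : Module.Dual K S.h) (H : S.h) {η : Module.Dual K S.h}
    {u : Module.End K M.P} (hu : u ∈ M.words B η) :
    M.act lam H (u M.one) = (lam - η) H • u M.one := by
  induction hu using Submodule.span_induction with
  | mem u hu => obtain ⟨l, hl, rfl, rfl⟩ := hu; exact act_h_prod hB lam H hl
  | zero => simp
  | add v v' _ _ h h' => rw [LinearMap.add_apply, map_add, h, h', smul_add]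
  | smul c v _ h => rw [LinearMap.smul_apply, map_smul, h, smul_comm]

theorem act_simple_low {β b : Module.Dual K S.h} (hβ : S.IsSimpleRoot β) (hb : S.IsSimpleRoot b)
    {e : g} (he : e ∈ S.W β) (lam : Module.Dual K S.h) (hne : β ≠ b) (p : M.P) :
    M.act lam e (M.low b p) = M.low b (M.act lam e p) := by
  rw [← M.act_rootVec_neg hb.1 lam, ← sub_eq_zero, ← M.act_lie,
    hβ.lie_eq_zero hb hne he (rootVec_mem _), map_zero, LinearMap.zero_apply]

theorem act_of_mem_pos {α : Module.Dual K S.h} (hα : α ∈ S.pos) {e : g} (he : e ∈ S.W α)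
    (lam : Module.Dual K S.h) : M.act lam e M.one = 0 := by
  rw [M.act_one lam e (W_le_b hα he), extend_of_mem_W lam (S.pos_root α hα).1 he, zero_smul]

theorem act_simple_prod (hB : ∀ b ∈ B, S.IsSimpleRoot b) {β : Module.Dual K S.h}
    (hβ : S.IsSimpleRoot β) {e : g} (he : e ∈ S.W β) (lam : Module.Dual K S.h)
    {l : List (Module.Dual K S.h)} (hl : ∀ b ∈ l, b ∈ B) :
    ∃ u ∈ M.words B (l.sum - β), M.act lam e ((l.map M.low).prod M.one) = u M.one := by
  induction l with
  | nil =>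
    refine ⟨0, zero_mem _, ?_⟩
    simp [act_of_mem_pos hβ.1 he]
  | cons b l ih =>
    have hl' : ∀ b ∈ l, b ∈ B := fun b hb => hl b (List.mem_cons_of_mem _ hb)
    obtain ⟨u, hu, h⟩ := ih hl'
    have hbB : b ∈ B := hl b List.mem_cons_self
    have hb := hB b hbB
    have h2 := words_mul (low_mem_words hbB) hu
    rw [List.map_cons, List.prod_cons, List.sum_cons, Module.End.mul_apply]
    by_cases hne : β = b
    · subst hne
      have hh : ⁅e, S.rootVec (-β)⁆ ∈ S.h := by
        have := S.lie_mem_W he (rootVec_mem (-β))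
        rw [add_neg_cancel] at this
        exact S.mem_W_zero.1 this
      have h1 := M.act_lie lam e (S.rootVec (-β)) ((l.map M.low).prod M.one)
      have h3 := act_h_prod (M := M) (fun b hb => (hB b hb).1) lam ⟨_, hh⟩ hl'
      rw [h, M.act_rootVec_neg hb.1, h3] at h1
      refine ⟨M.low β * u + (lam - l.sum) ⟨_, hh⟩ • (l.map M.low).prod, ?_, ?_⟩
      · refine add_mem (by rwa [← add_sub_assoc] at h2) (Submodule.smul_mem _ _ ?_)
        rw [add_sub_cancel_left]
        exact prod_mem_words hl'
      · rw [LinearMap.add_apply, LinearMap.smul_apply, Module.End.mul_apply, h1]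
        abel
    · refine ⟨M.low b * u, by rwa [← add_sub_assoc] at h2, ?_⟩
      rw [act_simple_low hβ hb he lam hne, h, Module.End.mul_apply]

theorem act_simple_words (hB : ∀ b ∈ B, S.IsSimpleRoot b) {β : Module.Dual K S.h}
    (hβ : S.IsSimpleRoot β) {e : g} (he : e ∈ S.W β) (lam : Module.Dual K S.h)
    {η : Module.Dual K S.h} {u : Module.End K M.P} (hu : u ∈ M.words B η) :
    ∃ v ∈ M.words B (η - β), M.act lam e (u M.one) = v M.one := by
  induction hu using Submodule.span_induction with
  | mem u hu => obtain ⟨l, hl, rfl, rfl⟩ := hu; exact act_simple_prod hB hβ he lam hl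
  | zero => exact ⟨0, zero_mem _, by simp⟩
  | add v v' _ _ h h' =>
    obtain ⟨u, hu, h⟩ := h
    obtain ⟨u', hu', h'⟩ := h'
    exact ⟨u + u', add_mem hu hu', by rw [LinearMap.add_apply, map_add, h, h', LinearMap.add_apply]⟩
  | smul c v _ h =>
    obtain ⟨u, hu, h⟩ := h
    exact ⟨c • u, Submodule.smul_mem _ _ hu,
      by rw [LinearMap.smul_apply, map_smul, h, LinearMap.smul_apply]⟩

theorem act_simple_words_of_notMem (hB : ∀ b ∈ B, S.IsSimpleRoot b) {β : Module.Dual K S.h}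
    (hβ : S.IsSimpleRoot β) (hβB : β ∉ B) {e : g} (he : e ∈ S.W β) (lam : Module.Dual K S.h)
    {η : Module.Dual K S.h} {u : Module.End K M.P} (hu : u ∈ M.words B η) :
    M.act lam e (u M.one) = 0 := by
  induction hu using Submodule.span_induction with
  | mem u hu =>
    obtain ⟨l, hl, rfl, rfl⟩ := hu
    induction l with
    | nil => simp [act_of_mem_pos hβ.1 he]
    | cons b l ih =>
      have hb := hl b List.mem_cons_self
      rw [List.map_cons, List.prod_cons, Module.End.mul_apply,
        act_simple_low hβ (hB b hb) he lam (by rintro rfl; exact hβB hb),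
        ih fun b hb => hl b (List.mem_cons_of_mem _ hb), map_zero]
  | zero => simp
  | add v v' _ _ h h' => rw [LinearMap.add_apply, map_add, h, h', add_zero]
  | smul c v _ h => rw [LinearMap.smul_apply, map_smul, h, smul_zero]

theorem finiteDimensional_words (hD : S.IsDynkin) (hBf : B.Finite)
    (hB : ∀ b ∈ B, S.IsSimpleRoot b) (η : Module.Dual K S.h) :
    FiniteDimensional K (M.words B η) := by
  obtain ⟨H, hH⟩ := exists_apply_eq_one hD hBf.toFinset fun b hb => hB b (hBf.mem_toFinset.1 hb)
  refine FiniteDimensional.span_of_finite K ?_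
  have hfin : Finite B := hBf
  obtain ⟨n, hn⟩ : ∃ n : ℕ, ∀ l : List (Module.Dual K S.h), (∀ b ∈ l, b ∈ B) → l.sum = η →
      l.length ≤ n := by
    have hlen : ∀ l : List (Module.Dual K S.h), (∀ b ∈ l, b ∈ B) → l.sum H = l.length := by
      intro l hl
      induction l with
      | nil => simp
      | cons b l ih =>
        rw [List.sum_cons, LinearMap.add_apply, ih fun b hb => hl b (List.mem_cons_of_mem _ hb),
          hH b (hBf.mem_toFinset.2 (hl b List.mem_cons_self)), List.length_cons]
        push_cast
        ring
    by_cases h : ∃ n : ℕ, η H = n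
    · obtain ⟨n, hn⟩ := h
      refine ⟨n, fun l hl hs => le_of_eq ?_⟩
      have := hlen l hl
      rw [hs, hn] at this
      exact_mod_cast this.symm
    · exact ⟨0, fun l hl hs => absurd ⟨_, hs ▸ hlen l hl⟩ h⟩
  refine ((List.finite_length_le B n).image
    fun l => ((l.map Subtype.val).map M.low).prod).subset ?_
  rintro _ ⟨l, hl, hs, rfl⟩
  refine ⟨l.attachWith (· ∈ B) hl, ?_, ?_⟩
  · change (l.attachWith (· ∈ B) hl).length ≤ n
    rw [List.length_attachWith]
    exact hn l hl hs
  · simp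

end VermaModel
end Setup
end Paper

namespace Paper

namespace Setup

variable {K : Type} [Field K] [CharZero K] [IsAlgClosed K] {g : Type} [LieRing g] [LieAlgebra K g]
variable {S : Setup K g}

namespace VermaModel

variable {M : VermaModel S} {B : Set (Module.Dual K S.h)}

theorem exists_low_pow_mul_act {β : Module.Dual K S.h} (hβ : β ∈ B) (k : ℕ) :
    ∀ (θ : Module.Dual K S.h) (z : g), M.act 0 z ∈ M.words B θ →
      ((LieAlgebra.ad K g (S.rootVec (-β))) ^ k) z = 0 → ∀ p t : ℕ, p + k ≤ t →
      ∃ u ∈ M.words B (θ + (t : K) • β - (p : K) • β),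
        M.low β ^ t * (M.act 0 z : Module.End K M.P) = u * M.low β ^ p := by
  induction k with
  | zero =>
    intro θ z _ h p t _
    have hz : z = 0 := h
    exact ⟨0, zero_mem _, by rw [hz, map_zero, mul_zero, zero_mul]⟩
  | succ k ih =>
    intro θ z hz h p
    induction p with
    | zero =>
      intro t _
      refine ⟨_, ?_, (mul_one _).symm⟩
      have h1 := words_mul (low_pow_mem_words hβ t) hz
      have h2 : t • β + θ = θ + (t : K) • β - ((0 : ℕ) : K) • β := by
        rw [Nat.cast_zero, ← Nat.cast_smul_eq_nsmul K]; module
      rwa [h2] at h1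
    | succ p ihp =>
      intro t ht
      obtain ⟨s, rfl⟩ : ∃ s, t = s + 1 := ⟨t - 1, by omega⟩
      have hbr : (M.act 0 ⁅S.rootVec (-β), z⁆ : Module.End K M.P) =
          M.low β * (M.act 0 z : Module.End K M.P) - (M.act 0 z : Module.End K M.P) * M.low β :=
        LinearMap.ext fun q => M.act_lie 0 _ _ q
      have hy : M.act 0 ⁅S.rootVec (-β), z⁆ ∈ M.words B (θ + β) := by
        rw [hbr]
        exact sub_mem (by rw [add_comm]; exact words_mul (low_mem_words hβ) hz)
          (words_mul hz (low_mem_words hβ))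
      obtain ⟨u, hu, h1⟩ := ihp s (by omega)
      obtain ⟨v, hv, h2⟩ := ih (θ + β) _ hy (by
        rw [pow_succ, Module.End.mul_apply, LieAlgebra.ad_apply] at h; exact h)
        (p + 1) s (by omega)
      refine ⟨u + v, add_mem ?_ ?_, ?_⟩
      · have h3 : θ + (s : K) • β - (p : K) • β =
            θ + ((s + 1 : ℕ) : K) • β - ((p + 1 : ℕ) : K) • β := by push_cast; module
        rwa [h3] at hu
      · have h3 : θ + β + (s : K) • β - ((p + 1 : ℕ) : K) • β =
            θ + ((s + 1 : ℕ) : K) • β - ((p + 1 : ℕ) : K) • β := by push_cast; module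
        rwa [h3] at hv
      · rw [add_mul, ← h2, hbr, pow_succ (M.low β) p, ← mul_assoc, ← h1, pow_succ]
        noncomm_ring

theorem exists_low_pow_mul_prod {β : Module.Dual K S.h} (hβ : β ∈ B)
    (hB : ∀ b ∈ B, S.IsSimpleRoot b) (l : List (Module.Dual K S.h)) (hl : ∀ b ∈ l, b ∈ B) :
    ∀ p : ℕ, ∃ N : ℕ, ∀ t ≥ N, ∃ u ∈ M.words B (l.sum + (t : K) • β - (p : K) • β),
      M.low β ^ t * (l.map M.low).prod = u * M.low β ^ p := by
  induction l with
  | nil =>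
    intro p
    refine ⟨p, fun t ht => ⟨M.low β ^ (t - p), ?_, ?_⟩⟩
    · have h1 := low_pow_mem_words (M := M) hβ (t - p)
      have h2 : (t - p) • β =
          (List.nil : List (Module.Dual K S.h)).sum + (t : K) • β - (p : K) • β := by
        rw [List.sum_nil, ← Nat.cast_smul_eq_nsmul K, Nat.cast_sub ht]; module
      rwa [h2] at h1
    · rw [List.map_nil, List.prod_nil, mul_one, ← pow_add, Nat.sub_add_cancel ht]
  | cons b l ih =>
    intro p
    have hb : b ∈ B := hl b List.mem_cons_self
    obtain ⟨N, hN⟩ := ih (fun b hb => hl b (List.mem_cons_of_mem _ hb)) p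
    obtain ⟨k, hk⟩ := S.exists_pow_ad_eq_zero (neg_ne_zero.2 (hB β hβ).ne_zero) (rootVec_mem (-β))
      (S.rootVec (-b))
    refine ⟨N + k, fun t ht => ?_⟩
    obtain ⟨u, hu, h1⟩ := exists_low_pow_mul_act (M := M) hβ k b _ (low_mem_words hb) hk N t ht
    obtain ⟨v, hv, h2⟩ := hN N le_rfl
    refine ⟨u * v, ?_, ?_⟩
    · have h3 := words_mul hu hv
      have h4 : b + (t : K) • β - (N : K) • β + (l.sum + (N : K) • β - (p : K) • β) =
          (b :: l).sum + (t : K) • β - (p : K) • β := by rw [List.sum_cons]; module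
      rwa [h4] at h3
    · change M.low β ^ t * M.low b = _ at h1
      rw [List.map_cons, List.prod_cons, ← mul_assoc, h1, mul_assoc, h2, mul_assoc]

theorem exists_low_pow_mul {β : Module.Dual K S.h} (hβ : β ∈ B)
    (hB : ∀ b ∈ B, S.IsSimpleRoot b) {η : Module.Dual K S.h} {x : Module.End K M.P}
    (hx : x ∈ M.words B η) (p : ℕ) :
    ∃ N : ℕ, ∀ t ≥ N, ∃ u ∈ M.words B (η + (t : K) • β - (p : K) • β),
      M.low β ^ t * x = u * M.low β ^ p := by
  induction hx using Submodule.span_induction with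
  | mem u hu =>
    obtain ⟨l, hl, rfl, rfl⟩ := hu
    exact exists_low_pow_mul_prod hβ hB l hl p
  | zero => exact ⟨0, fun t _ => ⟨0, zero_mem _, by rw [mul_zero, zero_mul]⟩⟩
  | add v v' _ _ h h' =>
    obtain ⟨N, hN⟩ := h
    obtain ⟨N', hN'⟩ := h'
    refine ⟨max N N', fun t ht => ?_⟩
    obtain ⟨u, hu, h1⟩ := hN t (le_of_max_le_left ht)
    obtain ⟨u', hu', h1'⟩ := hN' t (le_of_max_le_right ht)
    exact ⟨u + u', add_mem hu hu', by rw [mul_add, h1, h1', add_mul]⟩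
  | smul c v _ h =>
    obtain ⟨N, hN⟩ := h
    refine ⟨N, fun t ht => ?_⟩
    obtain ⟨u, hu, h1⟩ := hN t ht
    exact ⟨c • u, Submodule.smul_mem _ _ hu, by rw [mul_smul_comm, h1, smul_mul_assoc]⟩

/-- A vector killed by the simple root spaces. -/
def IsSing (M : VermaModel S) (lam : Module.Dual K S.h) (w : M.P) : Prop :=
  ∀ β, S.IsSimpleRoot β → ∀ e ∈ S.W β, M.act lam e w = 0

theorem IsSing.act_eq (hD : S.IsDynkin) {lam nu : Module.Dual K S.h} {w : M.P}
    (hw : M.IsSing lam w) (hH : ∀ H : S.h, M.act lam H w = nu H • w) {x : g} (hx : x ∈ S.b) :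
    M.act lam x w = S.extend nu x • w := by
  let A : LieSubalgebra K g :=
    { carrier := {x | ∃ c : K, M.act lam x w = c • w}
      add_mem' := by
        rintro x y ⟨c, hc⟩ ⟨d, hd⟩
        exact ⟨c + d, by rw [map_add, LinearMap.add_apply, hc, hd, add_smul]⟩
      zero_mem' := ⟨0, by simp⟩
      smul_mem' := by
        rintro a x ⟨c, hc⟩
        exact ⟨a * c, by rw [map_smul, LinearMap.smul_apply, hc, smul_smul]⟩
      lie_mem' := by
        rintro x y ⟨c, hc⟩ ⟨d, hd⟩
        refine ⟨0, ?_⟩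
        rw [M.act_lie, hd, hc, map_smul, map_smul, hd, hc, smul_comm, sub_self, zero_smul] }
  have hA : ∀ y ∈ S.b, ∃ c : K, M.act lam y w = c • w := fun y hy =>
    hD.b_le (A := A) (fun H hH' => ⟨nu ⟨H, hH'⟩, hH ⟨H, hH'⟩⟩)
      (fun β hβ e he => ⟨0, by rw [hw β hβ e he, zero_smul]⟩) hy
  refine b_induction (p := fun x => M.act lam x w = S.extend nu x • w) (fun x y hx hy => ?_)
    (fun H hH' => ?_) (fun γ hγ x hx => ?_) hx
  · rw [map_add, LinearMap.add_apply, hx, hy, map_add, add_smul]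
  · rw [hH ⟨H, hH'⟩, ← extend_h nu ⟨H, hH'⟩]
  · have hγ0 := (S.pos_root γ hγ).1
    obtain ⟨c, hc⟩ := hA x (W_le_b hγ hx)
    obtain ⟨H, hγH⟩ : ∃ H, γ H ≠ 0 := by
      by_contra! h
      exact hγ0 (LinearMap.ext h)
    have h1 := M.act_lie lam H x w
    rw [S.lie_of_mem_W hx, hc, hH, map_smul, map_smul, hH, LinearMap.smul_apply, map_smul, hc,
      smul_comm c, sub_self] at h1
    rw [extend_of_mem_W nu hγ0 hx, zero_smul, hc]
    exact (smul_eq_zero.1 h1).resolve_left hγH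

theorem isSing_one (lam : Module.Dual K S.h) : M.IsSing lam M.one :=
  fun _ hβ _ he => act_of_mem_pos hβ.1 he lam

theorem act_h_one (lam : Module.Dual K S.h) (H : S.h) : M.act lam H M.one = lam H • M.one := by
  rw [M.act_one lam H (h_le_b H.2), extend_h]

theorem slTwoOps {β : Module.Dual K S.h} (hβ : β ∈ S.pos) {e : g} {H : S.h}
    (T : S.Triple β e (S.rootVec (-β)) H) (lam : Module.Dual K S.h) :
    SlTwoOps (M.act lam H : Module.End K M.P) (M.act lam e) (M.low β) := by
  rw [← M.act_rootVec_neg hβ lam]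
  refine ⟨LinearMap.ext fun p => ?_, LinearMap.ext fun p => ?_, LinearMap.ext fun p => ?_⟩ <;>
    simp only [LinearMap.sub_apply, Module.End.mul_apply, ← M.act_lie]
  · rw [T.ef]
  · rw [T.he H, T.two, map_smul]
  · rw [T.hf H, LinearMap.neg_apply, T.two, neg_smul, map_neg, map_smul]

theorem low_pow_one_ne_zero {β : Module.Dual K S.h} (hβ : β ∈ S.pos) {e : g} {H : S.h}
    (T : S.Triple β e (S.rootVec (-β)) H) (n : ℕ) : (M.low β ^ n) M.one ≠ 0 := by
  intro h
  let lam : Module.Dual K S.h := -((2 : K)⁻¹ • β)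
  have hlam : lam H = -1 := by
    simp only [lam, LinearMap.neg_apply, LinearMap.smul_apply, T.two, smul_eq_mul]
    field_simp
  have h1 := (M.slTwoOps hβ T lam).E_pow_F_pow (v := M.one) (μ := -1)
    (by rw [act_h_one, hlam]) (act_of_mem_pos hβ T.he lam) n
  rw [h, map_zero] at h1
  rcases smul_eq_zero.1 h1.symm with h2 | h2
  · obtain ⟨i, -, hi⟩ := Finset.prod_eq_zero_iff.1 h2
    have h3 : ((i : K) + 1) * ((i : K) + 1) = 0 := by linear_combination -hi
    exact Nat.cast_add_one_ne_zero i (mul_self_eq_zero.1 h3)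
  · exact M.one_ne h2

/-- A singular vector generates an image of a Verma module. -/
theorem IsSing.exists_map (hD : S.IsDynkin) {lam nu : Module.Dual K S.h} {w : M.P}
    (hw : M.IsSing lam w) (hH : ∀ H : S.h, M.act lam H w = nu H • w) (hw0 : w ≠ 0) :
    ∃ T : M.P →ₗ[K] M.P, T M.one = w ∧ (∀ x p, T (M.act nu x p) = M.act lam x (T p)) ∧
      Function.Injective T := by
  obtain ⟨T, h1, hT⟩ := M.exists_map nu M.P (M.act lam) w (M.act_lie lam) fun x hx =>
    hw.act_eq hD hH hx
  exact ⟨T, h1, hT, M.map_injective nu lam T hT (by rwa [h1])⟩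

theorem map_low {lam nu : Module.Dual K S.h} {T : M.P →ₗ[K] M.P}
    (hT : ∀ x p, T (M.act nu x p) = M.act lam x (T p)) {β : Module.Dual K S.h} (hβ : β ∈ S.pos)
    (p : M.P) : T (M.low β p) = M.low β (T p) := by
  have := hT (S.rootVec (-β)) p
  rwa [M.act_rootVec_neg hβ, M.act_rootVec_neg hβ] at this

theorem map_words {lam nu : Module.Dual K S.h} {T : M.P →ₗ[K] M.P}
    (hT : ∀ x p, T (M.act nu x p) = M.act lam x (T p)) (hB : B ⊆ S.pos) {η : Module.Dual K S.h}
    {u : Module.End K M.P} (hu : u ∈ M.words B η) (p : M.P) : T (u p) = u (T p) := by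
  induction hu using Submodule.span_induction with
  | mem u hu =>
    obtain ⟨l, hl, rfl, rfl⟩ := hu
    induction l with
    | nil => rfl
    | cons b l ih =>
      rw [List.map_cons, List.prod_cons, Module.End.mul_apply, Module.End.mul_apply,
        map_low hT (hB (hl b List.mem_cons_self)), ih fun b hb => hl b (List.mem_cons_of_mem _ hb)]
  | zero => simp
  | add v v' _ _ h h' => rw [LinearMap.add_apply, map_add, h, h', LinearMap.add_apply]
  | smul c v _ h => rw [LinearMap.smul_apply, map_smul, h, LinearMap.smul_apply]

theorem IsSing.low_pow (hD : S.IsDynkin) {lam nu : Module.Dual K S.h} {w : M.P}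
    (hw : M.IsSing lam w) (hH : ∀ H : S.h, M.act lam H w = nu H • w) {β : Module.Dual K S.h}
    (hβ : S.IsSimpleRoot β) {e : g} {H : S.h} (T : S.Triple β e (S.rootVec (-β)) H) {n : ℕ}
    (hn : nu H = n) : M.IsSing lam ((M.low β ^ (n + 1)) w) := by
  intro b hb x hx
  by_cases hne : b = β
  · subst hne
    obtain ⟨c, rfl⟩ := exists_smul_eq hD hβ.ne_zero T.he T.e_ne_zero hx
    have h1 := (M.slTwoOps hβ.1 T lam).E_F_pow_succ (hH H) (hw b hβ e T.he) n
    rw [map_smul, LinearMap.smul_apply, h1, hn, sub_self, mul_zero, zero_smul, smul_zero]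
  · have h1 : ∀ m : ℕ, M.act lam x ((M.low β ^ m) w) = 0 := by
      intro m
      induction m with
      | zero => exact hw b hb x hx
      | succ m ih => rw [pow_succ', Module.End.mul_apply, act_simple_low hb hβ hx lam hne, ih, map_zero]
    exact h1 _

theorem IsSing.low_pow_ne_zero (hD : S.IsDynkin) {lam nu : Module.Dual K S.h} {w : M.P}
    (hw : M.IsSing lam w) (hH : ∀ H : S.h, M.act lam H w = nu H • w) (hw0 : w ≠ 0)
    {β : Module.Dual K S.h} (hβ : β ∈ S.pos) {e : g} {H : S.h}
    (T : S.Triple β e (S.rootVec (-β)) H) (n : ℕ) : (M.low β ^ n) w ≠ 0 := by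
  obtain ⟨φ, h1, hφ, hinj⟩ := hw.exists_map hD hH hw0
  have h2 : φ ((M.low β ^ n) M.one) = (M.low β ^ n) w := by
    rw [← h1]
    exact map_words hφ (fun _ hb => hb) (low_pow_mem_words hβ n) M.one
  rw [← h2]
  exact (map_ne_zero_iff φ hinj).2 (low_pow_one_ne_zero hβ T n)

end VermaModel
end Setup
end Paper

namespace Paper

/-- If infinitely many members of a pencil of linear maps on a finite-dimensional space are not
injective, then none is. -/
theorem exists_apply_eq_zero_of_pencil {K V U : Type*} [Field K] [AddCommGroup V] [Module K V]
    [FiniteDimensional K V] [AddCommGroup U] [Module K U] (τ σ : V →ₗ[K] U)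
    (h : {t : K | ∃ v, v ≠ 0 ∧ τ v + t • σ v = 0}.Infinite) : ∃ v, v ≠ 0 ∧ τ v = 0 := by
  by_contra! hτ
  obtain ⟨L, hL⟩ := τ.exists_leftInverse_of_injective (LinearMap.ker_eq_bot'.2 fun v hv => by
    by_contra h0
    exact hτ v h0 hv)
  have hLτ : ∀ v, L (τ v) = v := fun v => LinearMap.congr_fun hL v
  refine h ((Module.End.finite_hasEigenvalue (L ∘ₗ σ)).preimage
    (f := fun t : K => -t⁻¹) (fun s _ t _ hst => inv_injective (neg_injective hst)) |>.subset ?_)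
  rintro t ⟨v, hv0, hv⟩
  have h1 := congrArg L hv
  rw [map_add, map_smul, hLτ, map_zero] at h1
  have ht : t ≠ 0 := by
    rintro rfl
    rw [zero_smul, add_zero] at h1
    exact hv0 h1
  refine Module.End.hasEigenvalue_of_hasEigenvector (x := v) ⟨Module.End.mem_eigenspace_iff.2 ?_, hv0⟩
  have h2 := congrArg (fun w => -t⁻¹ • w) (eq_neg_of_add_eq_zero_left h1)
  simp only [neg_smul, smul_neg, neg_neg, inv_smul_smul₀ ht] at h2
  rw [LinearMap.comp_apply, neg_smul, h2]

namespace Setup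

variable {K : Type} [Field K] [CharZero K] [IsAlgClosed K] {g : Type} [LieRing g] [LieAlgebra K g]
variable {S : Setup K g}

namespace VermaModel

variable {M : VermaModel S} {B : Set (Module.Dual K S.h)}

theorem exists_isSing_sub (hD : S.IsDynkin) (hB : ∀ b ∈ B, S.IsSimpleRoot b)
    {β : Module.Dual K S.h} (hβ : β ∈ B) {e : g} {H : S.h} (T : S.Triple β e (S.rootVec (-β)) H)
    {lam mu η : Module.Dual K S.h} {p q : ℕ} (hmu : mu = lam + ((p : K) + 1) • β) (hp : mu H = p)
    (hq : (mu - η) H = q) {u : Module.End K M.P} (hu : u ∈ M.words B η) (hu0 : u M.one ≠ 0)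
    (hs : M.IsSing mu (u M.one)) :
    ∃ v ∈ M.words B (η + ((q + 1 : ℕ) : K) • β - ((p + 1 : ℕ) : K) • β),
      v M.one ≠ 0 ∧ M.IsSing lam (v M.one) := by
  have hBp : B ⊆ S.pos := fun b hb => (hB b hb).1
  have hβs := hB β hβ
  have hlam : mu - (p + 1) • β = lam := by
    rw [hmu, ← Nat.cast_smul_eq_nsmul K]
    push_cast
    module
  have s1 := (M.isSing_one mu).low_pow hD (act_h_one mu) hβs T hp
  have w1 := fun H' => act_h_words hBp mu H' (low_pow_mem_words (M := M) hβ (p + 1))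
  rw [hlam] at w1
  obtain ⟨φ, hφ1, hφ, hinj⟩ := s1.exists_map hD w1 (low_pow_one_ne_zero hβs.1 T _)
  have w2 := fun H' => act_h_words hBp mu H' hu
  have s2 := hs.low_pow hD w2 hβs T hq
  obtain ⟨N, hN⟩ := exists_low_pow_mul hβ hB hu (p + 1)
  have key : ∀ j : ℕ, (∃ v ∈ M.words B (η + ((q + 1 + j : ℕ) : K) • β - ((p + 1 : ℕ) : K) • β),
      φ (v M.one) = (M.low β ^ (q + 1 + j)) (u M.one)) →
      ∃ v ∈ M.words B (η + ((q + 1 : ℕ) : K) • β - ((p + 1 : ℕ) : K) • β),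
      φ (v M.one) = (M.low β ^ (q + 1)) (u M.one) := by
    intro j
    induction j with
    | zero => exact id
    | succ j ih =>
      rintro ⟨v, hv, h⟩
      refine ih ?_
      obtain ⟨v', hv', h'⟩ := act_simple_words hB hβs T.he lam hv
      have h1 : M.act mu e ((M.low β ^ (q + 1 + (j + 1))) (u M.one)) = _ :=
        (M.slTwoOps hβs.1 T mu).E_F_pow_succ (w2 H) (hs β hβs e T.he) (q + 1 + j)
      have h2 := hφ e (v M.one)
      rw [h, h', h1, hq] at h2
      have hc : (((q + 1 + j : ℕ) : K) + 1) * ((q : K) - ((q + 1 + j : ℕ) : K)) ≠ 0 := by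
        refine mul_ne_zero (Nat.cast_add_one_ne_zero _) ?_
        push_cast
        intro h0
        exact Nat.cast_add_one_ne_zero (R := K) j (by linear_combination -h0)
      refine ⟨((((q + 1 + j : ℕ) : K) + 1) * ((q : K) - ((q + 1 + j : ℕ) : K)))⁻¹ • v',
        Submodule.smul_mem _ _ ?_, ?_⟩
      rotate_left
      · rw [LinearMap.smul_apply, map_smul, h2, inv_smul_smul₀ hc]
      · have h3 : η + ((q + 1 + (j + 1) : ℕ) : K) • β - ((p + 1 : ℕ) : K) • β - β =
            η + ((q + 1 + j : ℕ) : K) • β - ((p + 1 : ℕ) : K) • β := by push_cast; module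
        rwa [h3] at hv'
  obtain ⟨v, hv, h⟩ := key N (by
    obtain ⟨v, hv, h⟩ := hN (q + 1 + N) (by omega)
    refine ⟨v, hv, ?_⟩
    rw [map_words hφ hBp hv, hφ1, ← Module.End.mul_apply, ← Module.End.mul_apply, h])
  refine ⟨v, hv, fun h0 => ?_, fun b hb x hx => hinj ?_⟩
  · rw [h0, map_zero] at h
    exact hs.low_pow_ne_zero hD w2 hu0 hβs.1 T _ h.symm
  · rw [hφ, h, s2 b hb x hx, map_zero]

theorem isSing_of_mem_words (hD : S.IsDynkin) (hB : ∀ b ∈ B, S.IsSimpleRoot b)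
    {lam η : Module.Dual K S.h} {u : Module.End K M.P} (hu : u ∈ M.words B η)
    (h : ∀ b ∈ B, M.act lam (S.rootVec b) (u M.one) = 0) : M.IsSing lam (u M.one) := by
  intro β hβ e he
  by_cases hβB : β ∈ B
  · obtain ⟨c, rfl⟩ := eq_smul_rootVec hD (S.pos_root β hβ.1) he
    rw [map_smul, LinearMap.smul_apply, h β hβB, smul_zero]
  · exact act_simple_words_of_notMem hB hβ hβB he lam hu

theorem exists_isSing_of_infinite (hD : S.IsDynkin) (hBf : B.Finite)
    (hB : ∀ b ∈ B, S.IsSimpleRoot b) (lam δ η : Module.Dual K S.h)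
    (h : {t : K | ∃ u ∈ M.words B η, u M.one ≠ 0 ∧ M.IsSing (lam + t • δ) (u M.one)}.Infinite) :
    ∃ u ∈ M.words B η, u M.one ≠ 0 ∧ M.IsSing lam (u M.one) := by
  have := M.finiteDimensional_words hD hBf hB η
  let V := (M.words B η).map (LinearMap.applyₗ M.one)
  have hV : FiniteDimensional K V := inferInstance
  let τ (mu : Module.Dual K S.h) : V →ₗ[K] B → M.P :=
    LinearMap.pi fun b => M.act mu (S.rootVec b) ∘ₗ V.subtype
  have hsub : {t : K | ∃ u ∈ M.words B η, u M.one ≠ 0 ∧ M.IsSing (lam + t • δ) (u M.one)} ⊆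
      {t : K | ∃ v : V, v ≠ 0 ∧ τ lam v + t • (τ (lam + δ) - τ lam) v = 0} := by
    rintro t ⟨u, hu, hu0, hs⟩
    refine ⟨⟨u M.one, u, hu, rfl⟩, fun h1 => hu0 (congrArg Subtype.val h1), funext fun b => ?_⟩
    have h1 := hs b (hB b b.2) _ (rootVec_mem _)
    rw [M.act_affine] at h1
    exact h1
  obtain ⟨⟨_, u, hu, rfl⟩, hu0, h0⟩ := exists_apply_eq_zero_of_pencil _ _ (h.mono hsub)
  refine ⟨u, hu, fun h1 => hu0 (Subtype.ext h1), isSing_of_mem_words hD hB hu fun b hb => ?_⟩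
  exact congrFun h0 ⟨b, hb⟩

theorem exists_isSing (hD : S.IsDynkin) {ρ : Module.Dual K S.h} (hρ : S.IsGlobalRho ρ) (n : ℕ) :
    ∀ (α : Module.Dual K S.h) (e f : g) (H : S.h), α ∈ S.pos → S.Triple α e f H → S.ht α = n →
    ∃ B : Set (Module.Dual K S.h), B.Finite ∧ (∀ b ∈ B, S.IsSimpleRoot b) ∧
      ∀ (lam : Module.Dual K S.h) (k : ℕ), (lam + ρ) H = (k : K) + 1 →
        ∃ u ∈ M.words B (((k : K) + 1) • α), u M.one ≠ 0 ∧ M.IsSing lam (u M.one) := by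
  induction n using Nat.strong_induction_on with
  | _ n ih =>
  intro α e f H hα T hn
  by_cases hs : S.IsSimpleRoot α
  · refine ⟨{α}, Set.finite_singleton α, fun b hb => by rwa [Set.mem_singleton_iff.1 hb],
      fun lam k hk => ?_⟩
    obtain ⟨e', T'⟩ := T.exists_rootVec hD
    refine ⟨M.low α ^ (k + 1), ?_, low_pow_one_ne_zero hα T' _,
      (M.isSing_one lam).low_pow hD (act_h_one lam) hs T' ?_⟩
    · have := low_pow_mem_words (M := M) (B := {α}) rfl (k + 1)
      rw [← Nat.cast_smul_eq_nsmul K] at this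
      push_cast at this
      exact this
    · rw [LinearMap.add_apply, T.rho_apply hD hs hρ] at hk
      exact add_right_cancel hk
  · obtain ⟨β, e', f', H', r, hβ, T', -, hr, hγ, hlt, ⟨e'', f'', Tγ⟩, hind⟩ :=
      exists_reduction hD hα hs T
    obtain ⟨B, hBf, hB, hBs⟩ := ih _ (hn ▸ hlt) _ _ _ _ hγ Tγ rfl
    obtain ⟨δ, hδ', hδ⟩ : ∃ δ : Module.Dual K S.h, δ H' = 1 ∧ δ H = 0 := by
      obtain ⟨δ, hδ, hδ'⟩ := Submodule.exists_le_ker_of_notMem (p := K ∙ H) (v := H')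
        (fun h => by
          obtain ⟨c, hc⟩ := Submodule.mem_span_singleton.1 h
          exact hind c hc.symm)
      refine ⟨(δ H')⁻¹ • δ, ?_, ?_⟩
      · rw [LinearMap.smul_apply, smul_eq_mul, inv_mul_cancel₀ hδ]
      · rw [LinearMap.smul_apply, LinearMap.mem_ker.1 (hδ' (Submodule.mem_span_singleton_self H)),
          smul_zero]
    have hB' : ∀ b ∈ insert β B, S.IsSimpleRoot b := by
      rintro b (rfl | hb)
      exacts [hβ, hB b hb]
    have hρ' := T'.rho_apply hD hβ hρ
    obtain ⟨e₁, T₁⟩ := T'.exists_rootVec hD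
    refine ⟨insert β B, hBf.insert β, hB', fun lam k hk => ?_⟩
    refine exists_isSing_of_infinite hD (hBf.insert β) hB' lam δ _ ((Set.infinite_range_of_injective
      (f := fun p : ℕ => -((p : K) + 1) - (lam + ρ) H') fun p q hpq => ?_).mono ?_)
    · exact_mod_cast add_right_cancel (neg_injective (sub_left_injective hpq))
    · rintro _ ⟨p, rfl⟩
      set t := -((p : K) + 1) - (lam + ρ) H' with ht
      set mu := lam + t • δ + ((p : K) + 1) • β with hmu
      rw [LinearMap.add_apply] at hk ht
      obtain ⟨u, hu, hu0, hs⟩ := hBs mu k (by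
        simp only [hmu, LinearMap.add_apply, LinearMap.smul_apply, map_sub, map_smul, smul_eq_mul,
          hδ, hδ', T'.two, hρ']
        rw [hρ'] at ht
        linear_combination hk - β H * ht)
      obtain ⟨v, hv, hv0, hvs⟩ := exists_isSing_sub hD hB' (Set.mem_insert β B) T₁ hmu
        (q := p + (k + 1) * r)
        (by
          simp only [hmu, LinearMap.add_apply, LinearMap.smul_apply, smul_eq_mul, hδ', T'.two]
          rw [hρ'] at ht
          linear_combination ht)
        (by
          simp only [hmu, LinearMap.add_apply, LinearMap.sub_apply, LinearMap.smul_apply,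
            smul_eq_mul, hδ', T'.two, hr]
          rw [hρ'] at ht
          push_cast
          linear_combination ht)
        (words_mono (Set.subset_insert β B) _ hu) hu0 hs
      refine ⟨v, ?_, hv0, hvs⟩
      have h1 : ((k : K) + 1) • (α - (r : K) • β) + ((p + (k + 1) * r + 1 : ℕ) : K) • β -
          ((p + 1 : ℕ) : K) • β = ((k : K) + 1) • α := by
        push_cast
        module
      rwa [h1] at hv

end VermaModel

/-- **Verma's theorem**, for the coroot provided by an `sl₂`-triple. -/
theorem exists_verma_embedding (hD : S.IsDynkin) {ρ : Module.Dual K S.h} (hρ : S.IsGlobalRho ρ)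
    {lam α : Module.Dual K S.h} (hα : α ∈ S.pos) {H : S.h} (hc : S.IsCoroot α H)
    (hle : S.wle (S.dotReflect ρ α H lam) lam) :
    ∃ f : S.Verma (S.dotReflect ρ α H lam) →ₗ[Env K g] S.Verma lam, Function.Injective f := by
  obtain ⟨s, hs, hsum⟩ := hle
  rw [dotReflect, sub_sub_cancel] at hsum
  obtain ⟨k, hk⟩ := exists_nat_of_smul_eq_sum hD hα hs hsum
  rcases k with _ | k
  · have h1 : S.dotReflect ρ α H lam = lam := by
      rw [dotReflect, hk, Nat.cast_zero, zero_smul, sub_zero]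
    rw [h1]
    exact ⟨LinearMap.id, fun _ _ h => h⟩
  · obtain ⟨e, f, T⟩ := hc.exists_triple
    obtain ⟨M⟩ := nonempty_vermaModel hD
    rw [Nat.cast_succ] at hk
    obtain ⟨B, -, hB, h⟩ := M.exists_isSing hD hρ _ α e f H hα T rfl
    obtain ⟨u, hu, hu0, hsing⟩ := h lam k hk
    rw [← hk] at hu
    exact M.exists_embedding hu0 fun x hx => hsing.act_eq hD
      (fun H' => VermaModel.act_h_words (fun b hb => (hB b hb).1) lam H' hu) hx

end Setup
end Paper

namespace Paper

/-- Verma's theorem.  For `lam ∈ h^*` and a positive root `α` (with coroot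
`Hα`) such that `s_α · lam ≼ lam`, there is an embedding `M(s_α · lam) ↪ M(lam)`. -/
theorem verma_embedding_of_dotReflect_le
    (K : Type) [Field K] [IsAlgClosed K] [CharZero K]
    (g : Type) [LieRing g] [LieAlgebra K g] (S : Setup K g) (hDynkin : S.IsDynkin)
    (ρ : Module.Dual K S.h) (hρ : S.IsGlobalRho ρ)
    (lam α : Module.Dual K S.h) (hα : α ∈ S.pos) (Hα : S.h) (hcoroot : S.IsCoroot α Hα)
    (hle : S.wle (S.dotReflect ρ α Hα lam) lam) :
    ∃ f : S.Verma (S.dotReflect ρ α Hα lam) →ₗ[Env K g] S.Verma lam,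
      Function.Injective f := by
  exact Setup.exists_verma_embedding hDynkin hρ hα hcoroot hle

end Paper
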